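/- For every integer n with 26 ≤ n ≤ 129 that does not lie in the set {27, 34, 35, 37, 39, 41, 43, 45, 47, 49, 51, 52, 53, 55, 56, 58, 59, 61, 66, 69, 70, 75, 76, 77, 78, 79, 81, 83, 87, 88, 89, 91, 93, 94, 95, 96, 97, 99, 100, 101, 103, 105, 106, 107, 109, 111, 112, 113, 115, 116, 117, 118, 119, 120, 123, 124, 125}, there exists a finite group G whose covering number σ(G) equals n. -/

import Mathlib

open scoped ENat

/-- `S` is a cover of the group `G` by proper subgroups: every element of `G`
lies in some member of `S`, and every member of `S` is a proper subgroup. -/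
def IsSubgroupCover {G : Type*} [Group G] (S : Finset (Subgroup G)) : Prop :=
  (∀ H ∈ S, H ≠ ⊤) ∧ ∀ g : G, ∃ H ∈ S, g ∈ H

/-- The covering number `σ(G)`: the least size of a cover of `G` by proper
subgroups, equal to `⊤` (infinity) if no such finite collection exists. -/
noncomputable def coveringNumber (G : Type*) [Group G] : ℕ∞ :=
  sInf {n : ℕ∞ | ∃ S : Finset (Subgroup G), IsSubgroupCover S ∧ (S.card : ℕ∞) = n}

/-- The set of integers between 26 and 129 claimed not to be covering numbers. -/
def badSet : Finset ℕ :=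
  {27, 34, 35, 37, 39, 41, 43, 45, 47, 49, 51, 52, 53, 55, 56, 58, 59, 61, 66,
   69, 70, 75, 76, 77, 78, 79, 81, 83, 87, 88, 89, 91, 93, 94, 95, 96, 97, 99,
   100, 101, 103, 105, 106, 107, 109, 111, 112, 113, 115, 116, 117, 118, 119,
   120, 123, 124, 125}

section General

variable {G : Type*} [Group G]

theorem coveringNumber_le_of_family {ι : Type*} [Finite ι] (M : ι → Subgroup G)
    (hM : ∀ i, M i ≠ ⊤) (hcov : ∀ g, ∃ i, g ∈ M i) : coveringNumber G ≤ Nat.card ι := by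
  classical
  have := Fintype.ofFinite ι
  have h : coveringNumber G ≤ ((Finset.univ.image M).card : ℕ∞) :=
    sInf_le ⟨Finset.univ.image M, ⟨by simpa using hM, fun g ↦ by simpa using hcov g⟩, rfl⟩
  refine h.trans ?_
  rw [Nat.card_eq_fintype_card]
  exact_mod_cast Finset.card_image_le

theorem le_coveringNumber {n : ℕ}
    (h : ∀ S : Finset (Subgroup G), IsSubgroupCover S → n ≤ S.card) :
    (n : ℕ∞) ≤ coveringNumber G := by
  refine le_sInf ?_
  rintro _ ⟨S, hS, rfl⟩
  exact_mod_cast h S hS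

theorem le_coveringNumber_of_pairwise {ι : Type*} [Finite ι] (e : ι → G)
    (he : ∀ i j, i ≠ j → Subgroup.closure {e i, e j} = ⊤) :
    (Nat.card ι : ℕ∞) ≤ coveringNumber G := by
  classical
  have := Fintype.ofFinite ι
  refine le_coveringNumber fun S hS ↦ ?_
  choose M hMS hM using fun i ↦ hS.2 (e i)
  have hinj : Function.Injective M := fun i j hij ↦ by
    by_contra hne
    refine hS.1 _ (hMS i) (top_le_iff.mp ?_)
    rw [← he i j hne, Subgroup.closure_le]
    rintro x (rfl | rfl)
    · exact hM i
    · exact hij ▸ hM j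
  rw [Nat.card_eq_fintype_card, ← Finset.card_univ, ← Finset.card_image_of_injective _ hinj]
  exact Finset.card_le_card fun x ↦ by simpa using fun i hi ↦ hi ▸ hMS i

/-- The version of `le_coveringNumber_of_pairwise` for a subgroup of an ambient group. -/
theorem le_coveringNumber_of_pairwise_subgroup (H : Subgroup G) {ι : Type*} [Finite ι] (e : ι → G)
    (heH : ∀ i, e i ∈ H) (he : ∀ i j, i ≠ j → H ≤ Subgroup.closure {e i, e j}) :
    (Nat.card ι : ℕ∞) ≤ coveringNumber H := by
  refine le_coveringNumber_of_pairwise (fun i ↦ (⟨e i, heH i⟩ : H)) fun i j hij ↦ ?_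
  rw [eq_top_iff, ← Subgroup.map_le_map_iff_of_injective H.subtype_injective,
    MonoidHom.map_closure, Set.image_pair]
  rintro x ⟨y, -, rfl⟩
  exact he i j hij y.2

theorem coveringNumber_subgroup_le_of_family (H : Subgroup G) {ι : Type*} [Finite ι]
    (M : ι → Subgroup G) (hM : ∀ i, ¬ H ≤ M i) (hcov : ∀ g ∈ H, ∃ i, g ∈ M i) :
    coveringNumber H ≤ Nat.card ι :=
  coveringNumber_le_of_family (fun i ↦ (M i).subgroupOf H)
    (fun i h ↦ hM i (Subgroup.subgroupOf_eq_top.mp h)) fun g ↦ hcov g g.2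

end General

section Affine

/-- The affine group `V ⋊ H` of a group `H` acting linearly on `V`. -/
@[ext]
structure Aff (H V : Type*) where
  lin : H
  tr : V

namespace Aff

variable {H V : Type*} [Group H] [AddCommGroup V]

instance : One (Aff H V) := ⟨⟨1, 0⟩⟩

@[simp] theorem one_lin : (1 : Aff H V).lin = 1 := rfl
@[simp] theorem one_tr : (1 : Aff H V).tr = 0 := rfl

variable [DistribMulAction H V]

instance : Mul (Aff H V) := ⟨fun a b ↦ ⟨a.lin * b.lin, a.tr + a.lin • b.tr⟩⟩
instance : Inv (Aff H V) := ⟨fun a ↦ ⟨a.lin⁻¹, -(a.lin⁻¹ • a.tr)⟩⟩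

@[simp] theorem mul_lin (a b : Aff H V) : (a * b).lin = a.lin * b.lin := rfl
@[simp] theorem mul_tr (a b : Aff H V) : (a * b).tr = a.tr + a.lin • b.tr := rfl
@[simp] theorem inv_lin (a : Aff H V) : a⁻¹.lin = a.lin⁻¹ := rfl
@[simp] theorem inv_tr (a : Aff H V) : a⁻¹.tr = -(a.lin⁻¹ • a.tr) := rfl

instance : Group (Aff H V) := Group.ofLeftAxioms
  (fun a b c ↦ by ext <;> simp [mul_assoc, mul_smul, add_assoc])
  (fun a ↦ by ext <;> simp) (fun a ↦ by ext <;> simp)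

instance [Finite H] [Finite V] : Finite (Aff H V) :=
  Finite.of_injective (fun a ↦ (a.lin, a.tr)) fun a b h ↦ by
    simp only [Prod.mk.injEq] at h
    exact Aff.ext h.1 h.2

/-- The projection to the linear part. -/
def linHom : Aff H V →* H where
  toFun := lin
  map_one' := rfl
  map_mul' _ _ := rfl

@[simp] theorem linHom_apply (a : Aff H V) : linHom a = a.lin := rfl

/-- The stabilizer of a point. -/
def pointStab (x : V) : Subgroup (Aff H V) where
  carrier := {a | a.tr + a.lin • x = x}
  mul_mem' {a b} ha hb := by
    simp only [Set.mem_ofPred_eq, mul_tr, mul_lin, mul_smul] at *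
    rw [add_assoc, ← smul_add, hb, ha]
  one_mem' := by simp
  inv_mem' {a} ha := by
    simp only [Set.mem_ofPred_eq, inv_tr, inv_lin] at *
    calc -(a.lin⁻¹ • a.tr) + a.lin⁻¹ • x
        = -(a.lin⁻¹ • a.tr) + a.lin⁻¹ • (a.tr + a.lin • x) := by rw [ha]
      _ = x := by simp [smul_add]

theorem mem_pointStab {x : V} {a : Aff H V} : a ∈ pointStab x ↔ a.tr + a.lin • x = x := Iff.rfl

theorem eq_top_of_translation (htrans : ∀ v w : V, v ≠ 0 → w ≠ 0 → ∃ h : H, h • v = w)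
    (K : Subgroup (Aff H V)) (hK : ∀ h : H, ∃ a ∈ K, a.lin = h) {v : V} (hv : v ≠ 0)
    (hvK : (⟨1, v⟩ : Aff H V) ∈ K) : K = ⊤ := by
  have htr : ∀ w : V, (⟨1, w⟩ : Aff H V) ∈ K := by
    intro w
    by_cases hw : w = 0
    · subst hw; exact K.one_mem
    obtain ⟨h, rfl⟩ := htrans v w hv hw
    obtain ⟨a, ha, rfl⟩ := hK h
    have := K.mul_mem (K.mul_mem ha hvK) (K.inv_mem ha)
    convert this using 1
    ext <;> simp
  refine (Subgroup.eq_top_iff' K).mpr fun a ↦ ?_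
  obtain ⟨b, hb, hab⟩ := hK a.lin
  have := K.mul_mem (htr (a.tr - b.tr)) hb
  convert this using 1
  ext <;> simp [hab]

theorem coveringNumber_le [Finite V] [Nontrivial V] {κ : Type*} [Finite κ] (N : κ → Subgroup H)
    (hN : ∀ j, N j ≠ ⊤)
    (hcov : ∀ h : H, ¬ Function.Injective (fun x : V ↦ x - h • x) → ∃ j, h ∈ N j) :
    coveringNumber (Aff H V) ≤ (Nat.card V + Nat.card κ : ℕ) := by
  rw [← Nat.card_sum]
  refine coveringNumber_le_of_family
    (Sum.elim (fun x ↦ pointStab x) (fun j ↦ (N j).comap linHom)) ?_ ?_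
  · rintro (x | j) h
    · obtain ⟨v, hv⟩ := exists_ne (0 : V)
      have : (⟨1, v⟩ : Aff H V) ∈ pointStab x := by
        change _ ∈ pointStab x at *
        rw [show (pointStab x : Subgroup (Aff H V)) = ⊤ from h]; trivial
      simp [mem_pointStab, hv] at this
    · refine hN j ((Subgroup.eq_top_iff' _).mpr fun g ↦ ?_)
      have : (⟨g, 0⟩ : Aff H V) ∈ (N j).comap linHom := by
        rw [show (N j).comap linHom = ⊤ from h]; trivial
      exact this
  · intro g
    by_cases hg : Function.Injective (fun x : V ↦ x - g.lin • x)
    · obtain ⟨x, hx⟩ := (Finite.injective_iff_surjective.mp hg) g.tr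
      refine ⟨Sum.inl x, ?_⟩
      change g.tr + g.lin • x = x
      rw [← hx]; simp
    · obtain ⟨j, hj⟩ := hcov g.lin hg
      exact ⟨Sum.inr j, hj⟩

theorem le_coveringNumber [Finite V] 
    (htrans : ∀ v w : V, v ≠ 0 → w ≠ 0 → ∃ h : H, h • v = w)
    {ι κ : Type*} [Finite ι] [Finite κ] (hι : Nat.card ι = Nat.card V)
    (e : ι ⊕ κ → H) (he : ∀ i j, i ≠ j → Subgroup.closure {e i, e j} = ⊤)
    (hu : ∀ j : κ, ∃ v w : V, ∃ m : ℕ, w ≠ 0 ∧ (⟨e (.inr j), v⟩ : Aff H V) ^ m = ⟨1, w⟩) :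
    ((Nat.card V + Nat.card κ : ℕ) : ℕ∞) ≤ coveringNumber (Aff H V) := by
  classical
  have := Fintype.ofFinite ι
  have := Fintype.ofFinite κ
  have := Fintype.ofFinite V
  choose v w m hw hm using hu
  refine _root_.le_coveringNumber fun S hS ↦ ?_
  set A := S.filter (fun M ↦ M.map linHom = ⊤)
  have hnot : ∀ M ∈ A, ∀ x : V, x ≠ 0 → (⟨1, x⟩ : Aff H V) ∉ M := by
    intro M hM x hx hxM
    obtain ⟨hMS, hMt⟩ := Finset.mem_filter.mp hM
    refine hS.1 M hMS (eq_top_of_translation htrans M (fun h ↦ ?_) hx hxM)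
    have : h ∈ M.map linHom := by rw [hMt]; trivial
    simpa using this
  have huniq : ∀ M ∈ S, M ∉ A → ∀ i j, ∀ a ∈ M, ∀ b ∈ M, a.lin = e i → b.lin = e j → i = j := by
    intro M hMS hMA i j a ha b hb hai hbj
    by_contra hij
    refine hMA (Finset.mem_filter.mpr ⟨hMS, top_le_iff.mp ?_⟩)
    rw [← he i j hij, Subgroup.closure_le]
    rintro x (rfl | rfl)
    · exact ⟨a, ha, hai⟩
    · exact ⟨b, hb, hbj⟩
  choose U hUS hU using fun j ↦ hS.2 (⟨e (.inr j), v j⟩ : Aff H V)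
  have hUA : ∀ j, U j ∉ A := fun j hj ↦
    hnot _ hj (w j) (hw j) (hm j ▸ (U j).pow_mem (hU j) (m j))
  have hUinj : Function.Injective U := fun i j hij ↦ by
    have := huniq (U i) (hUS i) (hUA i) (.inr i) (.inr j) _ (hU i) _ (hij ▸ hU j) rfl rfl
    simpa using this
  by_cases hcase : ∀ i : ι, ∃ M ∈ S, M ∉ A ∧ ∃ a ∈ M, a.lin = e (.inl i)
  · choose T hTS hTA a haT ha using hcase
    have hinj : Function.Injective (Sum.elim T U) := by
      rintro (i | i) (j | j) hij
      · exact huniq _ (hTS i) (hTA i) _ _ _ (haT i) (a j)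
          (by rw [show T i = T j from hij]; exact haT j) (ha i) (ha j)
      · exact huniq _ (hTS i) (hTA i) _ _ _ (haT i) _
          (by rw [show T i = U j from hij]; exact hU j) (ha i) rfl
      · exact (huniq _ (hTS j) (hTA j) _ _ _ (haT j) _
          (by rw [show T j = U i from hij.symm]; exact hU i) (ha j) rfl).symm
      · exact congrArg _ (hUinj hij)
    rw [← hι, ← Nat.card_sum, Nat.card_eq_fintype_card, ← Finset.card_univ,
      ← Finset.card_image_of_injective _ hinj]
    refine Finset.card_le_card fun M hM ↦ ?_
    obtain ⟨i | i, -, rfl⟩ := Finset.mem_image.mp hM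
    · exact hTS i
    · exact hUS i
  · push Not at hcase
    obtain ⟨i, hi⟩ := hcase
    choose T hTS hT using fun x : V ↦ hS.2 (⟨e (.inl i), x⟩ : Aff H V)
    have hTA : ∀ x, T x ∈ A := fun x ↦ by
      by_contra h
      exact hi _ (hTS x) h _ (hT x) rfl
    have hinj : Function.Injective (Sum.elim T U) := by
      rintro (x | x) (y | y) hxy
      · by_contra hne
        refine hnot _ (hTA x) (x - y) (fun h ↦ hne (by rw [sub_eq_zero.mp h])) ?_
        have := (T x).mul_mem (hT x) ((T x).inv_mem (show _ ∈ T x from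
          (show T x = T y from hxy) ▸ hT y))
        convert this using 1
        ext <;> simp [sub_eq_add_neg]
      · exact absurd (show T x = U y from hxy) fun h ↦ hUA y (h ▸ hTA x)
      · exact absurd (show U x = T y from hxy) fun h ↦ hUA x (h ▸ hTA y)
      · exact congrArg _ (hUinj hxy)
    rw [← Nat.card_sum, Nat.card_eq_fintype_card, ← Finset.card_univ,
      ← Finset.card_image_of_injective _ hinj]
    refine Finset.card_le_card fun M hM ↦ ?_
    obtain ⟨i | i, -, rfl⟩ := Finset.mem_image.mp hM
    · exact hTS i
    · exact hUS i

end Aff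

theorem coveringNumber_aff_field (F : Type*) [Field F] [Finite F] (hF : 2 < Nat.card F) :
    coveringNumber (Aff Fˣ F) = (Nat.card F + 1 : ℕ) := by
  classical
  have := Fintype.ofFinite F
  have hnt : Nontrivial Fˣ := by
    rw [← Fintype.one_lt_card_iff_nontrivial, Fintype.card_units, ← Nat.card_eq_fintype_card]
    omega
  apply le_antisymm
  · have := Aff.coveringNumber_le (H := Fˣ) (V := F) (κ := Unit) (fun _ ↦ ⊥)
      (fun _ ↦ bot_ne_top) ?_
    · simpa using this
    · intro h hh
      refine ⟨(), ?_⟩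
      by_contra hne
      refine hh fun x y hxy ↦ ?_
      have h1 : (1 - (h : F)) ≠ 0 := fun h0 ↦ hne (by
        rw [Subgroup.mem_bot]; ext; simpa using (sub_eq_zero.mp h0).symm)
      refine mul_left_cancel₀ h1 ?_
      simp only [Units.smul_def, smul_eq_mul] at hxy
      linear_combination hxy
  · obtain ⟨c, hc⟩ := IsCyclic.exists_generator (α := Fˣ)
    have hc' : ∀ a b : Fˣ, a = c ∨ b = c → Subgroup.closure {a, b} = ⊤ := by
      rintro a b hab
      refine (Subgroup.eq_top_iff' _).mpr fun x ↦ ?_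
      refine Subgroup.closure_mono (k := {a, b}) (h := {c}) ?_ ?_
      · rcases hab with rfl | rfl <;> simp
      · rw [← Subgroup.zpowers_eq_closure]; exact hc x
    have := Aff.le_coveringNumber (H := Fˣ) (V := F) (ι := F) (κ := Unit) ?_ rfl
      (Sum.elim (fun _ ↦ c) fun _ ↦ 1) ?_ ?_
    · simpa using this
    · intro v w hv hw
      refine ⟨Units.mk0 (w / v) (div_ne_zero hw hv), ?_⟩
      simp [Units.smul_def, hv]
    · rintro (i | i) (j | j) hij
      · exact hc' _ _ (.inl rfl)
      · exact hc' _ _ (.inl rfl)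
      · exact hc' _ _ (.inr rfl)
      · exact absurd rfl hij
    · exact fun _ ↦ ⟨1, 1, 1, one_ne_zero, by simp⟩

theorem exists_coveringNumber_eq_prime_pow_add_one (p k : ℕ) (hp : p.Prime) (hk : k ≠ 0)
    (h : 2 < p ^ k) :
    ∃ (G : Type) (_ : Group G) (_ : Finite G), coveringNumber G = (p ^ k + 1 : ℕ) := by
  have := Fact.mk hp
  have hc := GaloisField.card p k hk
  refine ⟨Aff (GaloisField p k)ˣ (GaloisField p k), inferInstance, inferInstance, ?_⟩
  rw [coveringNumber_aff_field _ (hc ▸ h), hc]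

end Affine

section Certificates

/-- Evaluate `n` before passing it to `f`; this keeps kernel computations on literals. -/
def forceNat {α : Type} (n : ℕ) (f : ℕ → α) : α :=
  Nat.rec (motive := fun _ ↦ α) (f 0) (fun m _ ↦ f (Nat.succ m)) n

@[simp] theorem forceNat_eq {α : Type} (n : ℕ) (f : ℕ → α) : forceNat n f = f n := by
  cases n <;> rfl

/-- The binary digits of `n` below the leading one spell a word in `a` and `b`
by which `acc` is multiplied on the right. -/
def evalWord (mul : ℕ → ℕ → ℕ) (a b fuel : ℕ) : ℕ → ℕ → ℕ :=
  Nat.rec (motive := fun _ ↦ ℕ → ℕ → ℕ) (fun _ acc ↦ acc)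
    (fun _ ih n acc ↦ cond (Nat.ble n 1) acc
      (forceNat (Nat.div n 2) fun n' ↦
        forceNat (mul acc (cond (Nat.beq (Nat.mod n 2) 0) a b)) fun acc' ↦ ih n' acc')) fuel

/-- The word `w`, starting with the letter `a`, evaluates to `t`. -/
def wordEq (mul : ℕ → ℕ → ℕ) (a b w t : ℕ) : Bool := Nat.beq (evalWord mul a b 100 w a) t

/-- The `d`-th word of the list, evaluated at `a` and `c ^ d * x * c ^ (-d)`, gives `t`. -/
def wordsEq (mul : ℕ → ℕ → ℕ) (a c c' t : ℕ) (ws : List ℕ) : ℕ → Bool :=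
  List.rec (motive := fun _ ↦ ℕ → Bool) (fun _ ↦ true)
    (fun w _ ih x ↦ and (wordEq mul a x w t)
      (forceNat (mul (mul c x) c') fun x' ↦ ih x')) ws

/-- Powers with respect to `mul`. -/
def codePow (mul : ℕ → ℕ → ℕ) (one a k : ℕ) : ℕ :=
  Nat.rec (motive := fun _ ↦ ℕ → ℕ) (fun acc ↦ acc)
    (fun _ ih acc ↦ forceNat (mul acc a) ih) k one

variable {M : Type*} [Monoid M] {mul : ℕ → ℕ → ℕ} {φ : ℕ → M}

theorem evalWord_sound (hφ : ∀ x y, φ (mul x y) = φ x * φ y) {a b : ℕ} {A B : Mˣ}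
    (hA : A.val = φ a) (hB : B.val = φ b) (k : ℕ) : ∀ (n acc : ℕ) (X : Mˣ), X.val = φ acc →
      X ∈ Subgroup.closure {A, B} →
      ∃ Y ∈ Subgroup.closure {A, B}, Y.val = φ (evalWord mul a b k n acc) := by
  induction k with
  | zero => exact fun n acc X hX hXm ↦ ⟨X, hXm, hX⟩
  | succ k ih =>
    intro n acc X hX hXm
    change ∃ Y ∈ Subgroup.closure {A, B}, Y.val = φ (cond (Nat.ble n 1) acc
      (forceNat (Nat.div n 2) fun n' ↦ forceNat (mul acc (cond (Nat.beq (Nat.mod n 2) 0) a b))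
        fun acc' ↦ evalWord mul a b k n' acc'))
    simp only [forceNat_eq]
    cases Nat.ble n 1
    · cases Nat.beq (Nat.mod n 2) 0
      · exact ih _ _ (X * B) (by simp [hX, hB, hφ])
          (mul_mem hXm (Subgroup.subset_closure (by simp)))
      · exact ih _ _ (X * A) (by simp [hX, hA, hφ])
          (mul_mem hXm (Subgroup.subset_closure (by simp)))
    · exact ⟨X, hXm, hX⟩

theorem wordEq_sound (hφ : ∀ x y, φ (mul x y) = φ x * φ y) {a b w t : ℕ} {A B T : Mˣ}
    (hA : A.val = φ a) (hB : B.val = φ b) (hT : T.val = φ t)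
    (h : wordEq mul a b w t = true) : T ∈ Subgroup.closure {A, B} := by
  obtain ⟨Y, hY, hYv⟩ := evalWord_sound hφ hA hB 100 w a A hA (Subgroup.subset_closure (by simp))
  rw [Nat.eq_of_beq_eq_true h, ← hT] at hYv
  rwa [← Units.ext hYv]

theorem wordsEq_sound (hφ : ∀ x y, φ (mul x y) = φ x * φ y) {a c c' t : ℕ} {A C T : Mˣ}
    (hA : A.val = φ a) (hC : C.val = φ c) (hC' : (C⁻¹).val = φ c') (hT : T.val = φ t)
    (ws : List ℕ) : ∀ (x : ℕ) (X : Mˣ), X.val = φ x → wordsEq mul a c c' t ws x = true →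
      ∀ d < ws.length, T ∈ Subgroup.closure {A, C ^ d * X * (C ^ d)⁻¹} := by
  induction ws with
  | nil => intro x X _ _ d hd; simp at hd
  | cons w ws ih =>
    intro x X hX h d hd
    change and (wordEq mul a x w t) (forceNat (mul (mul c x) c') fun x' ↦
      wordsEq mul a c c' t ws x') = true at h
    rw [forceNat_eq, Bool.and_eq_true] at h
    cases d with
    | zero => simpa using wordEq_sound hφ hA hX hT h.1
    | succ d =>
      have := ih _ (C * X * C⁻¹) (by simp [hφ, hC, hX, ← hC']) h.2 d (by simpa using hd)
      simpa [pow_succ, mul_assoc] using this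

theorem codePow_sound (hφ : ∀ x y, φ (mul x y) = φ x * φ y) {one a : ℕ} {A : Mˣ}
    (hA : A.val = φ a) (h1 : φ one = 1) (k : ℕ) : (A ^ k).val = φ (codePow mul one a k) := by
  suffices ∀ (acc : ℕ), φ (codePow mul acc a k) = φ acc * (A ^ k).val by rw [this, h1, one_mul]
  induction k with
  | zero => intro acc; simp [codePow]
  | succ k ih =>
    intro acc
    change φ (forceNat (mul acc a) fun acc' ↦ codePow mul acc' a k) = _
    rw [forceNat_eq, ih, hφ, pow_succ', Units.val_mul, hA, mul_assoc]

end Certificates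

section Orbits

variable {Γ : Type*} [Group Γ]

/-- The family consisting of `c` and of the conjugates `c ^ j * r i * c ^ (-j)` with `j < L i`. -/
def orbitFamily (c : Γ) {m : ℕ} (r : Fin m → Γ) (L : Fin m → ℕ) :
    Option (Σ i, Fin (L i)) → Γ
  | none => c
  | some ⟨i, j⟩ => c ^ (j : ℕ) * r i * (c ^ (j : ℕ))⁻¹

theorem mem_closure_conj {a b t g : Γ} (h : t ∈ Subgroup.closure {a, b}) :
    g * t * g⁻¹ ∈ Subgroup.closure {g * a * g⁻¹, g * b * g⁻¹} := by
  have := Subgroup.mem_map_of_mem (MulAut.conj g).toMonoidHom h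
  rw [MonoidHom.map_closure, Set.image_pair] at this
  simpa using this

theorem closure_pair_le {a b : Γ} {K : Subgroup Γ} (ha : a ∈ K) (hb : b ∈ K) :
    Subgroup.closure {a, b} ≤ K := by
  rw [Subgroup.closure_le]
  rintro x (rfl | rfl) <;> assumption

theorem left_mem_closure_pair (a b : Γ) : a ∈ Subgroup.closure {a, b} :=
  Subgroup.subset_closure (by simp)

theorem right_mem_closure_pair (a b : Γ) : b ∈ Subgroup.closure {a, b} :=
  Subgroup.subset_closure (by simp)

variable {c : Γ} {m : ℕ} {r : Fin m → Γ} {L : Fin m → ℕ}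

theorem conj_pow_mem {K : Subgroup Γ} {x y : Γ} (hx : x ∈ K) (hy : y ∈ K) (k : ℕ) :
    x ^ k * y * (x ^ k)⁻¹ ∈ K :=
  mul_mem (mul_mem (pow_mem hx _) hy) (inv_mem (pow_mem hx _))

theorem mem_of_conj_pow_mem {K : Subgroup Γ} {x y : Γ} (hx : x ∈ K) (k : ℕ)
    (hy : x ^ k * y * (x ^ k)⁻¹ ∈ K) : y ∈ K := by
  have := mul_mem (mul_mem (inv_mem (pow_mem hx k)) hy) (pow_mem hx k)
  simpa [mul_assoc] using this

/-- Shifting a pair of conjugates, where `c ^ P` commutes with `a`. -/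
theorem mem_closure_shift {P d : ℕ} (hd : d ≤ P) {a b : Γ} (hP : Commute (c ^ P) a)
    (h : c ∈ Subgroup.closure {a, c ^ (P - d) * b * (c ^ (P - d))⁻¹}) :
    c ∈ Subgroup.closure {b, c ^ d * a * (c ^ d)⁻¹} := by
  have h1 := mem_closure_conj (g := (c ^ (P - d))⁻¹) h
  have h2 : (c ^ (P - d))⁻¹ * c * (c ^ (P - d))⁻¹⁻¹ = c := by
    rw [inv_inv, ((Commute.refl c).pow_left (P - d)).inv_left.eq, inv_mul_cancel_right]
  have h3 : (c ^ (P - d))⁻¹ * a * (c ^ (P - d))⁻¹⁻¹ = c ^ d * a * (c ^ d)⁻¹ := by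
    have h4 : c ^ (P - d) = c ^ P * (c ^ d)⁻¹ := by
      rw [eq_mul_inv_iff_mul_eq, ← pow_add, Nat.sub_add_cancel hd]
    have h5 := hP.inv_left.eq
    rw [h4, inv_inv, mul_inv_rev, inv_inv, mul_assoc (c ^ d), h5]
    group
  rw [h2, h3] at h1
  rw [Set.pair_comm]
  simpa [mul_assoc] using h1

theorem orbitFamily_generates {P : ℕ} {r₀ : Γ} (hL : ∀ i, L i ≤ P)
    (hP : ∀ i, Commute (c ^ P) (r i))
    (h₀ : ∀ i, r₀ ∈ Subgroup.closure {c, r i})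
    (hne : ∀ i j, i < j → ∀ d < P, c ∈ Subgroup.closure {r i, c ^ d * r j * (c ^ d)⁻¹})
    (heq : ∀ i d, 0 < d → d < L i → c ∈ Subgroup.closure {r i, c ^ d * r i * (c ^ d)⁻¹})
    (x y : Option (Σ i, Fin (L i))) (hxy : x ≠ y) :
    Subgroup.closure {c, r₀} ≤ Subgroup.closure {orbitFamily c r L x, orbitFamily c r L y} := by
  have hgen : ∀ (K : Subgroup Γ) (i : Fin m) (k : ℕ), c ∈ K → c ^ k * r i * (c ^ k)⁻¹ ∈ K →
      Subgroup.closure {c, r₀} ≤ K := fun K i k hc hr ↦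
    closure_pair_le hc (closure_pair_le hc (mem_of_conj_pow_mem hc k hr) (h₀ i))
  have hall : ∀ i j : Fin m, ∀ d < P, (i = j → 0 < d ∧ d < L i) →
      c ∈ Subgroup.closure {r i, c ^ d * r j * (c ^ d)⁻¹} := by
    intro i j d hd hij
    rcases lt_trichotomy i j with h | rfl | h
    · exact hne i j h d hd
    · exact heq i d (hij rfl).1 (hij rfl).2
    · rcases Nat.eq_zero_or_pos d with rfl | hd0
      · rw [Set.pair_comm]
        simpa using hne j i h 0 hd
      · exact mem_closure_shift hd.le (hP j) (hne j i h (P - d) (by omega))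
  have hle : ∀ (i j : Fin m) (k l : ℕ), k ≤ l → l < L j → (i = j → k ≠ l) →
      c ∈ Subgroup.closure {c ^ k * r i * (c ^ k)⁻¹, c ^ l * r j * (c ^ l)⁻¹} := by
    intro i j k l hkl hl hij
    have h1 := mem_closure_conj (g := c ^ k) (hall i j (l - k) (by have := hL j; omega)
      (fun h ↦ by have := hij h; subst h; omega))
    have h2 : c ^ k * c * (c ^ k)⁻¹ = c := by
      rw [((Commute.refl c).pow_left k).eq, mul_inv_cancel_right]
    have h3 : c ^ k * (c ^ (l - k) * r j * (c ^ (l - k))⁻¹) * (c ^ k)⁻¹ =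
        c ^ l * r j * (c ^ l)⁻¹ := by
      nth_rw 3 4 [← Nat.add_sub_cancel' hkl]
      rw [pow_add]; group
    rwa [h2, h3] at h1
  match x, y with
  | none, none => exact absurd rfl hxy
  | none, some ⟨i, k⟩ =>
    exact hgen _ i k (left_mem_closure_pair _ _) (right_mem_closure_pair _ _)
  | some ⟨i, k⟩, none =>
    exact hgen _ i k (right_mem_closure_pair _ _) (left_mem_closure_pair _ _)
  | some ⟨i, k⟩, some ⟨j, l⟩ =>
    refine hgen _ i k ?_ (left_mem_closure_pair _ _)
    rcases le_total (k : ℕ) l with h | h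
    · refine hle i j k l h l.2 ?_
      rintro rfl h'
      exact hxy (by rw [Fin.ext h'])
    · have := hle j i l k h k.2 ?_
      · rwa [Set.pair_comm] at this
      · rintro rfl h'
        exact hxy (by rw [Fin.ext h'])

theorem orbitFamily_mem {r₀ : Γ} (h₀ : ∀ i, r i ∈ Subgroup.closure {c, r₀})
    (x : Option (Σ i, Fin (L i))) : orbitFamily c r L x ∈ Subgroup.closure {c, r₀} :=
  match x with
  | none => left_mem_closure_pair _ _
  | some ⟨i, k⟩ => conj_pow_mem (left_mem_closure_pair _ _) (h₀ i) k

end Orbits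

section OrbitCertificate

/-- Codes for a family of the form `orbitFamily`, with words certifying that any two members
generate the same group. -/
structure OrbitCert where
  c : ℕ
  cInv : ℕ
  period : ℕ
  size : ℕ
  gen : Fin size → ℕ
  genInv : Fin size → ℕ
  len : Fin size → ℕ
  base : ℕ
  baseInv : ℕ
  toBase : Fin size → ℕ
  ofBase : Fin size → ℕ
  words : Fin size → Fin size → List ℕ

/-- The conditions making a certificate valid with respect to a coded multiplication. -/
structure OrbitCert.Valid (C : OrbitCert) (mul : ℕ → ℕ → ℕ) (one : ℕ) : Prop where
  c_inv : mul C.c C.cInv = one ∧ mul C.cInv C.c = one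
  base_inv : mul C.base C.baseInv = one ∧ mul C.baseInv C.base = one
  gen_inv : ∀ i, mul (C.gen i) (C.genInv i) = one ∧ mul (C.genInv i) (C.gen i) = one
  len_le : ∀ i, C.len i ≤ C.period
  commute : forceNat (codePow mul one C.c C.period) fun z ↦
    ∀ i, mul z (C.gen i) = mul (C.gen i) z
  toBase : ∀ i, wordEq mul C.c (C.gen i) (C.toBase i) C.base = true
  ofBase : ∀ i, wordEq mul C.c C.base (C.ofBase i) (C.gen i) = true
  words_ne : ∀ i j, i < j → (C.words i j).length = C.period ∧
    wordsEq mul (C.gen i) C.c C.cInv C.c (C.words i j) (C.gen j) = true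
  words_eq : ∀ i, (C.len i ≤ (C.words i i).length + 1 ∨
      C.len i = C.period ∧ C.period ≤ 2 * (C.words i i).length + 1) ∧
    wordsEq mul (C.gen i) C.c C.cInv C.c (C.words i i)
      (mul (mul C.c (C.gen i)) C.cInv) = true

variable {M : Type*} [Monoid M] {mul : ℕ → ℕ → ℕ} {φ : ℕ → M}

/-- The unit with coded value `a` and coded inverse `b`. -/
def codeUnit (hφ : ∀ x y, φ (mul x y) = φ x * φ y) {one : ℕ} (h1 : φ one = 1) (a b : ℕ)
    (h : mul a b = one ∧ mul b a = one) : Mˣ :=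
  ⟨φ a, φ b, by rw [← hφ, h.1, h1], by rw [← hφ, h.2, h1]⟩

theorem OrbitCert.Valid.exists_units {C : OrbitCert} {one : ℕ} (h : C.Valid mul one)
    (hφ : ∀ x y, φ (mul x y) = φ x * φ y) (h1 : φ one = 1) :
    ∃ (c r₀ : Mˣ) (r : Fin C.size → Mˣ), c.val = φ C.c ∧ r₀.val = φ C.base ∧
      (∀ i, (r i).val = φ (C.gen i)) ∧ (∀ i, Commute (c ^ C.period) (r i)) ∧
      (∀ i, r i ∈ Subgroup.closure {c, r₀}) ∧ (∀ i, r₀ ∈ Subgroup.closure {c, r i}) ∧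
      ∀ x y, x ≠ y → Subgroup.closure {c, r₀} ≤
        Subgroup.closure {orbitFamily c r C.len x, orbitFamily c r C.len y} := by
  set c : Mˣ := codeUnit hφ h1 C.c C.cInv h.c_inv
  set r₀ : Mˣ := codeUnit hφ h1 C.base C.baseInv h.base_inv
  set r : Fin C.size → Mˣ := fun i ↦ codeUnit hφ h1 (C.gen i) (C.genInv i) (h.gen_inv i)
  have hcomm : ∀ i, Commute (c ^ C.period) (r i) := fun i ↦ by
    have h2 := h.commute
    rw [forceNat_eq] at h2
    refine Units.ext ?_
    rw [Units.val_mul, Units.val_mul, codePow_sound hφ (one := one) (a := C.c) rfl h1]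
    change _ * φ _ = φ _ * _
    rw [← hφ, ← hφ, h2 i]
  have hto : ∀ i, r₀ ∈ Subgroup.closure {c, r i} := fun i ↦
    wordEq_sound hφ rfl rfl rfl (h.toBase i)
  refine ⟨c, r₀, r, rfl, rfl, fun _ ↦ rfl, hcomm,
    fun i ↦ wordEq_sound hφ rfl rfl rfl (h.ofBase i), hto, ?_⟩
  refine orbitFamily_generates h.len_le hcomm hto (fun i j hij d hd ↦ ?_) (fun i d hd0 hd ↦ ?_)
  · obtain ⟨hl, hw⟩ := h.words_ne i j hij
    exact wordsEq_sound hφ (t := C.c) rfl rfl rfl rfl (C.words i j) _ _ rfl hw d (hl ▸ hd)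
  · obtain ⟨hl, hw⟩ := h.words_eq i
    have key : ∀ d < (C.words i i).length + 1, 0 < d →
        c ∈ Subgroup.closure {r i, c ^ d * r i * (c ^ d)⁻¹} := by
      intro d hd hd0
      have := wordsEq_sound hφ (t := C.c) (A := r i) (C := c) (T := c) rfl rfl rfl rfl
        (C.words i i) _ (c * r i * c⁻¹) (by rw [hφ, hφ]; rfl) hw (d - 1) (by omega)
      obtain ⟨d, rfl⟩ := Nat.exists_eq_add_of_lt hd0
      simpa [pow_succ, mul_assoc] using this
    have hlen := h.len_le i
    by_cases hd' : d < (C.words i i).length + 1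
    · exact key d hd' hd0
    · exact mem_closure_shift (P := C.period) (by omega) (hcomm i)
        (key (C.period - d) (by omega) (by omega))

end OrbitCertificate

section AffineOrbits

variable {V : Type*} [AddCommGroup V]

theorem closure_subtype_eq_top {Γ : Type*} [Group Γ] {H : Subgroup Γ} (a b : H)
    (h : H ≤ Subgroup.closure {(a : Γ), (b : Γ)}) : Subgroup.closure {a, b} = ⊤ := by
  rw [eq_top_iff, ← Subgroup.map_le_map_iff_of_injective H.subtype_injective,
    MonoidHom.map_closure, Set.image_pair]
  rintro x ⟨y, -, rfl⟩
  exact h y.2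

theorem coveringNumber_aff_of_orbits [Finite V] {m P : ℕ} (hP0 : 0 < P)
    (hV : Nat.card V = m * P + 1)
    (c r₀ : (AddMonoid.End V)ˣ) (r : Fin (m + 1) → (AddMonoid.End V)ˣ)
    (hcomm : Commute (c ^ P) r₀)
    (hmem : ∀ i, r i ∈ Subgroup.closure {c, r₀})
    (hgen : ∀ x y, x ≠ y → Subgroup.closure {c, r₀} ≤
      Subgroup.closure {orbitFamily c r (fun _ ↦ P) x, orbitFamily c r (fun _ ↦ P) y})
    (x₀ : V) (hc : ∀ x ≠ 0, ∃ k : ℕ, x = c ^ k • x₀) (hc1 : c • x₀ ≠ x₀)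
    (v w : V) (k : ℕ) (hw : w ≠ 0)
    (hu : (⟨r (Fin.last m), v⟩ : Aff (AddMonoid.End V)ˣ V) ^ k = ⟨1, w⟩) :
    coveringNumber (Aff (Subgroup.closure {c, r₀}) V) = (m * P + 1 + P : ℕ) := by
  set H := Subgroup.closure {c, r₀}
  have hcH : c ∈ H := left_mem_closure_pair _ _
  have hx0 : x₀ ≠ 0 := by rintro rfl; simp at hc1
  have : Nontrivial V := ⟨x₀, 0, hx0⟩
  have hcommH : ∀ h ∈ H, Commute (c ^ P) h := by
    have : H ≤ Subgroup.centralizer {c ^ P} := by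
      refine closure_pair_le ?_ ?_ <;> rw [Subgroup.mem_centralizer_singleton_iff]
      · exact ((Commute.refl c).pow_left P).eq.symm
      · exact hcomm.eq.symm
    intro h hh
    exact (Subgroup.mem_centralizer_singleton_iff.mp (this hh)).symm
  apply le_antisymm
  · have := Aff.coveringNumber_le (H := H) (V := V) (κ := Fin P)
      (fun j ↦ MulAction.stabilizer H (c ^ (j : ℕ) • x₀)) ?_ ?_
    · simpa [hV] using this
    · intro j h
      have h1 : (⟨c, hcH⟩ : H) ∈ MulAction.stabilizer H (c ^ (j : ℕ) • x₀) := by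
        rw [h]; trivial
      have h2 : c • (c ^ (j : ℕ) • x₀) = c ^ (j : ℕ) • x₀ := h1
      rw [← mul_smul, ← pow_succ', pow_succ, mul_smul] at h2
      exact hc1 (smul_left_cancel _ h2)
    · intro h hh
      rw [Function.Injective] at hh
      push Not at hh
      obtain ⟨a, b, hab, hne⟩ := hh
      obtain ⟨k, hk⟩ := hc (a - b) (sub_ne_zero.mpr hne)
      have hfix : h • (a - b) = a - b := by
        rw [smul_sub, ← sub_eq_zero]
        rw [← sub_eq_zero] at hab
        rw [← neg_eq_zero, ← hab]; abel
      refine ⟨⟨k % P, Nat.mod_lt _ hP0⟩, ?_⟩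
      rw [MulAction.mem_stabilizer_iff]
      have hz : Commute ((c ^ P) ^ (k / P)) (h : (AddMonoid.End V)ˣ) :=
        (hcommH h h.2).pow_left _
      have hdec : a - b = ((c ^ P) ^ (k / P)) • (c ^ (k % P) • x₀) := by
        rw [hk, ← mul_smul, ← pow_mul, ← pow_add, Nat.div_add_mod]
      rw [hdec] at hfix
      change (h : (AddMonoid.End V)ˣ) • (_ : V) = _ at hfix
      change (h : (AddMonoid.End V)ˣ) • (_ : V) = _
      rw [← mul_smul, ← hz.eq, mul_smul] at hfix
      exact smul_left_cancel _ hfix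
  · have hm : ∀ x, orbitFamily c r (fun _ ↦ P) x ∈ H := orbitFamily_mem hmem
    set f : Option (Fin m × Fin P) ⊕ Fin P → Option (Σ _ : Fin (m + 1), Fin P) :=
      Sum.elim (Option.map fun x ↦ ⟨x.1.castSucc, x.2⟩) fun j ↦ some ⟨Fin.last m, j⟩ with hf
    have hfinj : Function.Injective f := by
      rintro ((_ | ⟨i, j⟩) | j) ((_ | ⟨i', j'⟩) | j') h <;>
        simp_all [(Fin.castSucc_ne_last _).symm]
    have := Aff.le_coveringNumber (H := H) (V := V) (ι := Option (Fin m × Fin P)) (κ := Fin P)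
      ?_ ?_ (fun i ↦ (⟨_, hm (f i)⟩ : H))
      (fun i j hij ↦ closure_subtype_eq_top _ _ (hgen _ _ (hfinj.ne hij))) ?_
    · simpa [hV] using this
    · intro a b ha hb
      obtain ⟨k, rfl⟩ := hc a ha
      obtain ⟨l, rfl⟩ := hc b hb
      refine ⟨⟨c, hcH⟩ ^ l * (⟨c, hcH⟩ ^ k)⁻¹, ?_⟩
      change (c ^ l * (c ^ k)⁻¹) • c ^ k • x₀ = c ^ l • x₀
      rw [mul_smul, inv_smul_smul]
    · rw [hV, Finite.card_option]; simp
    · intro j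
      refine ⟨c ^ (j : ℕ) • v, c ^ (j : ℕ) • w, k,
        fun h ↦ hw ((smul_eq_zero_iff_eq _).mp h), ?_⟩
      let incl : Aff H V →* Aff (AddMonoid.End V)ˣ V :=
        { toFun := fun a ↦ ⟨a.lin, a.tr⟩, map_one' := rfl, map_mul' := fun _ _ ↦ rfl }
      have hincl : Function.Injective incl := fun a b h ↦ by
        simp only [incl, MonoidHom.coe_mk, OneHom.coe_mk, Aff.mk.injEq] at h
        exact Aff.ext (Subtype.ext h.1) h.2
      apply hincl
      rw [map_pow]
      have hconj : incl ⟨⟨_, hm (f (.inr j))⟩, c ^ (j : ℕ) • v⟩ =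
          ⟨c ^ (j : ℕ), 0⟩ * ⟨r (Fin.last m), v⟩ * (⟨c ^ (j : ℕ), 0⟩)⁻¹ := by
        ext <;> simp [incl, f, orbitFamily]
      rw [hconj, conj_pow, hu]
      ext <;> simp [incl]

end AffineOrbits

section BitMatrices

/-- The vector space `𝔽₂ⁿ`, with vectors coded as numbers and addition being bitwise `xor`. -/
def XorVec (n : ℕ) : Type := Fin (2 ^ n)

namespace XorVec

variable {n : ℕ}

/-- The code of a vector. -/
def code (x : XorVec n) : ℕ := Fin.val x

theorem code_lt (x : XorVec n) : x.code < 2 ^ n := Fin.isLt x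

/-- The vector with a given code. -/
def ofCode (x : ℕ) (hx : x < 2 ^ n) : XorVec n := Fin.mk x hx

@[simp] theorem code_ofCode (x : ℕ) (hx : x < 2 ^ n) : (ofCode x hx).code = x := rfl

@[ext] theorem ext {x y : XorVec n} (h : x.code = y.code) : x = y := Fin.ext h

instance : Finite (XorVec n) := inferInstanceAs (Finite (Fin (2 ^ n)))

theorem card : Nat.card (XorVec n) = 2 ^ n := Nat.card_fin _

instance : Add (XorVec n) := ⟨fun x y ↦ ofCode (x.code ^^^ y.code)
  (Nat.xor_lt_two_pow x.code_lt y.code_lt)⟩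
instance : Zero (XorVec n) := ⟨ofCode 0 (by positivity)⟩
instance : Neg (XorVec n) := ⟨fun x ↦ x⟩

@[simp] theorem code_add (x y : XorVec n) : (x + y).code = x.code ^^^ y.code := rfl
@[simp] theorem code_zero : (0 : XorVec n).code = 0 := rfl
@[simp] theorem code_neg (x : XorVec n) : (-x).code = x.code := rfl

instance : AddCommGroup (XorVec n) where
  add_assoc x y z := by ext; simp [Nat.xor_assoc]
  zero_add x := by ext; simp
  add_zero x := by ext; simp
  add_comm x y := by ext; simp [Nat.xor_comm]
  neg_add_cancel x := by ext; simp
  nsmul := nsmulRec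
  zsmul := zsmulRec

end XorVec

/-- Apply a matrix to a vector: the first `k` base-`q` digits of `A` are the columns. -/
def bitApply (q k : ℕ) : ℕ → ℕ → ℕ :=
  Nat.rec (motive := fun _ ↦ ℕ → ℕ → ℕ) (fun _ _ ↦ 0)
    (fun _ ih A x ↦ Nat.xor (Nat.mul (Nat.mod A q) (Nat.mod x 2)) (ih (Nat.div A q) (Nat.div x 2))) k

/-- Apply `A` to the first `k` columns of a matrix. -/
def bitMulAux (q n A k : ℕ) : ℕ → ℕ :=
  Nat.rec (motive := fun _ ↦ ℕ → ℕ) (fun _ ↦ 0)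
    (fun _ ih B ↦ Nat.add (bitApply q n A (Nat.mod B q)) (Nat.mul q (ih (Nat.div B q)))) k

/-- The product of coded `n × n` matrices over `𝔽₂`, where `q = 2 ^ n`. -/
def bitMul (q n A B : ℕ) : ℕ := bitMulAux q n A n B

/-- The code of the identity matrix. -/
def bitOne (n : ℕ) : ℕ := (List.range n).foldl (fun s i ↦ s + 2 ^ (i * n + i)) 0

theorem bitApply_succ (q k A x : ℕ) :
    bitApply q (k + 1) A x = (A % q * (x % 2)) ^^^ bitApply q k (A / q) (x / 2) := rfl

theorem bitMulAux_succ (q n A k B : ℕ) :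
    bitMulAux q n A (k + 1) B = bitApply q n A (B % q) + q * bitMulAux q n A k (B / q) := rfl

theorem bitApply_lt (n k : ℕ) : ∀ A x, bitApply (2 ^ n) k A x < 2 ^ n := by
  induction k with
  | zero => intro A x; simp [bitApply]
  | succ k ih =>
    intro A x
    rw [bitApply_succ]
    refine Nat.xor_lt_two_pow ?_ (ih _ _)
    have h1 : A % 2 ^ n < 2 ^ n := Nat.mod_lt _ (by positivity)
    rcases Nat.mod_two_eq_zero_or_one x with h | h <;> rw [h] <;> omega

theorem bitApply_xor (q k : ℕ) : ∀ A x y,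
    bitApply q k A (x ^^^ y) = bitApply q k A x ^^^ bitApply q k A y := by
  induction k with
  | zero => intro A x y; simp [bitApply]
  | succ k ih =>
    intro A x y
    simp only [bitApply_succ]
    rw [show (x ^^^ y) / 2 = x / 2 ^^^ y / 2 by simpa using Nat.xor_div_two_pow (a := x) (b := y) (n := 1), ih]
    have h2 : (x ^^^ y) % 2 = x % 2 ^^^ y % 2 := by
      simpa using Nat.xor_mod_two_pow (a := x) (b := y) (n := 1)
    have h3 : A % q * ((x ^^^ y) % 2) = (A % q * (x % 2)) ^^^ (A % q * (y % 2)) := by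
      rw [h2]
      rcases Nat.mod_two_eq_zero_or_one x with h | h <;>
        rcases Nat.mod_two_eq_zero_or_one y with h' | h' <;> simp [h, h']
    rw [h3]
    ac_rfl

theorem bitApply_zero (q k : ℕ) : ∀ A, bitApply q k A 0 = 0 := by
  induction k with
  | zero => intro A; rfl
  | succ k ih => intro A; simp [bitApply_succ, ih]

theorem bitApply_mulAux (n k : ℕ) (A : ℕ) : ∀ B x,
    bitApply (2 ^ n) k (bitMulAux (2 ^ n) n A k B) x =
      bitApply (2 ^ n) n A (bitApply (2 ^ n) k B x) := by
  induction k with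
  | zero => intro B x; simp only [bitApply, bitMulAux]; exact (bitApply_zero _ _ _).symm
  | succ k ih =>
    intro B x
    have hlt := bitApply_lt n n A (B % 2 ^ n)
    have hpos : 0 < 2 ^ n := by positivity
    rw [bitApply_succ, bitMulAux_succ, Nat.add_mul_mod_self_left, Nat.mod_eq_of_lt hlt,
      Nat.add_mul_div_left _ _ hpos, Nat.div_eq_of_lt hlt, zero_add, ih, bitApply_succ,
      bitApply_xor]
    congr 1
    rcases Nat.mod_two_eq_zero_or_one x with h | h <;> simp [h, bitApply_zero]

/-- The linear map with a given coded matrix. -/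
def bitHom (n A : ℕ) : AddMonoid.End (XorVec n) where
  toFun x := XorVec.ofCode (bitApply (2 ^ n) n A x.code) (bitApply_lt _ _ _ _)
  map_zero' := by ext; simp [bitApply_zero]
  map_add' x y := by ext; simp [bitApply_xor]

@[simp] theorem code_bitHom (n A : ℕ) (x : XorVec n) :
    (bitHom n A x).code = bitApply (2 ^ n) n A x.code := rfl

theorem bitHom_mul (n A B : ℕ) : bitHom n (bitMul (2 ^ n) n A B) = bitHom n A * bitHom n B := by
  ext x
  exact bitApply_mulAux n n A B x.code

end BitMatrices

section CodedAffine

/-- The iterates `x, f x, f (f x), …` (`k` of them). -/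
def iterList (f : ℕ → ℕ) (k : ℕ) : ℕ → List ℕ :=
  Nat.rec (motive := fun _ ↦ ℕ → List ℕ) (fun _ ↦ [])
    (fun _ ih x ↦ x :: forceNat (f x) ih) k

/-- The `k`-fold iterate of `f`. -/
def iterNat (f : ℕ → ℕ) (k : ℕ) : ℕ → ℕ :=
  Nat.rec (motive := fun _ ↦ ℕ → ℕ) (fun x ↦ x) (fun _ ih x ↦ forceNat (f x) ih) k

theorem iterNat_succ (f : ℕ → ℕ) (k x : ℕ) : iterNat f (k + 1) x = iterNat f k (f x) :=
  forceNat_eq _ _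

theorem iterNat_succ' (f : ℕ → ℕ) (k : ℕ) : ∀ x, iterNat f (k + 1) x = f (iterNat f k x) := by
  induction k with
  | zero => intro x; rw [iterNat_succ]; rfl
  | succ k ih => intro x; rw [iterNat_succ, ih, iterNat_succ]

theorem exists_iterNat_of_mem_iterList (f : ℕ → ℕ) (k : ℕ) :
    ∀ x y, y ∈ iterList f k x → ∃ j, y = iterNat f j x := by
  induction k with
  | zero => intro x y hy; simp [iterList] at hy
  | succ k ih =>
    intro x y hy
    change y ∈ x :: forceNat (f x) (iterList f k) at hy
    rw [forceNat_eq, List.mem_cons] at hy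
    rcases hy with rfl | hy
    · exact ⟨0, rfl⟩
    · obtain ⟨j, rfl⟩ := ih _ _ hy
      exact ⟨j + 1, (iterNat_succ _ _ _).symm⟩

theorem coveringNumber_aff_of_cert {V : Type} [AddCommGroup V] [Finite V]
    {φ : ℕ → AddMonoid.End V} {mul : ℕ → ℕ → ℕ} {one : ℕ}
    (hφ : ∀ x y, φ (mul x y) = φ x * φ y) (h1 : φ one = 1)
    {app add : ℕ → ℕ → ℕ} {δ : ℕ → V} (happ : ∀ A x, δ (app A x) = φ A (δ x))
    (hadd : ∀ x y, δ (add x y) = δ x + δ y) (h0 : δ 0 = 0)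
    {C : OrbitCert} (hC : C.Valid mul one) {m P : ℕ} (hm : C.size = m + 1)
    (hP : C.period = P) (hlen : ∀ i, C.len i = P) (hP0 : 0 < P) (hV : Nat.card V = m * P + 1)
    (i₀ : Fin C.size) (hi₀ : C.gen i₀ = C.base) (x₀ l : ℕ)
    (hc : ∀ x : V, x ≠ 0 → ∃ y ∈ iterList (app C.c) l x₀, x = δ y)
    (hc1 : δ (app C.c x₀) ≠ δ x₀) (v k : ℕ) (iu : Fin C.size) (hiu : iu.val = m)
    (huk : codePow mul one (C.gen iu) k = one) (hw : δ (iterNat (fun t ↦ add v (app (C.gen iu) t)) k 0) ≠ 0) :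
    ∃ (G : Type) (_ : Group G) (_ : Finite G), coveringNumber G = (m * P + 1 + P : ℕ) := by
  have : Finite (AddMonoid.End V) := Finite.of_injective (fun f ↦ (f : V → V)) DFunLike.coe_injective
  obtain ⟨c, r₀, r, hcv, hrv, hr, hcomm, hmem, -, hgen⟩ := hC.exists_units hφ h1
  have hlen' : C.len = fun _ ↦ P := funext hlen
  have hcommr : Commute (c ^ P) r₀ := by
    have h2 : r i₀ = r₀ := Units.ext (by rw [hr, hrv, hi₀])
    rw [← hP, ← h2]; exact hcomm i₀
  have hpow : ∀ j x, δ (iterNat (app C.c) j x) = c ^ j • δ x := by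
    intro j
    induction j with
    | zero => intro x; simp [iterNat]
    | succ j ih =>
      intro x
      rw [iterNat_succ, ih, happ, pow_succ, mul_smul, ← hcv]; rfl
  refine ⟨Aff (Subgroup.closure {c, r₀}) V, inferInstance, inferInstance, ?_⟩
  rw [hlen'] at hgen
  obtain ⟨C1, C2, C3, C4, C5, C6, C7, C8, C9, C10, C11, C12⟩ := C
  dsimp only at *
  subst hm
  obtain rfl : iu = Fin.last m := Fin.ext hiu
  set u := C5 (Fin.last m) with hu
  refine coveringNumber_aff_of_orbits hP0 hV c r₀ r hcommr hmem hgen (δ x₀) ?_ ?_ (δ v)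
    (δ (iterNat (fun t ↦ add v (app u t)) k 0)) k hw ?_
  · intro x hx
    obtain ⟨y, hy, rfl⟩ := hc x hx
    obtain ⟨j, rfl⟩ := exists_iterNat_of_mem_iterList _ _ _ _ hy
    exact ⟨j, hpow j x₀⟩
  · have := hpow 1 x₀
    rw [pow_one] at this
    rw [← this]
    rw [iterNat_succ]; exact hc1
  · have hlast : (r (Fin.last m)).val = φ u := by rw [hr]
    have key : ∀ j, (⟨r (Fin.last m), δ v⟩ : Aff (AddMonoid.End V)ˣ V) ^ j =
        ⟨r (Fin.last m) ^ j, δ (iterNat (fun t ↦ add v (app u t)) j 0)⟩ := by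
      intro j
      induction j with
      | zero => ext <;> simp [iterNat, h0]
      | succ j ih =>
        rw [pow_succ', ih, iterNat_succ']
        ext
        · simp [pow_succ']
        · simp only [Aff.mul_tr, hadd, happ, ← hlast]; rfl
    rw [key]
    congr 1
    exact Units.ext (by rw [codePow_sound hφ hlast h1, huk, h1, Units.val_one])

theorem bitApply_mod (q k : ℕ) : ∀ A x, bitApply q k A (x % 2 ^ k) = bitApply q k A x := by
  induction k with
  | zero => intro A x; rfl
  | succ k ih =>
    intro A x
    have h1 : x % 2 ^ (k + 1) % 2 = x % 2 := Nat.mod_mod_of_dvd _ (dvd_pow_self 2 (by omega))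
    have h2 : x % 2 ^ (k + 1) / 2 = x / 2 % 2 ^ k := by
      rw [pow_succ', Nat.mod_mul_right_div_self]
    rw [bitApply_succ, bitApply_succ, h1, h2, ih]

/-- `coveringNumber_aff_of_cert` for coded matrices over `𝔽₂`. -/
theorem exists_coveringNumber_of_bitCert (n : ℕ) {one : ℕ}
    (h1 : ∀ x < 2 ^ n, bitApply (2 ^ n) n one x = x)
    {C : OrbitCert} (hC : C.Valid (bitMul (2 ^ n) n) one) {m P : ℕ} (hm : C.size = m + 1)
    (hP : C.period = P) (hlen : ∀ i, C.len i = P) (hP0 : 0 < P) (hV : 2 ^ n = m * P + 1)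
    (i₀ : Fin C.size) (hi₀ : C.gen i₀ = C.base)
    (hc : forceNat C.c fun c ↦ ∀ x < 2 ^ n, x ≠ 0 → x ∈ iterList (bitApply (2 ^ n) n c) (2 ^ n) 1)
    (hc1 : bitApply (2 ^ n) n C.c 1 % 2 ^ n ≠ 1 % 2 ^ n) (v k : ℕ) (iu : Fin C.size)
    (hiu : iu.val = m) (huk : codePow (bitMul (2 ^ n) n) one (C.gen iu) k = one)
    (hw : iterNat (fun t ↦ Nat.xor v (bitApply (2 ^ n) n (C.gen iu) t)) k 0 % 2 ^ n ≠ 0) :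
    ∃ (G : Type) (_ : Group G) (_ : Finite G), coveringNumber G = (m * P + 1 + P : ℕ) := by
  have hpos : 0 < 2 ^ n := by positivity
  let δ : ℕ → XorVec n := fun x ↦ XorVec.ofCode (x % 2 ^ n) (Nat.mod_lt _ hpos)
  have hδ : ∀ x y, x % 2 ^ n ≠ y % 2 ^ n → δ x ≠ δ y := fun x y h h' ↦ h (congrArg XorVec.code h')
  rw [forceNat_eq] at hc
  refine coveringNumber_aff_of_cert (φ := bitHom n) (bitHom_mul n)
    (AddMonoidHom.ext fun x ↦ XorVec.ext (h1 _ x.code_lt)) (app := bitApply (2 ^ n) n)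
    (add := Nat.xor) (δ := δ) ?_ ?_ ?_ hC hm hP hlen hP0 (by rw [XorVec.card, hV]) i₀ hi₀ 1
    (2 ^ n) ?_ (hδ _ _ hc1) v k iu hiu huk ?_
  · intro A x
    refine XorVec.ext ?_
    change bitApply (2 ^ n) n A x % 2 ^ n = bitApply (2 ^ n) n A (x % 2 ^ n)
    rw [Nat.mod_eq_of_lt (bitApply_lt _ _ _ _), bitApply_mod]
  · intro x y
    exact XorVec.ext Nat.xor_mod_two_pow
  · exact XorVec.ext (Nat.zero_mod _)
  · intro x hx
    exact ⟨x.code, hc _ x.code_lt fun h ↦ hx (XorVec.ext h),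
      XorVec.ext (Nat.mod_eq_of_lt x.code_lt).symm⟩
  · refine fun h ↦ hw ?_
    exact congrArg XorVec.code h

end CodedAffine

section LinearCertificates

instance decidableForceNat (n : ℕ) (f : ℕ → Prop) [DecidablePred f] : Decidable (forceNat n f) :=
  Nat.rec (motive := fun n ↦ Decidable (forceNat n f)) (inferInstanceAs (Decidable (f 0)))
    (fun m _ ↦ inferInstanceAs (Decidable (f (Nat.succ m)))) n

/-- Generators of `GL(4, 2)`, as coded matrices over `𝔽₂`. -/
def certGL4Two : OrbitCert where
  c := 14402
  cInv := 16921
  period := 15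
  size := 2
  gen := ![43285, 32291]
  genInv := ![25570, 63779]
  len := ![15, 15]
  base := 43285
  baseInv := 25570
  toBase := ![114, 36930]
  ofBase := ![114, 48511]
  words := ![
    ![[94082, 10466, 63232, 12323, 84204, 135419, 60],
      [17972, 63725, 86444, 8402, 5433, 19061, 15293, 34109, 20362, 19484, 3100, 29394,
        4675, 4371, 10809]],
    ![[],
      [18921, 1386, 30992, 3314, 14536, 3626, 1317]]]

theorem valid_certGL4Two : certGL4Two.Valid (bitMul (2 ^ 4) 4) (bitOne 4) where
  c_inv := by decide +kernel
  base_inv := by decide +kernel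
  gen_inv := by decide +kernel
  len_le := by decide +kernel
  commute := by decide +kernel
  toBase := by decide +kernel
  ofBase := by decide +kernel
  words_ne := by decide +kernel
  words_eq := by decide +kernel

theorem exists_coveringNumber_eq_31 :
    ∃ (G : Type) (_ : Group G) (_ : Finite G), coveringNumber G = (31 : ℕ) :=
  exists_coveringNumber_of_bitCert 4 (by decide +kernel) valid_certGL4Two (m := 1) (P := 15)
    rfl rfl (by decide +kernel) (by norm_num) (by norm_num) ⟨0, by decide⟩ rfl (by decide +kernel)
    (by decide +kernel) 1 6 ⟨1, by decide⟩ rfl (by decide +kernel) (by decide +kernel)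

/-- Generators of `GL(5, 2)`, as coded matrices over `𝔽₂`. -/
def certGL5Two : OrbitCert where
  c := 5775490
  cInv := 8521778
  period := 31
  size := 2
  gen := ![31650072, 26479350]
  genInv := ![3217037, 28604547]
  len := ![31, 31]
  base := 31650072
  baseInv := 3217037
  toBase := ![1877, 12559705]
  ofBase := ![1877, 225927]
  words := ![
    ![[5741390, 107419, 18008636, 430346, 7179418, 17121768, 6042240, 6121256, 493880,
        1773856, 2364515, 8637691, 23493764, 29666133, 8771877],
      [1028526, 10257801, 10595255, 1695310, 34486082, 5324298, 12158758, 13269905,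
        1305999, 444677, 3823319, 3888345, 6315442, 862646, 5858910, 13034251, 1178968,
        4028560, 5405449, 18568293, 5720657, 17960669, 4654593, 22082120, 10900305,
        7146414, 864712, 17820551, 1531322, 11337058, 16211854]],
    ![[],
      [18455142, 11654278, 26425315, 4275070, 49089857, 746327, 12359082, 30072476,
        1211124, 9565740, 13498346, 7876496, 11983398, 1332821, 5057054]]]

theorem valid_certGL5Two : certGL5Two.Valid (bitMul (2 ^ 5) 5) (bitOne 5) where
  c_inv := by decide +kernel
  base_inv := by decide +kernel
  gen_inv := by decide +kernel
  len_le := by decide +kernel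
  commute := by decide +kernel
  toBase := by decide +kernel
  ofBase := by decide +kernel
  words_ne := by decide +kernel
  words_eq := by decide +kernel

theorem exists_coveringNumber_eq_63 :
    ∃ (G : Type) (_ : Group G) (_ : Finite G), coveringNumber G = (63 : ℕ) :=
  exists_coveringNumber_of_bitCert 5 (by decide +kernel) valid_certGL5Two (m := 1) (P := 31)
    rfl rfl (by decide +kernel) (by norm_num) (by norm_num) ⟨0, by decide⟩ rfl (by decide +kernel)
    (by decide +kernel) 1 15 ⟨1, by decide⟩ rfl (by decide +kernel) (by decide +kernel)

/-- Generators of `GL(6, 2)`, as coded matrices over `𝔽₂`. -/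
def certGL6Two : OrbitCert where
  c := 3762323714
  cInv := 17315143777
  period := 63
  size := 2
  gen := ![15385304427, 52861675898]
  genInv := ![19930366503, 55513246271]
  len := ![63, 63]
  base := 15385304427
  baseInv := 19930366503
  toBase := ![468114, 3323317143]
  ofBase := ![468114, 6496007140]
  words := ![
    ![[95078531951, 886855205, 31549789665, 890448235, 74486571239, 1964432420,
        14226082434, 61318179465, 40584649787, 31098111831, 17197936997, 33769532435,
        1748480860, 20233417995, 768407804, 58243640561, 10226769883, 12341954144,
        15351733975, 47915459833, 15577933130, 765787133, 16586587351, 2707338127,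
        2901540536, 4523999417, 15753478836, 64211738353, 12001617951, 2173335778,
        29964610169],
      [4622117372, 14421300425, 13776047990, 15047342749, 100511616996, 4624147668,
        15238622595, 2274803714, 3573914086, 19786779636, 19150458469, 35003716692,
        19574536005, 28584644636, 7230069545, 13634325997, 8645690337, 36633211762,
        7086445564, 4077842215, 67365200463, 34291886697, 5457570038, 40632859726,
        3651747058, 13593496530, 30757579562, 17130870972, 67072740401, 1265806110,
        1421105402, 2995677233, 23217349981, 7096768348, 1625916577, 2702618695,
        18545956661, 19751030976, 2954822774, 10881468976, 30328172113, 4473333432,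
        4372342868, 6525405277, 275374100, 17466647043, 20699026704, 2350963498,
        21409401630, 45620223546, 2531121570, 11609465860, 45755261054, 29770105396,
        5673872773, 9508122641, 6919690171, 11743859164, 1043923802, 19266210600,
        33429100435, 109145616607, 3979731994]],
    ![[],
      [8252082552, 67679218022, 6485745842, 46180180525, 5537266656, 4588989798,
        39911492433, 2329485000, 26377322160, 36792024010, 101070797780, 10556836026,
        9205119745, 19587092158, 39248159506, 97045678449, 27830735546, 36591879195,
        608478320, 57387194411, 13598347053, 71482135168, 16259519763, 9302073137,
        42350453442, 16970970646, 5294908503, 7707399176, 2295796731, 12066434567,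
        23572437981]]]

theorem valid_certGL6Two : certGL6Two.Valid (bitMul (2 ^ 6) 6) (bitOne 6) where
  c_inv := by decide +kernel
  base_inv := by decide +kernel
  gen_inv := by decide +kernel
  len_le := by decide +kernel
  commute := by decide +kernel
  toBase := by decide +kernel
  ofBase := by decide +kernel
  words_ne := by decide +kernel
  words_eq := by decide +kernel

theorem exists_coveringNumber_eq_127 :
    ∃ (G : Type) (_ : Group G) (_ : Finite G), coveringNumber G = (127 : ℕ) :=
  exists_coveringNumber_of_bitCert 6 (by decide +kernel) valid_certGL6Two (m := 1) (P := 63)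
    rfl rfl (by decide +kernel) (by norm_num) (by norm_num) ⟨0, by decide⟩ rfl (by decide +kernel)
    (by decide +kernel) 1 31 ⟨1, by decide⟩ rfl (by decide +kernel) (by decide +kernel)

/-- Generators of `GL(3, 4)`, acting on `𝔽₂⁶`. -/
def certGL3Four : OrbitCert where
  c := 46548451844
  cInv := 8657573247
  period := 21
  size := 4
  gen := ![44418020668, 20152081243, 7764586409, 22490720855]
  genInv := ![46550568035, 27774658046, 53208919407, 44416070898]
  len := ![21, 21, 21, 21]
  base := 44418020668
  baseInv := 46550568035
  toBase := ![7509, 310657, 56032, 293420]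
  ofBase := ![7509, 41103, 384900, 414858]
  words := ![
    ![[279770, 273280, 5093, 363868, 265903, 64801, 265441, 42263, 41239, 53717],
      [326043, 263247, 291015, 299232, 274188, 44861, 283876, 290602, 36957, 278355,
        4619, 421833, 291495, 267432, 43153, 468718, 410661, 33060, 284744, 4561, 306753],
      [292297, 292000, 57065, 36532, 360815, 263539, 52795, 267261, 350987, 428808,
        429385, 3272831, 51475, 264113, 38292, 375359, 335954, 262338, 263553, 53771,
        325382],
      [56750, 36504, 315681, 306107, 273071, 280642, 317318, 38128, 37890, 43690,
        267013, 315729, 402649, 264126, 437314, 47712, 62394, 33498, 316808, 488934,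
        42792]],
    ![[],
      [2428221, 34000, 45205, 358085, 353039, 1000, 2207928, 263100, 330974, 307998],
      [35368, 40704, 294753, 330798, 287089, 330103, 32830, 34068, 58720, 490827, 33432,
        53969, 412173, 270545, 277432, 333320, 414751, 333243, 34384, 62278, 337006],
      [2108546, 54297, 329915, 39647, 401040, 46362, 268105, 48336, 48781, 5451, 419143,
        47232, 308579, 306915, 384448, 271118, 5412, 311126, 5638, 272284, 62977]],
    ![[],
      [],
      [37793, 282881, 269174, 289542, 320483, 2105665, 320702, 396641, 264450, 277661],
      [271367, 284651, 262384, 57152, 280119, 264014, 60713, 311389, 262807, 309260,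
        311366, 281498, 287395, 44810, 320539, 268369, 7225, 2212974, 60784, 33421,
        383965]],
    ![[],
      [],
      [],
      [35055, 297367, 34575, 35192, 59676, 363176, 265832, 308760, 292539, 269770]]]

theorem valid_certGL3Four : certGL3Four.Valid (bitMul (2 ^ 6) 6) (bitOne 6) where
  c_inv := by decide +kernel
  base_inv := by decide +kernel
  gen_inv := by decide +kernel
  len_le := by decide +kernel
  commute := by decide +kernel
  toBase := by decide +kernel
  ofBase := by decide +kernel
  words_ne := by decide +kernel
  words_eq := by decide +kernel

theorem exists_coveringNumber_eq_85 :
    ∃ (G : Type) (_ : Group G) (_ : Finite G), coveringNumber G = (85 : ℕ) :=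
  exists_coveringNumber_of_bitCert 6 (by decide +kernel) valid_certGL3Four (m := 3) (P := 21)
    rfl rfl (by decide +kernel) (by norm_num) (by norm_num) ⟨0, by decide⟩ rfl (by decide +kernel)
    (by decide +kernel) 1 15 ⟨3, by decide⟩ rfl (by decide +kernel) (by decide +kernel)

end LinearCertificates

section Digits

/-- The `i`-th digit of `x` in base `2 ^ β`. -/
def digit (β x i : ℕ) : ℕ := Nat.mod (Nat.shiftRight x (Nat.mul β i)) (Nat.pow 2 β)

/-- The number whose first `k` digits in base `2 ^ β` are the values of `f`, from `f s` on. -/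
def ofDigits (β : ℕ) (f : ℕ → ℕ) (k : ℕ) : ℕ → ℕ :=
  Nat.rec (motive := fun _ ↦ ℕ → ℕ) (fun _ ↦ 0)
    (fun _ ih s ↦ Nat.add (f s) (Nat.mul (Nat.pow 2 β) (ih (Nat.succ s)))) k

theorem digit_eq (β x i : ℕ) : digit β x i = x / (2 ^ β) ^ i % 2 ^ β := by
  rw [← pow_mul, ← Nat.shiftRight_eq_div_pow]; rfl

theorem digit_lt (β x i : ℕ) : digit β x i < 2 ^ β :=
  Nat.mod_lt _ (Nat.two_pow_pos β)

theorem digit_ofDigits {β : ℕ} {f : ℕ → ℕ} (hf : ∀ i, f i < 2 ^ β) (k : ℕ) :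
    ∀ s i, i < k → digit β (ofDigits β f k s) i = f (s + i) := by
  have hpos : 0 < 2 ^ β := by positivity
  induction k with
  | zero => intro s i hi; omega
  | succ k ih =>
    intro s i hi
    change digit β (f s + 2 ^ β * ofDigits β f k (s + 1)) i = _
    rw [digit_eq]
    cases i with
    | zero => simp [Nat.mod_eq_of_lt (hf s)]
    | succ i =>
      rw [pow_succ', ← Nat.div_div_eq_div_mul, Nat.add_mul_div_left _ _ hpos,
        Nat.div_eq_of_lt (hf s), zero_add, ← digit_eq, ih _ _ (by omega)]
      congr 1; omega

/-- Sum of the first `k` values of `f`. -/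
def sumTo (f : ℕ → ℕ) (k : ℕ) : ℕ :=
  Nat.rec (motive := fun _ ↦ ℕ) 0 (fun k s ↦ Nat.add s (f k)) k

theorem sumTo_eq (f : ℕ → ℕ) (k : ℕ) : sumTo f k = ∑ i : Fin k, f i := by
  induction k with
  | zero => rfl
  | succ k ih => rw [Fin.sum_univ_castSucc]; simp only [Fin.val_castSucc, Fin.val_last, ← ih]; rfl

end Digits

section CodedMatrices

variable (p n : ℕ)

/-- Product of coded `n × n` matrices over `ZMod p`: the entry in row `i` and column `j`
is the base 4 digit with index `n * i + j`. -/
def modMul (A B : ℕ) : ℕ :=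
  ofDigits 2 (fun t ↦ Nat.mod (sumTo (fun k ↦ Nat.mul (digit 2 A (Nat.add (Nat.mul n (Nat.div t n)) k))
    (digit 2 B (Nat.add (Nat.mul n k) (Nat.mod t n)))) n) p) (Nat.mul n n) 0

/-- Product of a coded matrix and a coded vector. -/
def modApply (A x : ℕ) : ℕ :=
  ofDigits 2 (fun i ↦ Nat.mod (sumTo (fun k ↦ Nat.mul (digit 2 A (Nat.add (Nat.mul n i) k))
    (digit 2 x k)) n) p) n 0

/-- Sum of coded vectors. -/
def modAdd (x y : ℕ) : ℕ :=
  ofDigits 2 (fun i ↦ Nat.mod (Nat.add (digit 2 x i) (digit 2 y i)) p) n 0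

/-- The matrix with a given code. -/
def codeMatrix (A : ℕ) : Matrix (Fin n) (Fin n) (ZMod p) :=
  Matrix.of fun i j ↦ (digit 2 A (n * i + j) : ZMod p)

/-- The vector with a given code. -/
def codeVec (x : ℕ) : Fin n → ZMod p := fun i ↦ (digit 2 x i : ZMod p)

/-- The linear map with a given coded matrix. -/
def modHom (A : ℕ) : AddMonoid.End (Fin n → ZMod p) :=
  (codeMatrix p n A).mulVecLin.toAddMonoidHom

variable {p n}

theorem natMod_lt_four (hp : 0 < p) (hp4 : p ≤ 4) (x : ℕ) : Nat.mod x p < 2 ^ 2 :=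
  lt_of_lt_of_le (Nat.mod_lt _ hp) hp4

theorem codeMatrix_modMul (hp : 0 < p) (hp4 : p ≤ 4) (A B : ℕ) :
    codeMatrix p n (modMul p n A B) = codeMatrix p n A * codeMatrix p n B := by
  ext i j
  have hn : 0 < n := i.pos
  have hlt : n * (i : ℕ) + j < Nat.mul n n := by
    change _ < n * n
    have := Nat.mul_le_mul_left n (Nat.succ_le_of_lt i.2)
    rw [Nat.mul_succ] at this
    have := j.2
    omega
  have hd : (n * (i : ℕ) + j) / n = i := by
    rw [Nat.mul_add_div hn, Nat.div_eq_of_lt j.2, add_zero]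
  have hm : (n * (i : ℕ) + j) % n = j := by
    rw [Nat.mul_add_mod, Nat.mod_eq_of_lt j.2]
  rw [codeMatrix, Matrix.of_apply, modMul,
    digit_ofDigits (fun i ↦ natMod_lt_four hp hp4 _) _ _ _ hlt]
  change ((sumTo (fun k ↦ digit 2 A (n * ((0 + (n * (i : ℕ) + j)) / n) + k) *
    digit 2 B (n * k + (0 + (n * (i : ℕ) + j)) % n)) n % p : ℕ) : ZMod p) = _
  rw [zero_add, hd, hm, ZMod.natCast_mod, sumTo_eq, Matrix.mul_apply]
  push_cast
  rfl

theorem modHom_modMul (hp : 0 < p) (hp4 : p ≤ 4) (A B : ℕ) :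
    modHom p n (modMul p n A B) = modHom p n A * modHom p n B := by
  unfold modHom
  rw [codeMatrix_modMul hp hp4]
  exact AddMonoidHom.ext fun x ↦ (Matrix.mulVec_mulVec x _ _).symm

theorem codeVec_modApply (hp : 0 < p) (hp4 : p ≤ 4) (A x : ℕ) :
    codeVec p n (modApply p n A x) = modHom p n A (codeVec p n x) := by
  ext i
  rw [codeVec, modApply, digit_ofDigits (fun i ↦ natMod_lt_four hp hp4 _) _ _ _ i.2]
  change ((sumTo (fun k ↦ digit 2 A (n * (0 + (i : ℕ)) + k) * digit 2 x k) n % p : ℕ) : ZMod p) = _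
  rw [zero_add, ZMod.natCast_mod, sumTo_eq]
  push_cast
  rfl

theorem codeVec_modAdd (hp : 0 < p) (hp4 : p ≤ 4) (x y : ℕ) :
    codeVec p n (modAdd p n x y) = codeVec p n x + codeVec p n y := by
  ext i
  rw [codeVec, modAdd, digit_ofDigits (fun i ↦ natMod_lt_four hp hp4 _) _ _ _ i.2]
  change ((digit 2 x (0 + i) + digit 2 y (0 + i)) % p : ℕ) = codeVec p n x i + codeVec p n y i
  rw [zero_add, ZMod.natCast_mod]
  push_cast
  rfl

/-- `coveringNumber_aff_of_cert` for coded matrices over `ZMod p`. -/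
theorem exists_coveringNumber_of_modCert (p n : ℕ) [NeZero p] (hp4 : p ≤ 4) {one : ℕ}
    (h1 : codeMatrix p n one = 1)
    {C : OrbitCert} (hC : C.Valid (modMul p n) one) {m P : ℕ} (hm : C.size = m + 1)
    (hP : C.period = P) (hlen : ∀ i, C.len i = P) (hP0 : 0 < P) (hV : p ^ n = m * P + 1)
    (i₀ : Fin C.size) (hi₀ : C.gen i₀ = C.base)
    (hc : ∀ x : Fin n → ZMod p, x ≠ 0 →
      ∃ y ∈ iterList (modApply p n C.c) (p ^ n) 1, x = codeVec p n y)
    (hc1 : codeVec p n (modApply p n C.c 1) ≠ codeVec p n 1) (v k : ℕ) (iu : Fin C.size)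
    (hiu : iu.val = m) (huk : codePow (modMul p n) one (C.gen iu) k = one)
    (hw : codeVec p n (iterNat (fun t ↦ modAdd p n v (modApply p n (C.gen iu) t)) k 0) ≠ 0) :
    ∃ (G : Type) (_ : Group G) (_ : Finite G), coveringNumber G = (m * P + 1 + P : ℕ) := by
  have hp : 0 < p := NeZero.pos p
  refine coveringNumber_aff_of_cert (φ := modHom p n) (modHom_modMul hp hp4) ?_
    (codeVec_modApply hp hp4) (codeVec_modAdd hp hp4) ?_ hC hm hP hlen hP0 ?_ i₀ hi₀ 1 (p ^ n)
    hc hc1 v k iu hiu huk hw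
  · refine AddMonoidHom.ext fun x ↦ ?_
    rw [modHom, h1]
    exact Matrix.one_mulVec x
  · ext i
    rw [codeVec, digit_eq]
    simp
  · rw [← hV]; simp

end CodedMatrices

section TernaryCertificates

/-- Generators of `GL(3, 3)`, as coded matrices. -/
def certGL3Three : OrbitCert where
  c := 17504
  cInv := 9221
  period := 13
  size := 3
  gen := ![83544, 136201, 100002]
  genInv := ![141382, 17812, 157080]
  len := ![13, 13, 13]
  base := 83544
  baseInv := 141382
  toBase := ![6729, 8110, 28948]
  ofBase := ![6729, 19943, 5494]
  words := ![
    ![[6560, 1743, 5786, 7977, 67536, 5983],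
      [5828, 4809, 28388, 19593, 4704, 1715, 6774, 25510, 7408, 17522, 7485, 1224, 1535],
      [24249, 17570, 17867, 29733, 1552, 69320, 7805, 1324, 17815, 1531, 6970, 1969,
        18444]],
    ![[],
      [21813, 20886, 18725, 17838, 75013, 65542],
      [17106, 18966, 24995, 21761, 18056, 31842, 5522, 395, 104518, 16940, 7950, 26679,
        1944]],
    ![[],
      [],
      [5585, 23384, 19330, 68078, 16707, 18655]]]

theorem valid_certGL3Three : certGL3Three.Valid (modMul 3 3) 65793 where
  c_inv := by decide +kernel
  base_inv := by decide +kernel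
  gen_inv := by decide +kernel
  len_le := by decide +kernel
  commute := by decide +kernel
  toBase := by decide +kernel
  ofBase := by decide +kernel
  words_ne := by decide +kernel
  words_eq := by decide +kernel

theorem exists_coveringNumber_eq_40 :
    ∃ (G : Type) (_ : Group G) (_ : Finite G), coveringNumber G = (40 : ℕ) :=
  exists_coveringNumber_of_modCert 3 3 (by norm_num) (by decide +kernel) valid_certGL3Three
    (m := 2) (P := 13) rfl rfl (by decide +kernel) (by norm_num) (by norm_num) ⟨0, by decide⟩ rfl
    (by decide +kernel) (by decide +kernel) 1 8 ⟨2, by decide⟩ rfl (by decide +kernel)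
    (by decide +kernel)

/-- Generators of `GL(4, 3)`, as coded matrices. -/
def certGL4Three : OrbitCert where
  c := 268714304
  cInv := 20975622
  period := 40
  size := 3
  gen := ![622225544, 2487261714, 1678268449]
  genInv := ![1386913866, 275130725, 2288525417]
  len := ![40, 40, 40]
  base := 622225544
  baseInv := 1386913866
  toBase := ![1782579, 7406480, 72291587]
  ofBase := ![1782579, 32138767, 68242065]
  words := ![
    ![[4593131, 22505578, 6731298, 6286115, 23861751, 70638516, 17199210, 68167095,
        4833575, 24851651, 24726737, 6239874, 4319783, 17629727, 20554323, 28522835,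
        6719749, 6105574, 33321750, 21143583],
      [27309035, 20442106, 19408663, 29674158, 100476427, 17772766, 1676795, 1462742,
        31611482, 309665, 72778877, 27772553, 20599786, 468488, 24453333, 29410272,
        6327269, 32748847, 29436948, 1440470, 18971575, 22621570, 69273595, 84121637,
        24805743, 5888634, 1200910, 18139419, 98547263, 6682890, 33497057, 28933774,
        4631817, 20801062, 6201918, 7313536, 27120306, 1238383, 72951839, 75104046],
      [7659173, 2079294, 21620431, 17896928, 388600, 22736722, 7417639, 30888750,
        1759341, 1390295, 26096459, 30938808, 24086205, 18198189, 6147220, 29335811,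
        24267543, 22169070, 22485771, 92438558, 89022612, 18121215, 1918762, 77689326,
        6806475, 86056112, 84674967, 6138014, 79910857, 22990461, 21691380, 67888135,
        17827654, 27614859, 6130232, 22502838, 18738761, 21398491, 70133443, 24191911]],
    ![[],
      [91750, 7832738, 5432836, 20814050, 94642632, 17163097, 76477475, 17085679,
        32663534, 1654528, 23169692, 23147535, 19378356, 93921694, 22068899, 24805581,
        18085454, 19373598, 17944029, 18223044],
      [1283664, 24579501, 28297927, 68271117, 33174826, 4558559, 22089666, 16904637,
        28409646, 68829420, 28722690, 20846338, 23281372, 18063296, 25053693, 6145532,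
        18290397, 78439935, 82755125, 22395873, 71610933, 20222001, 118663, 76575614,
        118015106, 5541355, 5818974, 18986075, 4844379, 6777414, 70355125, 79521775,
        20611863, 22214910, 23868392, 7619908, 32212376, 17709770, 19009908, 17831679]],
    ![[],
      [],
      [29923698, 17355395, 4237279, 82470651, 303606, 1388640, 20984003, 4232678,
        18750959, 97058784, 1827900, 27458918, 1896642, 29544428, 21094002, 19246920,
        111875635, 6163750, 4935080, 72466170]]]

theorem valid_certGL4Three : certGL4Three.Valid (modMul 3 4) 1074791425 where
  c_inv := by decide +kernel
  base_inv := by decide +kernel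
  gen_inv := by decide +kernel
  len_le := by decide +kernel
  commute := by decide +kernel
  toBase := by decide +kernel
  ofBase := by decide +kernel
  words_ne := by decide +kernel
  words_eq := by decide +kernel

theorem exists_coveringNumber_eq_121 :
    ∃ (G : Type) (_ : Group G) (_ : Finite G), coveringNumber G = (121 : ℕ) :=
  exists_coveringNumber_of_modCert 3 4 (by norm_num) (by decide +kernel) valid_certGL4Three
    (m := 2) (P := 40) rfl rfl (by decide +kernel) (by norm_num) (by norm_num) ⟨0, by decide⟩ rfl
    (by decide +kernel) (by decide +kernel) 1 26 ⟨2, by decide⟩ rfl (by decide +kernel)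
    (by decide +kernel)

end TernaryCertificates

section CodedPermutations

/-- Composition of coded self-maps of `Fin n`, the values being digits in base 16. -/
def permMul (n a b : ℕ) : ℕ :=
  ofDigits 4 (fun i ↦ digit 4 a (Nat.mod (digit 4 b i) n)) n 0

/-- The self-map with a given code. -/
def codeFun (n : ℕ) [NeZero n] (a : ℕ) (i : Fin n) : Fin n :=
  ⟨digit 4 a i % n, Nat.mod_lt _ (NeZero.pos n)⟩

/-- `codeFun` as an element of the monoid of self-maps. -/
def codeMap (n : ℕ) [NeZero n] (a : ℕ) : Function.End (Fin n) := codeFun n a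

theorem codeMap_eq_one {n : ℕ} [NeZero n] {a : ℕ} (h : ∀ i, codeFun n a i = i) :
    codeMap n a = 1 := funext h

theorem codeMap_permMul (n : ℕ) [NeZero n] (a b : ℕ) :
    codeMap n (permMul n a b) = codeMap n a * codeMap n b := by
  funext i
  refine Fin.ext ?_
  change digit 4 (permMul n a b) i % n = digit 4 a (digit 4 b i % n) % n
  rw [permMul, digit_ofDigits (fun _ ↦ digit_lt _ _ _) _ _ _ i.2, zero_add]
  rfl

end CodedPermutations

section SymmetricGroup

/-- The permutations leaving a set invariant. -/
def invariantSubgroup {α : Type*} (s : Set α) : Subgroup (Function.End α)ˣ where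
  carrier := {u | ∀ x, u.val x ∈ s ↔ x ∈ s}
  one_mem' _ := Iff.rfl
  mul_mem' ha hb x := (ha _).trans (hb x)
  inv_mem' {a} ha x := by
    rw [← ha]
    exact iff_of_eq (congrArg (· ∈ s) (congrFun a.mul_inv x))

/-- A permutation of seven points is even or leaves a set of one, two or three points invariant. -/
theorem sign_eq_one_or_exists_invariant (g : Equiv.Perm (Fin 7)) :
    Equiv.Perm.sign g = 1 ∨
      ∃ s : Finset (Fin 7), (1 ≤ s.card ∧ s.card ≤ 3) ∧ ∀ x, g x ∈ s ↔ x ∈ s := by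
  classical
  let s : Finset (Fin 7) := Finset.univ.filter (g.SameCycle 0)
  have hs : ∀ x, g x ∈ s ↔ x ∈ s := by simp [s]
  have h0 : (0 : Fin 7) ∈ s := by simpa [s] using Equiv.Perm.SameCycle.refl g 0
  have h1 : 1 ≤ s.card := Finset.card_pos.mpr ⟨0, h0⟩
  have h7 : s.card ≤ 7 := by simpa using Finset.card_le_univ s
  by_cases h3 : s.card ≤ 3
  · exact Or.inr ⟨s, ⟨h1, h3⟩, hs⟩
  by_cases hall : s.card = 7
  · left
    have hu : s = Finset.univ := Finset.eq_univ_of_card s (by simpa using hall)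
    have hsame : ∀ x, g.SameCycle 0 x := fun x ↦ by
      have : x ∈ s := hu ▸ Finset.mem_univ x
      simpa [s] using this
    have hcyc : g.IsCycleOn (Finset.univ : Finset (Fin 7)) :=
      ⟨by simp, fun x _ y _ ↦ (hsame x).symm.trans (hsame y)⟩
    have hpow : g ^ 7 = 1 := by
      ext x
      simpa using congrArg Fin.val (hcyc.pow_card_apply (Finset.mem_univ x))
    have := congrArg Equiv.Perm.sign hpow
    rw [map_pow, map_one] at this
    rcases Int.units_eq_one_or (Equiv.Perm.sign g) with h | h
    · exact h
    · rw [h] at this; exact absurd this (by decide)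
  · refine Or.inr ⟨sᶜ, ?_, ?_⟩
    · rw [Finset.card_compl, Fintype.card_fin]; omega
    · simpa [not_iff_not] using hs

/-- Generators of the symmetric group on seven points, as coded permutations. -/
def certSymSeven : OrbitCert where
  c := 6636321
  cInv := 88285446
  period := 7
  size := 9
  gen := ![88216416, 37111041, 23412786, 87441666, 73467171, 40174641, 23397186, 36791556,
    87037026]
  genInv := ![23405616, 69424641, 88281186, 73617441, 86376771, 88217091, 88154211, 52450881,
    23220276]
  len := ![7, 7, 7, 7, 7, 7, 7, 7, 7]
  base := 88216416
  baseInv := 23405616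
  toBase := ![192, 1206, 4438, 1265, 2764, 8762, 20, 1164, 5900]
  ofBase := ![192, 31179, 1205, 5346, 1502, 1582, 1032, 645, 7176]
  words := ![
    ![[34850, 2361, 11959],
      [2489, 2827, 10701, 597, 10461, 8997, 942],
      [991, 11210, 11897, 16025, 10406, 35033, 9802],
      [2463, 3139, 14245, 10273, 9457, 580, 2471],
      [9244, 3914, 2435, 2929, 2953, 3059, 8781],
      [2537, 3178, 12248, 46101, 3228, 3622, 11611],
      [2499, 961, 2318, 880, 3882, 2679, 33504],
      [958, 2487, 2113, 839, 2274, 8506, 14321],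
      [2974, 2332, 2841, 13969, 2282, 3913, 4039]],
    ![[],
      [923, 10752, 8491],
      [8379, 583, 3892, 2264, 12735, 12049, 2624],
      [33381, 11673, 9932, 2490, 13078, 3299, 2161],
      [3032, 9338, 2089, 8832, 727, 13039, 2912],
      [3880, 3341, 202800, 3694, 3223, 1014, 33461],
      [828, 1006, 2313, 11672, 11582, 33672, 3844],
      [8893, 913, 3484, 9375, 9873, 8894, 3769],
      [759, 890, 2871, 34146, 3496, 10063, 2812]],
    ![[],
      [],
      [918, 810, 9737],
      [3065, 16325, 12301, 2111, 3056, 3970, 13755],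
      [10994, 36240, 9358, 8838, 238, 818, 2690],
      [9141, 226, 528, 8232, 2994, 2552, 993],
      [779, 2174, 951, 234, 520, 2393, 939],
      [12, 571, 576, 11221, 13418, 10941, 198],
      [929, 3737, 8952, 3606, 14432, 8692, 8609]],
    ![[],
      [],
      [],
      [3960, 12789, 2127],
      [2299, 2404, 39639, 2714, 49731, 733, 9879],
      [15571, 2956, 3323, 3422, 8562, 2257, 3601],
      [8602, 249649, 8836, 16050, 11550, 8717, 37],
      [2419, 11452, 830, 9746, 2598, 133, 9853],
      [2657, 10559, 2527, 897, 8992, 724, 8932]],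
    ![[],
      [],
      [],
      [],
      [130, 668, 2414],
      [3081, 9664, 11779, 888, 746, 10249, 11197],
      [2339, 3035, 9092, 3792, 12924, 12473, 10702],
      [33, 4091, 33308, 8831, 9170, 33091, 936],
      [2795, 2519, 223, 12660, 732, 3535, 37116]],
    ![[],
      [],
      [],
      [],
      [],
      [3100, 12, 3169],
      [3299, 3630, 2325, 199, 15154, 571, 972],
      [2077, 2050, 14895, 911, 11235, 8379, 594],
      [2617, 918, 11006, 8474, 3161, 15677, 11698]],
    ![[],
      [],
      [],
      [],
      [],
      [],
      [3871, 15, 2709],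
      [3422, 2304, 2784, 586, 8250, 11389, 2068],
      [9435, 848, 3691, 9608, 807, 3276, 972]],
    ![[],
      [],
      [],
      [],
      [],
      [],
      [],
      [15564, 9784, 2663],
      [8488, 920, 9722, 10627, 784, 827, 8238]],
    ![[],
      [],
      [],
      [],
      [],
      [],
      [],
      [],
      [13405, 9119, 14]]]

theorem valid_certSymSeven : certSymSeven.Valid (permMul 7) 106181136 where
  c_inv := by decide +kernel
  base_inv := by decide +kernel
  gen_inv := by decide +kernel
  len_le := by decide +kernel
  commute := by decide +kernel
  toBase := by decide +kernel
  ofBase := by decide +kernel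
  words_ne := by decide +kernel
  words_eq := by decide +kernel

theorem exists_coveringNumber_eq_64 :
    ∃ (G : Type) (_ : Group G) (_ : Finite G), coveringNumber G = (64 : ℕ) := by
  obtain ⟨c, r₀, r, hc, hr₀, -, -, hmem, -, hgen⟩ :=
    valid_certSymSeven.exists_units (codeMap_permMul 7)
      (codeMap_eq_one (by decide +kernel))
  have : Finite (Function.End (Fin 7)) := inferInstanceAs (Finite (Fin 7 → Fin 7))
  refine ⟨Subgroup.closure {c, r₀}, inferInstance, inferInstance, le_antisymm ?_ ?_⟩
  · let sgn : (Function.End (Fin 7))ˣ →* ℤˣ :=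
      Equiv.Perm.sign.comp Equiv.Perm.equivUnitsEnd.symm.toMonoidHom
    have h := coveringNumber_subgroup_le_of_family (Subgroup.closure {c, r₀})
      (ι := Option {s : Finset (Fin 7) // 1 ≤ s.card ∧ s.card ≤ 3})
      (fun s ↦ s.elim sgn.ker fun s ↦ invariantSubgroup (s.1 : Set (Fin 7))) ?_ ?_
    · rw [Nat.card_eq_fintype_card] at h
      exact h.trans_eq (congrArg _ (by decide +kernel))
    · rintro (_ | ⟨s, hs⟩) h
      · have h1 : sgn r₀ = 1 := h (right_mem_closure_pair _ _)
        let g : Equiv.Perm (Fin 7) := ⟨codeFun 7 certSymSeven.base,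
          codeFun 7 certSymSeven.baseInv, show ∀ x, _ by decide +kernel,
          show ∀ x, _ by decide +kernel⟩
        have h2 : Equiv.Perm.sign g = -1 := by decide +kernel
        have h3 : Equiv.Perm.equivUnitsEnd.symm r₀ = g := Equiv.ext fun x ↦ congrFun hr₀ x
        change Equiv.Perm.sign (Equiv.Perm.equivUnitsEnd.symm r₀) = 1 at h1
        rw [h3, h2] at h1
        exact absurd h1 (by decide)
      · have h1 : c ∈ invariantSubgroup (s : Set (Fin 7)) := h (left_mem_closure_pair _ _)
        have h2 : ∀ s : Finset (Fin 7), 1 ≤ s.card ∧ s.card ≤ 3 →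
          ¬ ∀ x, codeFun 7 certSymSeven.c x ∈ s ↔ x ∈ s := by decide +kernel
        refine h2 s hs fun x ↦ ?_
        have := h1 x
        rwa [hc] at this
    · intro g _
      rcases sign_eq_one_or_exists_invariant (Equiv.Perm.equivUnitsEnd.symm g) with h | ⟨s, hs, h⟩
      · exact ⟨none, h⟩
      · exact ⟨some ⟨s, hs⟩, h⟩
  · have h := le_coveringNumber_of_pairwise_subgroup _ _ (orbitFamily_mem hmem) hgen
    rw [Nat.card_eq_fintype_card] at h
    exact le_trans (le_of_eq (congrArg _ (by decide +kernel))) h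

end SymmetricGroup

section LinearFourTwo

/-- `4 × 4` matrices over `𝔽₂`. -/
abbrev MatFour : Type := Matrix (Fin 4) (Fin 4) (ZMod 2)

theorem matFour_two_eq_zero : (2 : MatFour) = 0 := by
  have : ((2 : ℕ) : MatFour) = 0 := CharP.cast_eq_zero _ 2
  exact_mod_cast this

theorem matFour_add_self (x : MatFour) : x + x = 0 := by
  rw [← two_mul, matFour_two_eq_zero, zero_mul]

theorem exists_commuting_root {g : MatFour} (hdet : g.det ≠ 0)
    (hfix : ∀ v, g.mulVec v = v → v = 0) :
    ∃ w : MatFour, w * w + w + 1 = 0 ∧ g * w = w * g := by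
  have hdeg : g.charpoly.natDegree = 4 := by simp [Matrix.charpoly_natDegree_eq_dim]
  have hlead : g.charpoly.coeff 4 = 1 := by
    have := g.charpoly_monic.coeff_natDegree
    rwa [hdeg] at this
  have hone : ∀ a : ZMod 2, a ≠ 0 → a = 1 := by decide
  have h0 : g.charpoly.coeff 0 = 1 := by
    have := Matrix.det_eq_sign_charpoly_coeff g
    apply hone
    intro h
    rw [h, mul_zero] at this
    exact hdet this
  have hCH : g ^ 4 + g.charpoly.coeff 3 • g ^ 3 + g.charpoly.coeff 2 • g ^ 2 +
      g.charpoly.coeff 1 • g + 1 = 0 := by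
    have := g.aeval_self_charpoly
    rw [Polynomial.aeval_eq_sum_range, hdeg] at this
    simp only [Finset.sum_range_succ, Finset.sum_range_zero, h0, hlead, pow_zero, pow_one,
      one_smul, zero_add] at this
    rw [← this]; abel
  have h1 : g.charpoly.coeff 1 + g.charpoly.coeff 2 + g.charpoly.coeff 3 = 1 := by
    have h2 : g.charpoly.eval 1 ≠ 0 := by
      rw [Matrix.eval_charpoly]
      intro h
      obtain ⟨v, hv, hv'⟩ := Matrix.exists_mulVec_eq_zero_iff.mpr h
      apply hv
      apply hfix
      rw [Matrix.sub_mulVec, map_one, Matrix.one_mulVec, sub_eq_zero] at hv'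
      exact hv'.symm
    rw [Polynomial.eval_eq_sum_range, hdeg] at h2
    simp only [Finset.sum_range_succ, Finset.sum_range_zero, h0, hlead, one_pow, mul_one,
      zero_add] at h2
    revert h2
    generalize g.charpoly.coeff 1 = a
    generalize g.charpoly.coeff 2 = b
    generalize g.charpoly.coeff 3 = c
    revert a b c
    decide
  revert hCH h1
  generalize g.charpoly.coeff 1 = a
  generalize g.charpoly.coeff 2 = b
  generalize g.charpoly.coeff 3 = c
  have hab : ∀ a b c : ZMod 2, a + b + c = 1 → (a = 1 ∧ b = 0 ∧ c = 0) ∨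
      (a = 0 ∧ b = 1 ∧ c = 0) ∨ (a = 0 ∧ b = 0 ∧ c = 1) ∨ (a = 1 ∧ b = 1 ∧ c = 1) := by decide
  intro hCH h1
  rcases hab a b c h1 with ⟨rfl, rfl, rfl⟩ | ⟨rfl, rfl, rfl⟩ | ⟨rfl, rfl, rfl⟩ | ⟨rfl, rfl, rfl⟩ <;>
    simp only [one_smul, zero_smul, add_zero] at hCH
  · refine ⟨g ^ 2 + g, ?_, by noncomm_ring⟩
    rw [show (g ^ 2 + g) * (g ^ 2 + g) + (g ^ 2 + g) + 1 = (g ^ 4 + g + 1) + 2 * (g ^ 3 + g ^ 2) by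
      noncomm_ring, hCH, matFour_two_eq_zero, zero_mul, add_zero]
  · refine ⟨g ^ 2, ?_, by noncomm_ring⟩
    rw [← hCH]; noncomm_ring
  · refine ⟨g ^ 3 + g, ?_, by noncomm_ring⟩
    rw [show (g ^ 3 + g) * (g ^ 3 + g) + (g ^ 3 + g) + 1 = (g ^ 4 + g ^ 3 + 1) * (g ^ 2 + g + 1) -
      2 * g ^ 5 by noncomm_ring, hCH, matFour_two_eq_zero, zero_mul, zero_mul, sub_zero]
  · refine ⟨g ^ 3 + g ^ 2 + 1, ?_, by noncomm_ring⟩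
    rw [show (g ^ 3 + g ^ 2 + 1) * (g ^ 3 + g ^ 2 + 1) + (g ^ 3 + g ^ 2 + 1) + 1 =
      (g ^ 4 + g ^ 3 + g ^ 2 + g + 1) * (g ^ 2 + g + 1) + 2 * (1 - g ^ 4 - g) by noncomm_ring,
      hCH, matFour_two_eq_zero, zero_mul, zero_mul, add_zero]

/-- The units fixing a vector. -/
def vectorStabilizer (v : Fin 4 → ZMod 2) : Subgroup MatFourˣ where
  carrier := {u | u.val.mulVec v = v}
  one_mem' := Matrix.one_mulVec v
  mul_mem' {a b} ha hb := by
    change (a.val * b.val).mulVec v = v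
    rw [← Matrix.mulVec_mulVec, show b.val.mulVec v = v from hb, show a.val.mulVec v = v from ha]
  inv_mem' {a} ha := by
    change (a⁻¹).val.mulVec v = v
    conv_lhs => rw [← show a.val.mulVec v = v from ha]
    rw [Matrix.mulVec_mulVec, Units.inv_mul, Matrix.one_mulVec]

/-- The units semilinear with respect to the `𝔽₄`-structure given by `w`. -/
def semilinearSubgroup (w : MatFour) : Subgroup MatFourˣ where
  carrier := {u | u.val * w = w * u.val ∨ u.val * w = w * u.val + u.val}
  one_mem' := Or.inl (by simp)
  mul_mem' {a b} ha hb := by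
    have h2 := matFour_add_self (a.val * b.val)
    change a.val * b.val * w = w * (a.val * b.val) ∨
      a.val * b.val * w = w * (a.val * b.val) + a.val * b.val
    rcases ha with ha | ha <;> rcases hb with hb | hb <;> rw [mul_assoc, hb]
    · left; rw [← mul_assoc, ha, mul_assoc]
    · right; rw [mul_add, ← mul_assoc, ha, mul_assoc]
    · right; rw [← mul_assoc, ha, add_mul, mul_assoc]
    · left; rw [mul_add, ← mul_assoc, ha, add_mul, mul_assoc, add_assoc, h2, add_zero]
  inv_mem' {a} ha := by
    have key : ∀ x : MatFour, a.val * w = w * a.val + x →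
        (a⁻¹).val * w = w * (a⁻¹).val + (a⁻¹).val * x * (a⁻¹).val := by
      intro x hx
      have h1 := congrArg (fun y ↦ (a⁻¹).val * y * (a⁻¹).val) hx
      simp only [mul_add, add_mul, ← mul_assoc, Units.inv_mul, one_mul] at h1
      rw [mul_assoc ((a⁻¹).val * w), Units.mul_inv, mul_one] at h1
      rw [h1, add_assoc, matFour_add_self, add_zero]
    rcases ha with ha | ha
    · left
      have := key 0 (by rw [ha, add_zero])
      simpa using this
    · right
      have := key _ ha
      simpa using this

/-- Whether `e₀`, `a`, `e_j`, `b` are linearly independent, where `j = 2` if `a = e₁`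
and `j = 1` otherwise. -/
def FrameCondition (p : (Fin 4 → ZMod 2) × (Fin 4 → ZMod 2)) : Prop :=
  p.1 0 = 0 ∧ ∀ d : Fin 4 → ZMod 2, d 0 = 0 → d ⬝ᵥ p.1 = 0 →
    d (if p.1 = ![0, 1, 0, 0] then 2 else 1) = 0 → d ⬝ᵥ p.2 = 0 → d = 0

instance : DecidablePred FrameCondition := fun p ↦ by unfold FrameCondition; infer_instance

theorem card_frameCondition : Nat.card {p // FrameCondition p} = 56 := by
  rw [Nat.card_eq_fintype_card]
  decide +kernel

theorem frameCondition_of_root {w : MatFour} (hw : w * w + w + 1 = 0) (h0 : w 0 0 = 0) (j : Fin 4)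
    (hj : j = if (fun i ↦ w i 0) = ![0, 1, 0, 0] then 2 else 1) :
    FrameCondition (fun i ↦ w i 0, fun i ↦ w i j) := by
  refine ⟨h0, ?_⟩
  dsimp only
  rw [← hj]
  intro d hd0 hda hdj hdb
  by_contra hd
  set d' := Matrix.vecMul d w with hd'
  have hdd : Matrix.vecMul d' w = d' + d := by
    have h := congrArg (Matrix.vecMul d) hw
    rw [Matrix.vecMul_add, Matrix.vecMul_add, Matrix.vecMul_one, Matrix.vecMul_zero,
      ← Matrix.vecMul_vecMul, ← hd'] at h
    have hd2 : ∀ x y z : ZMod 2, x + y + z = 0 → x = y + z := by decide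
    funext i
    exact hd2 _ _ _ (congrFun h i)
  have h1 : d' 0 = 0 := hda
  have h2 : d' j = 0 := hdb
  have h3 : d' ⬝ᵥ (fun i ↦ w i 0) = 0 := by
    change Matrix.vecMul d' w 0 = 0
    rw [hdd, Pi.add_apply, h1, hd0, add_zero]
  have h4 : d' ≠ 0 := by
    intro h
    rw [h, Matrix.zero_vecMul, zero_add] at hdd
    exact hd hdd.symm
  have h5 : d ≠ d' := by
    intro h
    rw [← h] at hdd
    rw [← hd', ← h] at hdd
    exact hd (by simpa using hdd)
  have ha0 : (fun i ↦ w i 0) ≠ 0 := by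
    intro h
    have := congrFun (congrFun hw 0) 0
    simp only [Matrix.add_apply, Matrix.mul_apply, Matrix.one_apply_eq, Matrix.zero_apply] at this
    have h6 : ∀ i, w i 0 = 0 := congrFun h
    simp [h6] at this
  have key : ∀ d d' : Fin 4 → ZMod 2, d 0 = 0 ∧ d' 0 = 0 ∧ d ≠ 0 ∧ d' ≠ 0 ∧ d ≠ d' →
      ∀ a : Fin 4 → ZMod 2, a 0 = 0 ∧ a ≠ 0 ∧ d ⬝ᵥ a = 0 ∧ d' ⬝ᵥ a = 0 →
        ¬ (d (if a = ![0, 1, 0, 0] then 2 else 1) = 0 ∧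
          d' (if a = ![0, 1, 0, 0] then 2 else 1) = 0) := by
    decide +kernel
  exact key d d' ⟨hd0, h1, hd, h4, h5⟩ (fun i ↦ w i 0) ⟨h0, ha0, hda, h3⟩ (hj ▸ ⟨hdj, h2⟩)

theorem card_root_le :
    Nat.card {w : MatFour // w * w + w + 1 = 0 ∧ w 0 0 = 0} ≤ 56 := by
  rw [← card_frameCondition]
  let J : MatFour → Fin 4 := fun w ↦ if (fun i ↦ w i 0) = ![0, 1, 0, 0] then 2 else 1
  refine Nat.card_le_card_of_injective
    (fun w ↦ (⟨_, frameCondition_of_root w.2.1 w.2.2 (J w.1) rfl⟩ : {p // FrameCondition p})) ?_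
  rintro ⟨w, hw, hw0⟩ ⟨x, hx, hx0⟩ h
  rw [Subtype.mk.injEq, Prod.mk.injEq] at h
  obtain ⟨h1, h2⟩ := h
  have hJ : J w = J x := by simp only [J]; dsimp only at h1; rw [h1]
  rw [← hJ] at h2
  have hcol : ∀ k, (fun i ↦ w i k) = (fun i ↦ x i k) →
      (w - x).mulVec (fun i ↦ w i k) = 0 := by
    intro k hk
    have e1 : ∀ y : MatFour, y * y + y + 1 = 0 →
        y.mulVec (fun i ↦ y i k) = (fun i ↦ y i k) + (fun i ↦ (1 : MatFour) i k) := by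
      intro y hy
      funext i
      have := congrFun (congrFun hy i) k
      have hd2 : ∀ x y z : ZMod 2, x + y + z = 0 → x = y + z := by decide
      exact hd2 _ _ _ this
    rw [Matrix.sub_mulVec, e1 w hw]
    conv_lhs => rw [hk]
    rw [e1 x hx, sub_self]
  refine Subtype.ext ?_
  rw [← sub_eq_zero]
  ext i k
  have hrow := (frameCondition_of_root hw hw0 (J w) rfl).2 (fun k ↦ (w - x) i k)
    (by simpa [sub_eq_zero] using congrFun h1 i) (congrFun (hcol 0 h1) i)
    (by simpa [sub_eq_zero] using congrFun h2 i) (congrFun (hcol _ h2) i)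
  exact congrFun hrow k

/-- Generators of `GL(4, 2)`, as coded matrices. -/
def certGL4TwoLarge : OrbitCert where
  c := 268714304
  cInv := 20975621
  period := 15
  size := 6
  gen := ![356586577, 1157694804, 1163203857, 353652801, 1347704129, 1363149060]
  genInv := ![1410405700, 1146164240, 340788561, 1364542800, 357912596, 273940740]
  len := ![15, 5, 15, 15, 5, 15]
  base := 356586577
  baseInv := 1410405700
  toBase := ![6729, 41949, 32447, 37989, 25047, 5912]
  ofBase := ![6729, 18824, 6898, 228, 10282, 18136]
  words := ![
    ![[22361, 41259, 3605, 1908, 71953, 6372, 11571],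
      [20924, 72464, 1491, 26545, 2233, 135236, 21783, 23448, 17677, 12002, 3989, 42270,
        16322, 101905, 56109],
      [18654, 19302, 10982, 119947, 13556, 5781, 9831, 26136, 1140, 19211, 25686, 7677,
        7617, 14847, 8850],
      [13796, 26569, 4962, 14886, 18097, 89481, 3310, 57587, 7301, 1398, 41376, 17752,
        26763, 222, 15208],
      [9262, 9946, 37941, 58123, 1327, 10462, 23615, 11537, 44125, 24776, 119506, 9973,
        1265, 6439, 8619],
      [542, 22587, 42530, 8676, 4636, 51234, 57961, 6479, 10529, 28591, 43670, 17318,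
        222095, 7367, 11981]],
    ![[],
      [14758, 15564, 18231, 42011],
      [15516, 3689, 6649, 56109, 12656, 76815, 283816, 6000, 5063, 2390, 26618, 32775,
        37353, 69, 2717],
      [10578, 26608, 4675, 8852, 13856, 10235, 4171, 25792, 4114, 10448, 80947, 37869,
        15841, 20978, 79980],
      [38378, 23388, 24665, 4285, 70204, 9512, 918, 8621, 11096, 824, 8522, 30960, 5608,
        41938, 18267],
      [2830, 4414, 21954, 52073, 20584, 33552, 35416, 20226, 19854, 20170, 13638, 27033,
        22434, 6541, 19530]],
    ![[],
      [],
      [19044, 14267, 37924, 15894, 39592, 5976, 11143],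
      [22970, 83342, 4044, 157, 58263, 18020, 56525, 49129, 1610, 42917, 4316, 39373,
        68486, 2982, 7702],
      [3573, 4355, 2667, 17075, 29541, 23520, 34742, 497, 29634, 11491, 6041, 75649,
        13550, 13356, 16136],
      [13692, 74228, 24231, 104875, 23574, 33153, 692, 14862, 10354, 19317, 53514, 1014,
        19890, 15077, 1714]],
    ![[],
      [],
      [],
      [10058, 17935, 18844, 11102, 33061, 11984, 14824],
      [18343, 22904, 7990, 120777, 3386, 10364, 74847, 40762, 3275, 63090, 8810, 39855,
        23427, 13382, 13154],
      [13374, 13248, 43058, 138786, 12733, 31991, 10644, 6099, 12860, 47515, 23266,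
        5608, 14823, 13988, 15665]],
    ![[],
      [],
      [],
      [],
      [131478, 6494, 2912, 19120],
      [57864, 44002, 16835, 10198, 25331, 12834, 76728, 2122, 9375, 13561, 2368, 6870,
        15330, 12673, 12152]],
    ![[],
      [],
      [],
      [],
      [],
      [6405, 13767, 67160, 713, 72437, 11502, 15065]]]

theorem valid_certGL4TwoLarge : certGL4TwoLarge.Valid (modMul 2 4) 1074791425 where
  c_inv := by decide +kernel
  base_inv := by decide +kernel
  gen_inv := by decide +kernel
  len_le := by decide +kernel
  commute := by decide +kernel
  toBase := by decide +kernel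
  ofBase := by decide +kernel
  words_ne := by decide +kernel
  words_eq := by decide +kernel

theorem semilinearSubgroup_add_one (w : MatFour) :
    semilinearSubgroup (w + 1) = semilinearSubgroup w := by
  ext u
  change (u.val * (w + 1) = (w + 1) * u.val ∨ u.val * (w + 1) = (w + 1) * u.val + u.val) ↔
    (u.val * w = w * u.val ∨ u.val * w = w * u.val + u.val)
  rw [mul_add, add_mul, mul_one, one_mul, add_left_inj,
    add_right_comm (w * u.val) u.val u.val, add_left_inj]

theorem not_mem_semilinearSubgroup {w : MatFour} (hw : w * w + w + 1 = 0) {x : MatFourˣ}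
    (hx : x ^ 7 = 1) (v₀ : Fin 4 → ZMod 2) (hv₀ : v₀ ≠ 0) (hfix₀ : x.val.mulVec v₀ = v₀)
    (hfix : ∀ v, x.val.mulVec v = v → v = 0 ∨ v = v₀) : x ∉ semilinearSubgroup w := by
  intro h
  have h2 : Commute (x.val ^ 2) w := by
    rcases h with h | h
    · exact (show Commute x.val w from h).pow_left 2
    · change x.val ^ 2 * w = w * x.val ^ 2
      rw [sq, mul_assoc, h, mul_add, ← mul_assoc, h, add_mul, mul_assoc, add_assoc,
        matFour_add_self, add_zero]
  have h8 : (x.val ^ 2) ^ 4 = x.val := by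
    rw [← pow_mul, show 2 * 4 = 7 + 1 from rfl, pow_succ]
    rw [← Units.val_pow_eq_pow_val, hx, Units.val_one, one_mul]
  have h1 : x.val * w = w * x.val := by
    have := h2.pow_left 4
    rwa [h8] at this
  have h3 := hfix (w.mulVec v₀) (by
    rw [Matrix.mulVec_mulVec, h1, ← Matrix.mulVec_mulVec, hfix₀])
  have h4 := congrArg (Matrix.mulVec · v₀) hw
  simp only [Matrix.add_mulVec, ← Matrix.mulVec_mulVec, Matrix.one_mulVec,
    Matrix.zero_mulVec] at h4
  apply hv₀
  rcases h3 with h3 | h3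
  · simpa [h3] using h4
  · rw [h3, h3] at h4
    have : ∀ v : Fin 4 → ZMod 2, v + v + v = 0 → v = 0 := by decide +kernel
    exact this _ h4

theorem exists_coveringNumber_eq_71 :
    ∃ (G : Type) (_ : Group G) (_ : Finite G), coveringNumber G = (71 : ℕ) := by
  have hφ := codeMatrix_modMul (p := 2) (n := 4) (by norm_num) (by norm_num)
  have h1 : codeMatrix 2 4 1074791425 = 1 := by decide +kernel
  obtain ⟨c, r₀, r, hc, hr₀, -, -, hmem, -, hgen⟩ :=
    valid_certGL4TwoLarge.exists_units hφ h1
  refine ⟨Subgroup.closure {c, r₀}, inferInstance, inferInstance, le_antisymm ?_ ?_⟩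
  · have h := coveringNumber_subgroup_le_of_family (Subgroup.closure {c, r₀})
      (ι := {v : Fin 4 → ZMod 2 // v ≠ 0} ⊕ {w : MatFour // w * w + w + 1 = 0 ∧ w 0 0 = 0})
      (Sum.elim (fun v ↦ vectorStabilizer v) fun w ↦ semilinearSubgroup w) ?_ ?_
    · refine h.trans ?_
      have h15 : Nat.card {v : Fin 4 → ZMod 2 // v ≠ 0} = 15 := by
        rw [Nat.card_eq_fintype_card]; decide +kernel
      rw [Nat.card_sum, h15]
      exact_mod_cast Nat.add_le_add_left card_root_le 15
    · rintro (⟨v, hv⟩ | ⟨w, hw, _⟩) h'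
      · have h1 : c.val.mulVec v = v := h' (left_mem_closure_pair _ _)
        rw [hc] at h1
        have h2 : ∀ v : Fin 4 → ZMod 2,
          (codeMatrix 2 4 certGL4TwoLarge.c).mulVec v = v → v = 0 := by decide +kernel
        exact hv (h2 v h1)
      · let x : MatFourˣ := codeUnit hφ h1 1427374353 1409619204 (by decide +kernel)
        have hx : x ∈ Subgroup.closure {c, r₀} :=
          wordEq_sound hφ hc hr₀ (t := 1427374353) rfl
            (show wordEq _ _ _ 21 _ = true by decide +kernel)
        refine not_mem_semilinearSubgroup hw (x := x) ?_ ![0, 0, 0, 1] (by decide +kernel)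
          (show (codeMatrix 2 4 1427374353).mulVec _ = _ by decide +kernel)
          (show ∀ v, (codeMatrix 2 4 1427374353).mulVec v = v → _ by decide +kernel) (h' hx)
        refine Units.ext ?_
        rw [codePow_sound hφ (one := 1074791425) (a := 1427374353) rfl h1,
          show codePow (modMul 2 4) 1074791425 1427374353 7 = 1074791425 by decide +kernel, h1,
          Units.val_one]
    · intro g _
      by_cases hg : ∃ v, v ≠ 0 ∧ g.val.mulVec v = v
      · obtain ⟨v, hv, h⟩ := hg
        exact ⟨.inl ⟨v, hv⟩, h⟩
      · push Not at hg
        obtain ⟨w, hw, hgw⟩ := exists_commuting_root (g := g.val)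
          ((Matrix.isUnit_iff_isUnit_det _).mp g.isUnit).ne_zero
          (fun v hv ↦ by by_contra h0; exact hg v h0 hv)
        have hmem' : g ∈ semilinearSubgroup w := Or.inl hgw
        by_cases h0 : w 0 0 = 0
        · exact ⟨.inr ⟨w, hw, h0⟩, hmem'⟩
        · refine ⟨.inr ⟨w + 1, ?_, ?_⟩, ?_⟩
          · rw [← hw]
            have := matFour_add_self (w + 1)
            rw [show (w + 1) * (w + 1) + (w + 1) + 1 = w * w + w + 1 + (w + 1 + (w + 1)) by
              noncomm_ring, this, add_zero]
          · have : ∀ a : ZMod 2, a ≠ 0 → a + 1 = 0 := by decide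
            exact this _ h0
          · change g ∈ semilinearSubgroup (w + 1)
            rwa [semilinearSubgroup_add_one]
  · have h := le_coveringNumber_of_pairwise_subgroup _ _ (orbitFamily_mem hmem) hgen
    rw [Nat.card_eq_fintype_card] at h
    exact le_trans (le_of_eq (congrArg _ (by decide +kernel))) h

end LinearFourTwo

section BitMatrixEntries

/-- The `i`-th binary digit of `m`. -/
def bitEntry (m i : ℕ) : ZMod 2 := ((m / 2 ^ i : ℕ) : ZMod 2)

/-- The matrix over `𝔽₂` with a given code, the columns being digits in base `2 ^ n`. -/
def bitMatrix (n A : ℕ) : Matrix (Fin n) (Fin n) (ZMod 2) :=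
  Matrix.of fun i j ↦ bitEntry (A / (2 ^ n) ^ (j : ℕ) % 2 ^ n) i

theorem natCast_xor (a b : ℕ) : ((a ^^^ b : ℕ) : ZMod 2) = a + b := by
  have h : (a ^^^ b) % 2 = (a + b) % 2 := by
    rw [show (a ^^^ b) % 2 = a % 2 ^^^ b % 2 by
      simpa using Nat.xor_mod_two_pow (a := a) (b := b) (n := 1)]
    rcases Nat.mod_two_eq_zero_or_one a with h | h <;>
      rcases Nat.mod_two_eq_zero_or_one b with h' | h' <;> simp [h, h', Nat.add_mod]
  rw [← Nat.cast_add]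
  exact (ZMod.natCast_eq_natCast_iff _ _ _).mpr h

theorem bitEntry_xor (a b i : ℕ) : bitEntry (a ^^^ b) i = bitEntry a i + bitEntry b i := by
  rw [bitEntry, Nat.xor_div_two_pow, natCast_xor]; rfl

theorem bitEntry_bitApply (q k i : ℕ) : ∀ A x, bitEntry (bitApply q k A x) i =
    ∑ j : Fin k, bitEntry (A / q ^ (j : ℕ) % q) i * bitEntry x j := by
  induction k with
  | zero => intro A x; simp [bitApply, bitEntry]
  | succ k ih =>
    intro A x
    rw [bitApply_succ, bitEntry_xor, ih, Fin.sum_univ_succ]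
    congr 1
    · have h : bitEntry x 0 = ((x % 2 : ℕ) : ZMod 2) := by simp [bitEntry]
      simp only [Fin.val_zero, pow_zero, Nat.div_one, h]
      rcases Nat.mod_two_eq_zero_or_one x with h | h <;> simp [h, bitEntry]
    · refine Finset.sum_congr rfl fun j _ ↦ ?_
      simp only [Fin.val_succ, bitEntry, pow_succ', Nat.div_div_eq_div_mul]

theorem bitMulAux_digit (n A k : ℕ) : ∀ B, ∀ j < k,
    bitMulAux (2 ^ n) n A k B / (2 ^ n) ^ j % 2 ^ n =
      bitApply (2 ^ n) n A (B / (2 ^ n) ^ j % 2 ^ n) := by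
  have hpos : 0 < 2 ^ n := by positivity
  induction k with
  | zero => intro B j hj; omega
  | succ k ih =>
    intro B j hj
    have hlt := bitApply_lt n n A (B % 2 ^ n)
    rw [bitMulAux_succ]
    cases j with
    | zero => simp [Nat.mod_eq_of_lt hlt]
    | succ j =>
      rw [pow_succ', ← Nat.div_div_eq_div_mul, Nat.add_mul_div_left _ _ hpos,
        Nat.div_eq_of_lt hlt, zero_add, ih _ _ (by omega), Nat.div_div_eq_div_mul]

theorem bitMatrix_bitMul (n A B : ℕ) :
    bitMatrix n (bitMul (2 ^ n) n A B) = bitMatrix n A * bitMatrix n B := by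
  ext i j
  rw [Matrix.mul_apply, bitMatrix, Matrix.of_apply, bitMul, bitMulAux_digit _ _ _ _ _ j.2,
    bitEntry_bitApply]
  rfl

end BitMatrixEntries

section HermitianForms

open scoped Matrix

/-- The elements conjugating `s` to `s` or to `s ^ 4`. -/
def frobeniusSubgroup {Γ : Type*} [Group Γ] (s : Γ) (hs : s ^ 15 = 1) : Subgroup Γ where
  carrier := {u | MulAut.conj u s = s ∨ MulAut.conj u s = s ^ 4}
  one_mem' := Or.inl (by simp)
  mul_mem' {a b} ha hb := by
    have hs16 : (s ^ 4) ^ 4 = s := by rw [← pow_mul, show 4 * 4 = 15 + 1 from rfl, pow_succ, hs,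
      one_mul]
    change MulAut.conj (a * b) s = s ∨ MulAut.conj (a * b) s = s ^ 4
    rw [map_mul, MulAut.mul_apply]
    rcases ha with ha | ha <;> rcases hb with hb | hb <;> simp [ha, hb, hs16, map_pow]
  inv_mem' {a} ha := by
    have hs16 : (s ^ 4) ^ 4 = s := by rw [← pow_mul, show 4 * 4 = 15 + 1 from rfl, pow_succ, hs,
      one_mul]
    change MulAut.conj a⁻¹ s = s ∨ MulAut.conj a⁻¹ s = s ^ 4
    have key : ∀ t, MulAut.conj a t = s → MulAut.conj a⁻¹ s = t := by
      rintro t rfl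
      simp [mul_assoc]
    rcases ha with ha | ha
    · exact Or.inl (key _ ha)
    · exact Or.inr (key _ (by rw [map_pow, ha, hs16]))

/-- `8 × 8` matrices over `𝔽₂`. -/
abbrev MatEight : Type := Matrix (Fin 8) (Fin 8) (ZMod 2)

/-- The isometries of a bilinear form. -/
def isometrySubgroup (X : MatEight) : Subgroup MatEightˣ where
  carrier := {u | u.valᵀ * X * u.val = X}
  one_mem' := by simp
  mul_mem' {a b} ha hb := by
    change (a.val * b.val)ᵀ * X * (a.val * b.val) = X
    rw [Matrix.transpose_mul]
    calc b.valᵀ * a.valᵀ * X * (a.val * b.val) = b.valᵀ * (a.valᵀ * X * a.val) * b.val := by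
          simp only [mul_assoc]
      _ = X := by rw [show a.valᵀ * X * a.val = X from ha]; exact hb
  inv_mem' {a} ha := by
    have h1 : (a⁻¹).valᵀ * a.valᵀ = 1 := by
      rw [← Matrix.transpose_mul, Units.mul_inv, Matrix.transpose_one]
    change (a⁻¹).valᵀ * X * (a⁻¹).val = X
    calc (a⁻¹).valᵀ * X * (a⁻¹).val = (a⁻¹).valᵀ * (a.valᵀ * X * a.val) * (a⁻¹).val := by
          rw [show a.valᵀ * X * a.val = X from ha]
      _ = ((a⁻¹).valᵀ * a.valᵀ) * X * (a.val * (a⁻¹).val) := by simp only [mul_assoc]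
      _ = X := by rw [h1, Units.mul_inv, one_mul, mul_one]

theorem mem_isometrySubgroup {X : MatEight} {u : MatEightˣ} :
    u ∈ isometrySubgroup X ↔ u.valᵀ * X * u.val = X := Iff.rfl

/-- Multiplication by a primitive element on `𝔽₁₆ ⊕ 𝔽₁₆`. -/
def scalarS : MatEight := !![0,0,0,1,0,0,0,0; 1,0,0,1,0,0,0,0; 0,1,0,0,0,0,0,0; 0,0,1,0,0,0,0,0;
  0,0,0,0,0,0,0,1; 0,0,0,0,1,0,0,1; 0,0,0,0,0,1,0,0; 0,0,0,0,0,0,1,0]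

/-- The trace of the determinant form on `𝔽₁₆ ⊕ 𝔽₁₆`. -/
def traceJ : MatEight := bitMatrix 8 649085731119054976

/-- The trace forms of hermitian forms on `𝔽₁₆ ⊕ 𝔽₁₆`. -/
def IsHermitianForm (X : MatEight) : Prop := X * scalarS = (scalarS ^ 4)ᵀ * X ∧ Xᵀ = X

theorem scalarS_pow_fifteen : scalarS ^ 15 = 1 := by decide +kernel

theorem scalarS_pow_four : scalarS ^ 4 = !![1,0,0,1,0,0,0,0; 1,1,0,1,0,0,0,0; 0,1,1,0,0,0,0,0;
    0,0,1,1,0,0,0,0; 0,0,0,0,1,0,0,1; 0,0,0,0,1,1,0,1; 0,0,0,0,0,1,1,0; 0,0,0,0,0,0,1,1] := by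
  decide +kernel

theorem scalarS_transpose_mul : scalarSᵀ * traceJ = traceJ * scalarS := by decide +kernel

theorem transpose_traceJ : traceJᵀ = traceJ := by decide +kernel

theorem matEight_add_self (x : MatEight) : x + x = 0 := by
  ext i j
  exact CharTwo.add_self_eq_zero (x i j)

theorem exists_hermitianForm {g : MatEightˣ} (hJ : g ∈ isometrySubgroup traceJ)
    (hS : g.val * scalarS = scalarS ^ 4 * g.val) :
    ∃ X, IsHermitianForm X ∧ X ≠ 0 ∧ g ∈ isometrySubgroup X := by
  have hJ' : g.valᵀ * traceJ * g.val = traceJ := hJ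
  set Y : MatEight := g.valᵀ * traceJ with hY
  have hYt : Yᵀ = traceJ * g.val := by
    rw [hY, Matrix.transpose_mul, Matrix.transpose_transpose, transpose_traceJ]
  have hS' : scalarS * g.val = g.val * scalarS ^ 4 := by
    have h : ∀ k, g.val * scalarS ^ k = (scalarS ^ 4) ^ k * g.val := by
      intro k
      induction k with
      | zero => simp
      | succ k ih => rw [pow_succ, ← mul_assoc, ih, mul_assoc, hS, ← mul_assoc, ← pow_succ]
    rw [h, ← pow_mul, show 4 * 4 = 15 + 1 from rfl, pow_succ, scalarS_pow_fifteen, one_mul]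
  have hJ4 : traceJ * scalarS ^ 4 = (scalarS ^ 4)ᵀ * traceJ := by decide +kernel
  have hY1 : Y * scalarS = (scalarS ^ 4)ᵀ * Y := by
    rw [hY, mul_assoc, ← scalarS_transpose_mul, ← mul_assoc, ← Matrix.transpose_mul, hS',
      Matrix.transpose_mul, mul_assoc]
  have hY2 : Yᵀ * scalarS = (scalarS ^ 4)ᵀ * Yᵀ := by
    rw [hYt, mul_assoc, hS, ← mul_assoc, hJ4, mul_assoc]
  have hg1 : g ∈ isometrySubgroup Y := by
    rw [mem_isometrySubgroup, mul_assoc, show Y * g.val = traceJ from hJ']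
  have hg2 : g ∈ isometrySubgroup Yᵀ := by
    have := congrArg Matrix.transpose (mem_isometrySubgroup.mp hg1)
    rw [Matrix.transpose_mul, Matrix.transpose_mul, Matrix.transpose_transpose, ← mul_assoc] at this
    exact this
  by_cases h0 : Y + Yᵀ = 0
  · refine ⟨Y, ⟨hY1, ?_⟩, ?_, hg1⟩
    · have := congrArg (Y + ·) h0
      simpa [← add_assoc, matEight_add_self] using this
    · intro h
      rw [h, zero_mul] at hJ'
      exact absurd hJ' (by decide +kernel)
  · refine ⟨Y + Yᵀ, ⟨?_, ?_⟩, h0, ?_⟩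
    · rw [add_mul, mul_add, hY1, hY2]
    · rw [Matrix.transpose_add, Matrix.transpose_transpose, add_comm]
    · rw [mem_isometrySubgroup] at hg1 hg2 ⊢
      rw [mul_add, add_mul, hg1, hg2]

/-- The blocks of the first column of the blocks of a hermitian form which determine it. -/
def hermitianData (X : MatEight) : (Fin 4 → ZMod 2) × (Fin 4 → ZMod 2) × (Fin 4 → ZMod 2) :=
  (fun i ↦ X (Fin.castAdd 4 i) 0, fun i ↦ X (Fin.natAdd 4 i) 4, fun i ↦ X (Fin.castAdd 4 i) 4)

/-- A system of representatives, up to scalars, for the data of hermitian forms. -/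
def IsNormalized (t : (Fin 4 → ZMod 2) × (Fin 4 → ZMod 2) × (Fin 4 → ZMod 2)) : Prop :=
  (t.1 = ![0, 1, 1, 0] ∧ t.2.1 0 = 0 ∧ t.2.1 1 = t.2.1 2) ∨
  (t.1 = 0 ∧ t.2.1 = ![0, 1, 1, 0]) ∨ (t.1 = 0 ∧ t.2.1 = 0 ∧
    t.2.2 ∈ [![1, 0, 0, 0], ![0, 1, 0, 0], ![1, 1, 0, 0], ![0, 0, 1, 0], ![0, 1, 1, 0]])

instance : DecidablePred IsNormalized := fun p ↦ by unfold IsNormalized; infer_instance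

theorem card_isNormalized : Nat.card {t // IsNormalized t} = 85 := by
  rw [Nat.card_eq_fintype_card]
  decide +kernel

theorem IsHermitianForm.column_succ {X : MatEight} (h : IsHermitianForm X) (i : Fin 8) :
    (X i 1 = ∑ m, (scalarS ^ 4) m i * X m 0 ∧ X i 2 = ∑ m, (scalarS ^ 4) m i * X m 1 ∧
      X i 3 = ∑ m, (scalarS ^ 4) m i * X m 2) ∧
    (X i 5 = ∑ m, (scalarS ^ 4) m i * X m 4 ∧ X i 6 = ∑ m, (scalarS ^ 4) m i * X m 5 ∧
      X i 7 = ∑ m, (scalarS ^ 4) m i * X m 6) := by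
  have key : ∀ j k, (∀ m, scalarS m j = if m = k then 1 else 0) →
      X i k = ∑ m, (scalarS ^ 4) m i * X m j := by
    intro j k hjk
    have := congrFun (congrFun h.1 i) j
    rw [Matrix.mul_apply, Matrix.mul_apply] at this
    simpa only [Matrix.transpose_apply, hjk, mul_ite, mul_one, mul_zero, Finset.sum_ite_eq',
      Finset.mem_univ, if_true] using this
  refine ⟨⟨key _ _ ?_, key _ _ ?_, key _ _ ?_⟩, key _ _ ?_, key _ _ ?_, key _ _ ?_⟩ <;>
    decide +kernel

theorem IsHermitianForm.sub {X Y : MatEight} (hX : IsHermitianForm X) (hY : IsHermitianForm Y) :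
    IsHermitianForm (X - Y) :=
  ⟨by rw [sub_mul, mul_sub, hX.1, hY.1], by rw [Matrix.transpose_sub, hX.2, hY.2]⟩

theorem IsHermitianForm.mul_scalar {X : MatEight} (hX : IsHermitianForm X) :
    IsHermitianForm (X * scalarS ^ 5) := by
  have h : ∀ k, X * scalarS ^ k = ((scalarS ^ 4) ^ k)ᵀ * X := by
    intro k
    induction k with
    | zero => simp
    | succ k ih => rw [pow_succ, ← mul_assoc, ih, mul_assoc, hX.1, ← mul_assoc,
        ← Matrix.transpose_mul, ← pow_succ']
  constructor
  · rw [mul_assoc, ← pow_succ, pow_succ', ← mul_assoc, hX.1, mul_assoc]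
  · rw [Matrix.transpose_mul, hX.2, h, ← pow_mul, show 4 * 5 = 15 + 5 from rfl, pow_add,
      scalarS_pow_fifteen, one_mul]

theorem IsHermitianForm.entries {X : MatEight} (h : IsHermitianForm X) :
    (X 0 0 = 0 ∧ X 1 0 = X 2 0) ∧ X 4 4 = 0 ∧ X 5 4 = X 6 4 := by
  have hs : ∀ i j, X i j = X j i := fun i j ↦ congrFun (congrFun h.2 j) i
  obtain ⟨⟨a0, a1, a2⟩, -⟩ := h.column_succ 0
  obtain ⟨⟨b0, b1, -⟩, -⟩ := h.column_succ 1
  obtain ⟨⟨c0, -, -⟩, -⟩ := h.column_succ 2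
  obtain ⟨-, d0, d1, d2⟩ := h.column_succ 4
  obtain ⟨-, e0, e1, -⟩ := h.column_succ 5
  obtain ⟨-, f0, -, -⟩ := h.column_succ 6
  simp only [scalarS_pow_four, Fin.sum_univ_eight] at a0 a1 a2 b0 b1 c0 d0 d1 d2 e0 e1 f0
  simp at a0 a1 a2 b0 b1 c0 d0 d1 d2 e0 e1 f0
  have key : ∀ y00 y10 y20 y30 y11 y21 : ZMod 2, (y10 = y00 + y10 ∧ y20 = y10 + y11 ∧
      y30 = y20 + y21 ∧ y11 = y10 + y20 ∧ y21 = y11 + y21 ∧ y21 = y20 + y30) → y00 = 0 ∧ y10 = y20 := by decide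
  rw [hs 0 1] at a0 a1
  rw [hs 0 2] at a1 a2
  rw [hs 0 3, hs 1 2] at a2
  rw [hs 1 2] at b1
  rw [hs 5 6] at e1
  rw [hs 4 5] at d0 d1
  rw [hs 4 6] at d1 d2
  rw [hs 4 7, hs 5 6] at d2
  exact ⟨key _ _ _ _ _ _ ⟨a0, a1, a2, b0, b1, c0⟩, key _ _ _ _ _ _ ⟨d0, d1, d2, e0, e1, f0⟩⟩

theorem IsHermitianForm.eq_zero {X : MatEight} (h : IsHermitianForm X)
    (h0 : hermitianData X = 0) : X = 0 := by
  have hs : ∀ i j, X i j = X j i := fun i j ↦ congrFun (congrFun h.2 j) i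
  rw [hermitianData, Prod.mk_eq_zero, Prod.mk_eq_zero] at h0
  obtain ⟨h1, h2, h3⟩ := h0
  have c4 : ∀ i, X i 4 = 0 := by
    intro i
    refine Fin.addCases (m := 4) (n := 4) (fun i ↦ ?_) (fun i ↦ ?_) i
    · exact congrFun h3 i
    · exact congrFun h2 i
  have c5 : ∀ i, X i 5 = 0 := fun i ↦ by rw [(h.column_succ i).2.1]; simp [c4]
  have c6 : ∀ i, X i 6 = 0 := fun i ↦ by rw [(h.column_succ i).2.2.1]; simp [c5]
  have c7 : ∀ i, X i 7 = 0 := fun i ↦ by rw [(h.column_succ i).2.2.2]; simp [c6]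
  have c0 : ∀ i, X i 0 = 0 := by
    intro i
    refine Fin.addCases (m := 4) (n := 4) (fun i ↦ ?_) (fun i ↦ ?_) i
    · exact congrFun h1 i
    · rw [hs]
      fin_cases i
      · exact c4 0
      · exact c5 0
      · exact c6 0
      · exact c7 0
  have c1 : ∀ i, X i 1 = 0 := fun i ↦ by rw [(h.column_succ i).1.1]; simp [c0]
  have c2 : ∀ i, X i 2 = 0 := fun i ↦ by rw [(h.column_succ i).1.2.1]; simp [c1]
  have c3 : ∀ i, X i 3 = 0 := fun i ↦ by rw [(h.column_succ i).1.2.2]; simp [c2]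
  ext i j
  fin_cases j
  exacts [c0 i, c1 i, c2 i, c3 i, c4 i, c5 i, c6 i, c7 i]

/-- The effect on `hermitianData` of multiplication by a primitive cube root of unity. -/
def scaleData (y : Fin 4 → ZMod 2) : Fin 4 → ZMod 2 :=
  ![y 1 + y 2, y 2 + y 3, y 0 + y 1 + y 3, y 0 + y 2]

theorem scalarS_pow_five : scalarS ^ 5 = !![0,0,1,1,0,0,0,0; 1,0,1,0,0,0,0,0; 1,1,0,1,0,0,0,0;
    0,1,1,0,0,0,0,0; 0,0,0,0,0,0,1,1; 0,0,0,0,1,0,1,0; 0,0,0,0,1,1,0,1; 0,0,0,0,0,1,1,0] := by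
  decide +kernel

theorem IsHermitianForm.hermitianData_mul {X : MatEight} (h : IsHermitianForm X) :
    hermitianData (X * scalarS ^ 5) = (scaleData (hermitianData X).1,
      scaleData (hermitianData X).2.1, scaleData (hermitianData X).2.2) := by
  have h1 : X * scalarS ^ 5 = (scalarS ^ 5)ᵀ * X := by
    conv_rhs => rw [← h.2]
    rw [← Matrix.transpose_mul, h.mul_scalar.2]
  rw [h1, scalarS_pow_five]
  refine Prod.ext ?_ (Prod.ext ?_ ?_) <;> funext i <;> fin_cases i <;>
    simp [hermitianData, scaleData, Matrix.mul_apply, Fin.sum_univ_eight, add_assoc]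

theorem exists_normalized : ∀ a b c : Fin 4 → ZMod 2,
    ((a 0 = 0 ∧ a 1 = a 2) ∧ (b 0 = 0 ∧ b 1 = b 2) ∧ ¬ (a = 0 ∧ b = 0 ∧ c = 0)) →
      IsNormalized (a, b, c) ∨ IsNormalized (scaleData a, scaleData b, scaleData c) ∨
      IsNormalized (scaleData (scaleData a), scaleData (scaleData b),
        scaleData (scaleData c)) := by
  decide +kernel

theorem card_normalized_forms_le :
    Nat.card {X // IsHermitianForm X ∧ IsNormalized (hermitianData X)} ≤ 85 := by
  rw [← card_isNormalized]
  refine Nat.card_le_card_of_injective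
    (fun X ↦ (⟨_, X.2.2⟩ : {t // IsNormalized t})) ?_
  rintro ⟨X, hX, hX'⟩ ⟨Y, hY, hY'⟩ h
  rw [Subtype.mk.injEq] at h
  refine Subtype.ext (sub_eq_zero.mp ((hX.sub hY).eq_zero ?_))
  change hermitianData X - hermitianData Y = 0
  exact sub_eq_zero.mpr h

theorem exists_normalized_form {g : MatEightˣ} (hJ : g ∈ isometrySubgroup traceJ)
    (hS : g.val * scalarS = scalarS ^ 4 * g.val) :
    ∃ X, (IsHermitianForm X ∧ IsNormalized (hermitianData X)) ∧ g ∈ isometrySubgroup X := by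
  obtain ⟨X, hX, hX0, hg⟩ := exists_hermitianForm hJ hS
  have h5 : g.val * scalarS ^ 5 = scalarS ^ 5 * g.val := by
    have h : ∀ k, g.val * scalarS ^ k = (scalarS ^ 4) ^ k * g.val := by
      intro k
      induction k with
      | zero => simp
      | succ k ih => rw [pow_succ, ← mul_assoc, ih, mul_assoc, hS, ← mul_assoc, ← pow_succ]
    rw [h, ← pow_mul, show 4 * 5 = 15 + 5 from rfl, pow_add, scalarS_pow_fifteen, one_mul]
  have hmul : ∀ Y, g ∈ isometrySubgroup Y → g ∈ isometrySubgroup (Y * scalarS ^ 5) := by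
    intro Y hY
    rw [mem_isometrySubgroup] at hY ⊢
    rw [mul_assoc, mul_assoc Y, ← h5, ← mul_assoc, ← mul_assoc, hY]
  have he := hX.entries
  rcases exists_normalized (hermitianData X).1 (hermitianData X).2.1
    (hermitianData X).2.2 ⟨he.1, he.2, (fun h ↦ hX0 (hX.eq_zero (Prod.ext h.1 (Prod.ext h.2.1 h.2.2))))⟩
    with h | h | h
  · exact ⟨X, ⟨hX, h⟩, hg⟩
  · exact ⟨_, ⟨hX.mul_scalar, by rwa [hX.hermitianData_mul]⟩, hmul _ hg⟩
  · exact ⟨_, ⟨hX.mul_scalar.mul_scalar,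
      by rwa [hX.mul_scalar.hermitianData_mul, hX.hermitianData_mul]⟩, hmul _ (hmul _ hg)⟩

/-- Generators of `SL(2, 16).2`, as coded `8 × 8` matrices over `𝔽₂`. -/
def certSLSixteen : OrbitCert where
  c := 16679825983425559951
  cInv := 1700907086762162821
  period := 17
  size := 5
  gen := ![7075143279228166654, 16115395837875988983, 17272856608674689040,
    76010375591767546, 5609979227690255581]
  genInv := ![17130152094715067524, 13800598747005040003, 1082274592398192926,
    9986295457407611008, 3611857984010709686]
  len := ![17, 17, 17, 17, 17]
  base := 7075143279228166654
  baseInv := 17130152094715067524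
  toBase := ![4468, 8276, 1907, 2052, 11457]
  ofBase := ![4468, 3431, 1889, 1266, 16842]
  words := ![
    ![[3243, 41055, 12310, 36478, 811, 13286, 37252, 51],
      [3274, 11427, 518, 12459, 3979, 14640, 2974, 3582, 3320, 62772, 2318, 15626, 8608,
        14271, 13384, 608, 9857],
      [3927, 3897, 38239, 14328, 9774, 12529, 34426, 8644, 9070, 3889, 11347, 10995,
        8736, 3044, 10228, 11574, 2566],
      [36543, 12964, 15681, 3258, 2769, 2914, 8552, 2331, 2605, 3916, 13486, 40736,
        13653, 2068, 9449, 8345, 2208],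
      [42102, 3429, 11908, 9554, 3430, 2178, 9730, 149016, 53773, 586, 15683, 14907,
        2630, 3209, 750, 11994, 523]],
    ![[],
      [4066, 850, 3079, 250, 4072, 2074, 11603, 8694],
      [39360, 14408, 216, 12841, 3082, 14945, 9991, 3516, 169, 11235, 3811, 189, 61,
        2820, 11476, 13274, 3936],
      [33263, 13066, 3208, 871, 8969, 151, 581, 11278, 14280, 9372, 3891, 2631, 40350,
        2808, 9093, 14117, 38447],
      [35954, 535927, 10445, 9227, 11701, 10101, 32980, 8657, 12296, 10457, 2084, 3853,
        9579, 43577, 724, 2596, 148530]],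
    ![[],
      [],
      [36816, 12256, 3070, 145, 2791, 158849, 13326, 2789],
      [3209, 10428, 14317, 10484, 4017, 52, 136132, 4034, 660, 9702, 33528, 10103, 9275,
        8446, 11526, 133, 9886],
      [51917, 11425, 2660, 10539, 2788, 39440, 13145, 38946, 2797, 42326, 14021, 38426,
        3363, 39128, 3610, 33196, 10837]],
    ![[],
      [],
      [],
      [2355, 3630, 9770, 938, 10770, 8556, 2145, 4064],
      [8582, 14629, 628, 2625, 983, 33312, 9752, 15546, 12656, 2192, 10048, 3266, 8376,
        8565, 2380, 519, 8973]],
    ![[],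
      [],
      [],
      [],
      [51473, 12011, 11061, 3544, 2502, 37610, 15190, 3180]]]

theorem valid_certSLSixteen : certSLSixteen.Valid (bitMul 256 8) 9241421688590303745 where
  c_inv := by decide +kernel
  base_inv := by decide +kernel
  gen_inv := by decide +kernel
  len_le := by decide +kernel
  commute := by decide +kernel
  toBase := by decide +kernel
  ofBase := by decide +kernel
  words_ne := by decide +kernel
  words_eq := by decide +kernel

/-- The minimal polynomial of the element of `eq_zero_of_isometry` times `scalarS`. -/
def testPoly (T : MatEight) : MatEight := T ^ 5 + T ^ 4 + T ^ 2 + 1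

theorem IsHermitianForm.eq_zero_of_isometry {X : MatEight} (hX : IsHermitianForm X)
    {u : MatEightˣ} (hu : u ∈ isometrySubgroup X) (h : testPoly (u.val * scalarS) = 0)
    (h' : testPoly ((u⁻¹).val * scalarS ^ 4) ^ 15 = 1)
    (hcomm : (u⁻¹).val * scalarS ^ 4 = scalarS ^ 4 * (u⁻¹).val) : X = 0 := by
  set T := u.val * scalarS
  set T' := (u⁻¹).val * scalarS ^ 4
  have h1 : X * T = T'ᵀ * X := by
    have hinv : (u⁻¹).valᵀ * u.valᵀ = 1 := by
      rw [← Matrix.transpose_mul, Units.mul_inv, Matrix.transpose_one]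
    have h2 : X * u.val = (u⁻¹).valᵀ * X := by
      conv_rhs => rw [← mem_isometrySubgroup.mp hu, ← mul_assoc, ← mul_assoc, hinv, one_mul]
    rw [← mul_assoc, h2, mul_assoc, hX.1, ← mul_assoc, ← Matrix.transpose_mul, ← hcomm]
  have h2 : ∀ k, X * T ^ k = (T' ^ k)ᵀ * X := by
    intro k
    induction k with
    | zero => simp
    | succ k ih => rw [pow_succ, ← mul_assoc, ih, mul_assoc, h1, ← mul_assoc,
        ← Matrix.transpose_mul, ← pow_succ']
  have h3 : (testPoly T')ᵀ * X = 0 := by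
    have h4 := congrArg (X * ·) h
    simp only [testPoly, mul_add, mul_one, h2, mul_zero, ← add_mul] at h4
    rw [← h4, testPoly]
    simp only [Matrix.transpose_add, add_mul, Matrix.transpose_one, one_mul]
  have h5 : (testPoly T' ^ 15)ᵀ * X = 0 := by
    rw [pow_succ', Matrix.transpose_mul, mul_assoc, h3, mul_zero]
  rwa [h', Matrix.transpose_one, one_mul] at h5

theorem exists_coveringNumber_eq_86 :
    ∃ (G : Type) (_ : Group G) (_ : Finite G), coveringNumber G = (86 : ℕ) := by
  have hφ := bitMatrix_bitMul 8
  have h1 : bitMatrix 8 9241421688590303745 = 1 := by decide +kernel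
  obtain ⟨c, r₀, r, hc, hr₀, -, -, hmem, -, hgen⟩ := valid_certSLSixteen.exists_units hφ h1
  have hS : bitMatrix 8 3494863817073492994 = scalarS := by decide +kernel
  let s : MatEightˣ := codeUnit hφ h1 3494863817073492994 4620711428410704137 (by decide +kernel)
  have hs : s.val = scalarS := hS
  have hs15 : s ^ 15 = 1 := Units.ext (by
    rw [Units.val_pow_eq_pow_val, hs, scalarS_pow_fifteen, Units.val_one])
  have hcS : bitMatrix 8 certSLSixteen.c * scalarS = scalarS * bitMatrix 8 certSLSixteen.c := by
    decide +kernel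
  have hrS : bitMatrix 8 certSLSixteen.base * scalarS =
      scalarS ^ 4 * bitMatrix 8 certSLSixteen.base := by
    decide +kernel
  have hF : Subgroup.closure {c, r₀} ≤ frobeniusSubgroup s hs15 := by
    refine closure_pair_le (Or.inl ?_) (Or.inr ?_)
    · rw [MulAut.conj_apply, mul_inv_eq_iff_eq_mul]
      exact Units.ext (by rw [Units.val_mul, Units.val_mul, hc, hs, hcS])
    · rw [MulAut.conj_apply, mul_inv_eq_iff_eq_mul]
      exact Units.ext (by
        rw [Units.val_mul, Units.val_mul, Units.val_pow_eq_pow_val, hr₀, hs, hrS])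
  have hJ : Subgroup.closure {c, r₀} ≤ isometrySubgroup traceJ := by
    refine closure_pair_le ?_ ?_
    · rw [mem_isometrySubgroup, hc]; decide +kernel
    · rw [mem_isometrySubgroup, hr₀]; decide +kernel
  refine ⟨Subgroup.closure {c, r₀}, inferInstance, inferInstance, le_antisymm ?_ ?_⟩
  · have h := coveringNumber_subgroup_le_of_family (Subgroup.closure {c, r₀})
      (ι := Option {X // IsHermitianForm X ∧ IsNormalized (hermitianData X)})
      (fun i ↦ i.elim (Subgroup.centralizer {s}) fun X ↦ isometrySubgroup X) ?_ ?_
    · refine h.trans ?_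
      rw [Finite.card_option]
      exact_mod_cast Nat.add_le_add_right card_normalized_forms_le 1
    · rintro (_ | ⟨X, hX, hX'⟩) h'
      · have h2 := Subgroup.mem_centralizer_singleton_iff.mp (h' (right_mem_closure_pair c r₀))
        have h3 := congrArg Units.val h2
        rw [Units.val_mul, Units.val_mul, hr₀, hs] at h3
        exact absurd h3 (by decide +kernel)
      · let x : MatEightˣ :=
          codeUnit hφ h1 9748645143695468314 17864220251504517649 (by decide +kernel)
        have hx : x ∈ Subgroup.closure {c, r₀} :=
          wordEq_sound hφ hc hr₀ (t := 9748645143695468314) rfl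
            (show wordEq _ _ _ 31 _ = true by decide +kernel)
        have h0 := hX.eq_zero_of_isometry (h' hx)
          (show testPoly (bitMatrix 8 9748645143695468314 * scalarS) = 0 by decide +kernel)
          (show testPoly (bitMatrix 8 17864220251504517649 * scalarS ^ 4) ^ 15 = 1 by
            decide +kernel)
          (show bitMatrix 8 17864220251504517649 * scalarS ^ 4 =
            scalarS ^ 4 * bitMatrix 8 17864220251504517649 by decide +kernel)
        rw [h0] at hX'
        exact absurd hX' (by decide +kernel)
    · intro g hg
      rcases hF hg with h | h
      · refine ⟨none, Subgroup.mem_centralizer_singleton_iff.mpr ?_⟩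
        rw [MulAut.conj_apply, mul_inv_eq_iff_eq_mul] at h
        exact h
      · rw [MulAut.conj_apply, mul_inv_eq_iff_eq_mul] at h
        have h2 := congrArg Units.val h
        rw [Units.val_mul, Units.val_mul, Units.val_pow_eq_pow_val, hs] at h2
        obtain ⟨X, hX, hgX⟩ := exists_normalized_form (hJ hg) h2
        exact ⟨some ⟨X, hX⟩, hgX⟩
  · have h := le_coveringNumber_of_pairwise_subgroup _ _ (orbitFamily_mem hmem) hgen
    rw [Nat.card_eq_fintype_card] at h
    exact le_trans (le_of_eq (congrArg _ (by decide +kernel))) h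

end HermitianForms

section SynthematicTotals

/-- The six edge colourings of the complete graph on six points (the colour `5` standing for
loops), one for each total. -/
def totalColour : Fin 6 → Fin 6 → Fin 6 → Fin 6 :=
  ![![![5, 0, 1, 2, 3, 4], ![0, 5, 4, 3, 1, 2], ![1, 4, 5, 0, 2, 3],
    ![2, 3, 0, 5, 4, 1], ![3, 1, 2, 4, 5, 0], ![4, 2, 3, 1, 0, 5]],
  ![![5, 0, 1, 2, 3, 4], ![0, 5, 3, 4, 2, 1], ![1, 3, 5, 0, 4, 2],
    ![2, 4, 0, 5, 1, 3], ![3, 2, 4, 1, 5, 0], ![4, 1, 2, 3, 0, 5]],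
  ![![5, 0, 1, 2, 3, 4], ![0, 5, 4, 1, 2, 3], ![1, 4, 5, 3, 0, 2],
    ![2, 1, 3, 5, 4, 0], ![3, 2, 0, 4, 5, 1], ![4, 3, 2, 0, 1, 5]],
  ![![5, 0, 1, 2, 3, 4], ![0, 5, 2, 3, 4, 1], ![1, 2, 5, 4, 0, 3],
    ![2, 3, 4, 5, 1, 0], ![3, 4, 0, 1, 5, 2], ![4, 1, 3, 0, 2, 5]],
  ![![5, 0, 1, 2, 3, 4], ![0, 5, 3, 1, 4, 2], ![1, 3, 5, 4, 2, 0],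
    ![2, 1, 4, 5, 0, 3], ![3, 4, 2, 0, 5, 1], ![4, 2, 0, 3, 1, 5]],
  ![![5, 0, 1, 2, 3, 4], ![0, 5, 2, 4, 1, 3], ![1, 2, 5, 3, 4, 0],
    ![2, 4, 3, 5, 0, 1], ![3, 1, 4, 0, 5, 2], ![4, 3, 0, 1, 2, 5]]]

/-- The edges `a b` and `c d` belong to the same syntheme of the total `t`. -/
def SameSyntheme (t a b c d : Fin 6) : Prop := totalColour t a b = totalColour t c d

instance (t a b c d : Fin 6) : Decidable (SameSyntheme t a b c d) :=
  inferInstanceAs (Decidable (_ = _))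

/-- The permutation `p` maps the total `t` to the total `t'`. -/
def MapsTotal (p : Equiv.Perm (Fin 6)) (t t' : Fin 6) : Prop :=
  ∀ a b c d, SameSyntheme t' (p a) (p b) (p c) (p d) ↔ SameSyntheme t a b c d

instance (p : Equiv.Perm (Fin 6)) (t t' : Fin 6) : Decidable (MapsTotal p t t') := by
  unfold MapsTotal; infer_instance

theorem MapsTotal.mul {p q : Equiv.Perm (Fin 6)} {t t' t'' : Fin 6} (hp : MapsTotal p t' t'')
    (hq : MapsTotal q t t') : MapsTotal (p * q) t t'' :=
  fun _ _ _ _ ↦ (hp _ _ _ _).trans (hq _ _ _ _)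

theorem MapsTotal.inv {p : Equiv.Perm (Fin 6)} {t t' : Fin 6} (hp : MapsTotal p t t') :
    MapsTotal p⁻¹ t' t := fun a b c d ↦ by
  have := hp (p⁻¹ a) (p⁻¹ b) (p⁻¹ c) (p⁻¹ d)
  simpa using this.symm

theorem exists_mapsTotal (p : Equiv.Perm (Fin 6)) : ∀ t, ∃ t', MapsTotal p t t' := by
  have hp : p ∈ Submonoid.closure
      (Set.range fun i : Fin 5 ↦ Equiv.swap i.castSucc i.succ) := by
    rw [Equiv.Perm.mclosure_swap_castSucc_succ]; trivial
  induction hp using Submonoid.closure_induction with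
  | mem x hx =>
    obtain ⟨i, rfl⟩ := hx
    have h : ∀ i : Fin 5, ∀ t, ∃ t', MapsTotal (Equiv.swap i.castSucc i.succ) t t' := by
      decide +kernel
    exact h i
  | one => exact fun t ↦ ⟨t, fun _ _ _ _ ↦ Iff.rfl⟩
  | mul x y _ _ hx hy =>
    intro t
    obtain ⟨t', ht'⟩ := hy t
    obtain ⟨t'', ht''⟩ := hx t'
    exact ⟨t'', ht''.mul ht'⟩

theorem exists_mapsTotal_self_of_isConj {p q : Equiv.Perm (Fin 6)} (h : IsConj q p)
    (hq : ∃ t, MapsTotal q t t) : ∃ t, MapsTotal p t t := by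
  obtain ⟨t, ht⟩ := hq
  obtain ⟨r, rfl⟩ := isConj_iff.mp h
  obtain ⟨t', ht'⟩ := exists_mapsTotal r t
  exact ⟨t', (ht'.mul ht).mul ht'.inv⟩

/-- An odd permutation of six points fixes a point or a total. -/
theorem exists_fixed_or_mapsTotal {p : Equiv.Perm (Fin 6)} (hp : Equiv.Perm.sign p = -1) :
    (∃ i, p i = i) ∨ ∃ t, MapsTotal p t t := by
  by_contra! hcon
  obtain ⟨hfix, hcon⟩ := hcon
  have hsum : p.cycleType.sum = 6 := by
    rw [Equiv.Perm.sum_cycleType]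
    have : p.support = Finset.univ := by
      ext i; simpa using hfix i
    rw [this]; rfl
  have htwo : ∀ k ∈ p.cycleType, 2 ≤ k := fun k ↦ Equiv.Perm.two_le_of_mem_cycleType
  rw [Equiv.Perm.sign_of_cycleType, hsum] at hp
  have hcard : p.cycleType.card ≤ 3 := by
    have := Multiset.card_nsmul_le_sum htwo
    rw [hsum, smul_eq_mul] at this
    omega
  have h13 : p.cycleType.card = 1 ∨ p.cycleType.card = 3 := by
    revert hp
    generalize p.cycleType.card = k at hcard
    interval_cases k <;> decide
  rcases h13 with h | h
  · obtain ⟨a, ha⟩ := Multiset.card_eq_one.mp h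
    rw [ha, Multiset.sum_singleton] at hsum
    obtain ⟨t, ht⟩ := exists_mapsTotal_self_of_isConj (q := finRotate 6) (p := p)
      (Equiv.Perm.isConj_iff_cycleType_eq.mpr (by rw [cycleType_finRotate, ha, hsum]))
      (by decide +kernel)
    exact hcon t ht
  · obtain ⟨a, b, c, ha⟩ := Multiset.card_eq_three.mp h
    rw [ha] at hsum htwo
    have h1 := htwo a (by simp)
    have h2 := htwo b (by simp)
    have h3 := htwo c (by simp)
    simp only [Multiset.insert_eq_cons, Multiset.sum_cons, Multiset.sum_singleton] at hsum
    obtain rfl : a = 2 := by omega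
    obtain rfl : b = 2 := by omega
    obtain rfl : c = 2 := by omega
    obtain ⟨t, ht⟩ := exists_mapsTotal_self_of_isConj
      (q := Equiv.swap 0 1 * (Equiv.swap 2 3 * Equiv.swap 4 5)) (p := p)
      (Equiv.Perm.isConj_iff_cycleType_eq.mpr (by
        have hsw : ∀ i j : Fin 6, i ≠ j → (Equiv.swap i j).cycleType = {2} := fun i j hij ↦ by
          rw [(Equiv.Perm.isCycle_swap hij).cycleType, Equiv.Perm.card_support_swap hij]
        rw [ha, Equiv.Perm.Disjoint.cycleType_mul (show ∀ x, _ by decide),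
          Equiv.Perm.Disjoint.cycleType_mul (show ∀ x, _ by decide), hsw _ _ (by decide),
          hsw _ _ (by decide), hsw _ _ (by decide)]
        rfl))
      (by decide +kernel)
    exact hcon t ht

end SynthematicTotals

section WreathSix

/-- Two copies of six points. -/
abbrev TwoSix : Type := Fin 6 ⊕ Fin 6

/-- The self-map of `TwoSix` with a given code. -/
def codeFunTwo (a : ℕ) (x : TwoSix) : TwoSix :=
  finSumFinEquiv.symm (codeFun 12 a (finSumFinEquiv x))

/-- `codeFunTwo` as an element of the monoid of self-maps. -/
def codeMapTwo (a : ℕ) : Function.End TwoSix := codeFunTwo a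

theorem codeMapTwo_permMul (a b : ℕ) :
    codeMapTwo (permMul 12 a b) = codeMapTwo a * codeMapTwo b := by
  funext x
  have := congrFun (codeMap_permMul 12 a b) (finSumFinEquiv x)
  change codeFun 12 _ _ = codeFun 12 a (codeFun 12 b _) at this
  have h : codeMapTwo a (codeMapTwo b x) =
      finSumFinEquiv.symm (codeFun 12 a (codeFun 12 b (finSumFinEquiv x))) := by
    rw [codeMapTwo, codeMapTwo, codeFunTwo, codeFunTwo, Equiv.apply_symm_apply]
  exact (congrArg finSumFinEquiv.symm this).trans h.symm

/-- The sign of a unit of the monoid of self-maps. -/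
def unitSign : (Function.End TwoSix)ˣ →* ℤˣ :=
  Equiv.Perm.sign.comp Equiv.Perm.equivUnitsEnd.symm.toMonoidHom

/-- The even permutations preserving both copies and the odd ones interchanging them. -/
def wreathSubgroup : Subgroup (Function.End TwoSix)ˣ where
  carrier := {u | (∀ x, (u.val x).isLeft = x.isLeft) ∧ unitSign u = 1 ∨
    (∀ x, (u.val x).isLeft = !x.isLeft) ∧ unitSign u = -1}
  one_mem' := Or.inl ⟨fun _ ↦ rfl, map_one _⟩
  mul_mem' {a b} ha hb := by
    have hab : ∀ x, (a * b).val x = a.val (b.val x) := fun _ ↦ rfl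
    change (∀ x, ((a * b).val x).isLeft = _) ∧ _ ∨ (∀ x, ((a * b).val x).isLeft = _) ∧ _
    rcases ha with ⟨ha, ha'⟩ | ⟨ha, ha'⟩ <;> rcases hb with ⟨hb, hb'⟩ | ⟨hb, hb'⟩ <;>
      simp [hab, ha, hb, ha', hb']
  inv_mem' {a} ha := by
    have h : ∀ x, a.val ((a⁻¹).val x) = x := fun x ↦ congrFun a.mul_inv x
    rcases ha with ⟨ha, ha'⟩ | ⟨ha, ha'⟩
    · refine Or.inl ⟨fun x ↦ ?_, by rw [map_inv, ha', inv_one]⟩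
      rw [← ha, h]
    · refine Or.inr ⟨fun x ↦ ?_, by rw [map_inv, ha']; rfl⟩
      rw [← Bool.not_not ((a⁻¹).val x).isLeft, ← ha, h]

/-- The pair of totals `t` and `t'`, as a relation between edges. -/
def totalPairRel (t t' : Fin 6) : TwoSix → TwoSix → TwoSix → TwoSix → Prop
  | .inl a, .inl b, .inl c, .inl d => SameSyntheme t a b c d
  | .inr a, .inr b, .inr c, .inr d => SameSyntheme t' a b c d
  | _, _, _, _ => False

/-- The permutations preserving a quaternary relation. -/
def relSubgroup {α : Type*} (R : α → α → α → α → Prop) : Subgroup (Function.End α)ˣ where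
  carrier := {u | ∀ a b c d, R (u.val a) (u.val b) (u.val c) (u.val d) ↔ R a b c d}
  one_mem' _ _ _ _ := Iff.rfl
  mul_mem' ha hb _ _ _ _ := (ha _ _ _ _).trans (hb _ _ _ _)
  inv_mem' {u} hu a b c d := by
    have h : ∀ x, u.val ((u⁻¹).val x) = x := fun x ↦ congrFun u.mul_inv x
    rw [← hu, h, h, h, h]

theorem exists_perm_of_interchange {u : (Function.End TwoSix)ˣ}
    (h : ∀ x, (u.val x).isLeft = !x.isLeft) : ∃ x y : Equiv.Perm (Fin 6),
      (∀ i, u.val (.inl i) = .inr (y i)) ∧ (∀ i, u.val (.inr i) = .inl (x i)) ∧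
        unitSign u = Equiv.Perm.sign (x * y) := by
  have hinj : Function.Injective u.val := (Equiv.Perm.equivUnitsEnd.symm u).injective
  have hy : ∀ i, ∃ j, u.val (.inl i) = .inr j := fun i ↦ by
    have := h (.inl i)
    cases hu : u.val (.inl i) with
    | inl k => rw [hu] at this; simp at this
    | inr k => exact ⟨k, rfl⟩
  have hx : ∀ i, ∃ j, u.val (.inr i) = .inl j := fun i ↦ by
    have := h (.inr i)
    cases hu : u.val (.inr i) with
    | inl k => exact ⟨k, rfl⟩
    | inr k => rw [hu] at this; simp at this
  choose y hy using hy
  choose x hx using hx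
  have hyi : Function.Injective y := fun i j hij ↦
    Sum.inl_injective (hinj (by rw [hy, hy, hij]))
  have hxi : Function.Injective x := fun i j hij ↦
    Sum.inr_injective (hinj (by rw [hx, hx, hij]))
  refine ⟨.ofBijective x (Finite.injective_iff_bijective.mp hxi),
    .ofBijective y (Finite.injective_iff_bijective.mp hyi), hy, hx, ?_⟩
  set X := Equiv.ofBijective x (Finite.injective_iff_bijective.mp hxi)
  set Y := Equiv.ofBijective y (Finite.injective_iff_bijective.mp hyi)
  have he : Equiv.Perm.equivUnitsEnd.symm u =
      Equiv.Perm.sumCongr X Y * (Equiv.sumComm (Fin 6) (Fin 6) : Equiv.Perm TwoSix) := by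
    ext1 z
    change u.val z = _
    rcases z with i | i
    · exact hy i
    · exact hx i
  have hsc : Equiv.Perm.sign (Equiv.sumComm (Fin 6) (Fin 6) : Equiv.Perm TwoSix) = 1 := by
    decide +kernel
  change Equiv.Perm.sign (Equiv.Perm.equivUnitsEnd.symm u) = _
  rw [he, map_mul, map_mul, Equiv.Perm.sign_sumCongr, hsc, mul_one]

theorem exists_invariant_of_interchange {u : (Function.End TwoSix)ˣ}
    (h : ∀ x, (u.val x).isLeft = !x.isLeft) (hs : unitSign u = -1) :
    (∃ i j, u ∈ invariantSubgroup ({.inl i, .inr j} : Set TwoSix)) ∨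
      ∃ t t', u ∈ relSubgroup (totalPairRel t t') := by
  obtain ⟨x, y, hy, hx, hxy⟩ := exists_perm_of_interchange h
  rw [hxy] at hs
  rcases exists_fixed_or_mapsTotal hs with ⟨i, hi⟩ | ⟨t, ht⟩
  · refine Or.inl ⟨i, y i, fun z ↦ ?_⟩
    have hi' : x (y i) = i := hi
    rcases z with k | k
    · simp [hy]
    · rw [hx]
      simp only [Set.mem_insert_iff, Set.mem_singleton_iff, Sum.inl.injEq, Sum.inr.injEq,
        reduceCtorEq, or_false, false_or]
      conv_lhs => rw [← hi']
      exact x.injective.eq_iff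
  · obtain ⟨t', ht'⟩ := exists_mapsTotal y t
    have ht'' : MapsTotal x t' t := by
      have := ht.mul ht'.inv
      rwa [mul_inv_cancel_right] at this
    refine Or.inr ⟨t, t', ?_⟩
    rintro (a | a) (b | b) (c | c) (d | d) <;> simp only [hx, hy, totalPairRel]
    · exact ht' _ _ _ _
    · exact ht'' _ _ _ _

/-- Generators of a subgroup of `S₆ ≀ S₂`, as coded permutations of twelve points. -/
def certWreath : OrbitCert where
  c := 188469730100001
  cInv := 188598075990276
  period := 20
  size := 8
  gen := ![54229343049606, 71824779553131, 88116379223706, 89335915001961, 2422720931736,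
    39810331543401, 23305577412216, 52863088421031]
  genInv := ![92569976944806, 3454522853031, 70451736377706, 57184565684136, 73736626150011,
    75879749950326, 58549307152566, 71820500318106]
  len := ![20, 20, 10, 10, 4, 4, 2, 2]
  base := 54229343049606
  baseInv := 92569976944806
  toBase := ![120149, 163499, 120587, 66326, 911619, 533955, 2667802, 1525252]
  ofBase := ![120149, 893182, 339432, 42711, 208610, 306307, 83421, 533850]
  words := ![
    ![[692883, 557636, 733905, 54349, 555709, 527591, 33494, 556494, 692571, 561826],
      [646730, 226322, 2646962, 212409, 774020, 598324, 260110, 144127, 539694, 257052,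
        256228, 238571, 638122, 544978, 978147, 2420532, 933781, 1024749, 591646, 152043],
      [610393, 787922, 528821, 678904, 34581, 579814, 534463, 567667, 540376, 632686,
        617836, 581148, 683351, 600879, 61766, 619610, 556156, 653475, 568667, 38133],
      [593481, 589847, 629166, 670629, 603325, 868358, 841216, 555951, 42532, 659303,
        805371, 612064, 710410, 599896, 576798, 538220, 62791, 662034, 649748, 530984],
      [654963, 525867, 602751, 607886, 540226, 577035, 46852, 608305, 590937, 701757,
        49695, 55928, 60471, 538524, 550601, 64533, 568900, 48085, 586008, 525635],
      [750453, 229842, 45161, 231204, 201345, 2801214, 14033, 152994, 552092, 655961,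
        150228, 243545, 241413, 40759, 693033, 2397332, 718761, 262032, 597376, 682863],
      [591495, 564451, 591080, 544436, 60251, 603219, 583893, 43019, 745842, 547370,
        705672, 802513, 752254, 776767, 780089, 716129, 607449, 687753, 63289, 576530],
      [136031, 670673, 781282, 49323, 167238, 162358, 250098, 2232372, 533963, 63373,
        2389031, 42854, 1039309, 163339, 675933, 545117, 187887, 233392, 135885, 525910]],
    ![[],
      [615449, 667744, 618404, 722673, 612134, 657729, 63813, 34564, 45401, 556913],
      [260868, 222952, 140505, 53291, 138329, 45944, 47751, 49146, 168355, 50044,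
        749357, 204438, 2139892, 14386, 571337, 525079, 639818, 943626, 2293135, 2572857],
      [2137500, 146746, 534011, 39313, 2281411, 164440, 11008050, 638468, 164056,
        180109, 579859, 178071, 141529, 695841, 16024, 133109, 41501, 4009666, 203497,
        11035],
      [221710, 134931, 156116, 160208, 603530, 202863, 749971, 874603, 56747, 203049,
        33428, 145969, 2256602, 2231766, 241533, 212709, 200280, 700823, 705483, 219470],
      [553509, 8462494, 544112, 831497, 561316, 42749, 527870, 643534, 47063, 35804,
        978464, 602000, 52229, 786361, 42724, 868561, 639869, 604057, 1012121, 539028],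
      [2313645, 2450390, 34125, 230170, 927680, 167600, 723087, 991185, 622873, 557700,
        2353681, 35050, 192097, 2265094, 795304, 675005, 53546, 230140, 208722, 151539],
      [553565, 38473, 714272, 38062, 562396, 9428217, 883487, 986802, 8412185, 657007,
        527153, 899856, 50102, 50379, 958598, 833839, 606736, 640645, 667320, 605632]],
    ![[],
      [],
      [649205, 47146, 564393, 542503, 37712, 654415, 8399527, 559817, 586448],
      [60886, 51398, 37554, 764875, 581518, 3855, 720576, 8552295, 571553, 528608,
        741562, 33775, 691510, 617217, 589097, 547096, 533135, 885321, 581985, 538944],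
      [532530, 34410, 634074, 2785, 653229, 845953, 556150, 961393, 600128, 575373,
        946201, 538729, 527182, 8694487, 674386, 571553, 663532, 48800, 525345, 533990],
      [886760, 877521, 15462, 260178, 959447, 214458, 647276, 150678, 43725, 12348,
        785405, 661790, 168808, 207866, 914697, 656836, 261317, 2227316, 233578, 813],
      [531573, 8448945, 623683, 40045, 55492, 794948, 51582, 682944, 553265, 595854,
        734048, 722717, 60201, 792144, 527925, 547236, 605284, 52737, 742375, 635925],
      [613330, 186116, 47699, 615237, 745571, 659502, 592856, 2324895, 197406, 243011,
        759407, 525361, 155406, 134587, 156397, 225607, 161537, 637325, 2126223, 160127]],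
    ![[],
      [],
      [],
      [571087, 716837, 640257, 595724, 593176, 808122, 529735, 559640, 699367],
      [547144, 590930, 606602, 532775, 571592, 43983, 527853, 565809, 855507, 535443,
        563050, 590498, 716537, 595749, 567113, 559824, 533109, 645030, 584424, 643672],
      [228366, 197803, 168458, 245886, 149363, 133817, 55360, 2903097, 234084, 2695077,
        780917, 562079, 887648, 219469, 1036328, 2283549, 586313, 628055, 232545, 737888],
      [33364, 537652, 632545, 753680, 62620, 532432, 34426, 33154, 697932, 653097,
        541418, 59575, 562357, 822277, 45528, 535130, 617541, 734020, 665269, 603013],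
      [779787, 54082, 137655, 887969, 2542142, 680686, 58417, 195554, 175606, 156723,
        851720, 41638, 622958, 804197, 584598, 2345527, 187569, 182560, 683369, 136283]],
    ![[],
      [],
      [],
      [],
      [628258, 561343, 42513],
      [195030, 153125, 37239, 537169, 914637, 252156, 237189, 813539, 549413, 757347,
        2239526, 241636, 62269, 979136, 239761, 583846, 2366490, 39539, 53168, 529141],
      [36552, 713289, 616556, 44370, 2394, 636420, 579986, 48567, 636636, 547248,
        614191, 614972, 41085, 633689, 834453, 626017, 43743, 750699, 57985, 38835],
      [170953, 135468, 131268, 57734, 54892, 2175059, 805966, 11373, 188635, 2295015,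
        786164, 526324, 659294, 621399, 783607, 154267, 2109175, 39061, 585210, 3015837]],
    ![[],
      [],
      [],
      [],
      [],
      [571173, 827714, 8758244],
      [648208, 537707, 219963, 2509637, 2239874, 870649, 2250914, 674736, 208162,
        831377, 55444, 53641, 774612, 2126587, 37974, 785764, 724890, 258864, 1013377,
        2231573],
      [549084, 54496, 1032313, 691502, 673956, 895381, 529859, 704637, 591248, 51758,
        57418, 526533, 554566, 47865, 751078, 45271, 980593, 33695, 727317, 621671]],
    ![[],
      [],
      [],
      [],
      [],
      [],
      [569653],
      [146871, 43137, 554737, 760213, 52084, 226307, 145757, 140035, 154434, 3038711,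
        982151, 603226, 163218, 555392, 2130250, 1011326, 250013, 648092, 2135751,
        886790]],
    ![[],
      [],
      [],
      [],
      [],
      [],
      [],
      [536954]]]

theorem valid_certWreath : certWreath.Valid (permMul 12) 205163983024656 where
  c_inv := by decide +kernel
  base_inv := by decide +kernel
  gen_inv := by decide +kernel
  len_le := by decide +kernel
  commute := by decide +kernel
  toBase := by decide +kernel
  ofBase := by decide +kernel
  words_ne := by decide +kernel
  words_eq := by decide +kernel

theorem unitSign_eq {u : (Function.End TwoSix)ˣ} {a b : ℕ} (hu : u.val = codeMapTwo a)
    (h1 : ∀ x, codeMapTwo b (codeMapTwo a x) = x) (h2 : ∀ x, codeMapTwo a (codeMapTwo b x) = x) :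
    unitSign u = Equiv.Perm.sign (⟨codeMapTwo a, codeMapTwo b, h1, h2⟩ : Equiv.Perm TwoSix) := by
  change Equiv.Perm.sign (Equiv.Perm.equivUnitsEnd.symm u) = _
  congr 1
  exact Equiv.ext fun x ↦ congrFun hu x

theorem exists_coveringNumber_eq_73 :
    ∃ (G : Type) (_ : Group G) (_ : Finite G), coveringNumber G = (73 : ℕ) := by
  obtain ⟨c, r₀, r, hc, hr₀, -, -, hmem, -, hgen⟩ :=
    valid_certWreath.exists_units codeMapTwo_permMul
      (show codeMapTwo 205163983024656 = 1 from funext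
        (show ∀ x, codeFunTwo 205163983024656 x = x by decide +kernel))
  have : Finite (Function.End TwoSix) := inferInstanceAs (Finite (TwoSix → TwoSix))
  have hle : Subgroup.closure {c, r₀} ≤ wreathSubgroup := by
    refine closure_pair_le (Or.inl ⟨?_, ?_⟩) (Or.inr ⟨?_, ?_⟩)
    · rw [hc]; decide +kernel
    · rw [unitSign_eq (b := certWreath.cInv) hc (by decide +kernel) (by decide +kernel)]
      decide +kernel
    · rw [hr₀]; decide +kernel
    · rw [unitSign_eq (b := certWreath.baseInv) hr₀ (by decide +kernel) (by decide +kernel)]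
      decide +kernel
  refine ⟨Subgroup.closure {c, r₀}, inferInstance, inferInstance, le_antisymm ?_ ?_⟩
  · have h := coveringNumber_subgroup_le_of_family (Subgroup.closure {c, r₀})
      (ι := Option (Fin 6 × Fin 6 ⊕ Fin 6 × Fin 6))
      (fun s ↦ s.elim (invariantSubgroup {x | x.isLeft = true}) (Sum.elim
        (fun p ↦ invariantSubgroup {.inl p.1, .inr p.2})
        fun p ↦ relSubgroup (totalPairRel p.1 p.2))) ?_ ?_
    · rw [Nat.card_eq_fintype_card] at h
      exact h.trans_eq (congrArg _ (by decide +kernel))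
    · rintro (_ | ⟨i, j⟩ | ⟨t, t'⟩) h
      · have h1 := h (right_mem_closure_pair c r₀) (.inl 0)
        rw [hr₀] at h1
        exact absurd h1 (show ¬ (Sum.isLeft _ = true ↔ Sum.isLeft _ = true) by decide +kernel)
      · have h1 := h (left_mem_closure_pair c r₀) (.inr j)
        rw [hc] at h1
        have h2 : ∀ j, ∀ i : Fin 6, ¬ (codeMapTwo certWreath.c (.inr j) = .inl i ∨
          codeMapTwo certWreath.c (.inr j) = .inr j) := by decide +kernel
        exact h2 j i (h1.mpr (by simp))
      · have h1 : ∀ a b c d, _ := fun a b c' d ↦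
          h (left_mem_closure_pair c r₀) (.inr a) (.inr b) (.inr c') (.inr d)
        rw [hc] at h1
        have h2 : ∀ a, codeMapTwo certWreath.c (.inr a) =
          .inr (![1, 2, 3, 0, 5, 4] a : Fin 6) := by decide +kernel
        simp only [h2, totalPairRel] at h1
        have h3 : ∀ t', ¬ ∀ a b c d, SameSyntheme t' (![1, 2, 3, 0, 5, 4] a)
          (![1, 2, 3, 0, 5, 4] b) (![1, 2, 3, 0, 5, 4] c) (![1, 2, 3, 0, 5, 4] d) ↔
            SameSyntheme t' a b c d := by decide +kernel
        exact h3 t' h1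
    · intro g hg
      rcases hle hg with ⟨h, -⟩ | ⟨h, hs⟩
      · exact ⟨none, fun x ↦ by
          rw [Set.mem_ofPred_eq, Set.mem_ofPred_eq, h]⟩
      · rcases exists_invariant_of_interchange h hs with ⟨i, j, h⟩ | ⟨t, t', h⟩
        · exact ⟨some (.inl (i, j)), h⟩
        · exact ⟨some (.inr (t, t')), h⟩
  · have h := le_coveringNumber_of_pairwise_subgroup _ _ (orbitFamily_mem hmem) hgen
    rw [Nat.card_eq_fintype_card] at h
    exact le_trans (le_of_eq (congrArg _ (by decide +kernel))) h

end WreathSix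

section GeneralLinear

open Matrix

variable {F : Type} [Field F]

/-- `2 × 2` matrices. -/
abbrev MatTwo (F : Type) : Type := Matrix (Fin 2) (Fin 2) F

/-- The set of matrices of the elements of a subgroup. -/
def Subgroup.matrices (K : Subgroup (MatTwo F)ˣ) : Submonoid (MatTwo F) :=
  K.toSubmonoid.map (Units.coeHom _)

variable {K : Subgroup (MatTwo F)ˣ}

theorem mem_matrices {m : MatTwo F} : m ∈ K.matrices ↔ ∃ u ∈ K, u.val = m := Iff.rfl

theorem val_mem_matrices {u : (MatTwo F)ˣ} : u.val ∈ K.matrices ↔ u ∈ K :=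
  ⟨fun ⟨_, hv, h⟩ ↦ Units.ext h ▸ hv, fun h ↦ ⟨u, h, rfl⟩⟩

theorem inv_mem_matrices {m m' : MatTwo F} (hm : m ∈ K.matrices) (h : m * m' = 1) :
    m' ∈ K.matrices := by
  obtain ⟨u, hu, rfl⟩ := mem_matrices.mp hm
  refine mem_matrices.mpr ⟨u⁻¹, K.inv_mem hu, ?_⟩
  rw [← mul_one (u⁻¹).val, ← h, ← mul_assoc, Units.inv_mul, one_mul]

theorem exists_unit {m : MatTwo F} (h : m.det ≠ 0) : ∃ u : (MatTwo F)ˣ, u.val = m :=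
  ⟨GeneralLinearGroup.mkOfDetNeZero m h, rfl⟩

theorem unit_det_ne_zero (u : (MatTwo F)ˣ) : u.val.det ≠ 0 :=
  ((Matrix.isUnit_iff_isUnit_det _).mp u.isUnit).ne_zero

/-- `SL(2, F)` is generated by elementary matrices. -/
theorem mem_matrices_of_det_eq_one (hU : ∀ c, !![1, c; 0, 1] ∈ K.matrices)
    (hL : ∀ c, !![1, 0; c, 1] ∈ K.matrices) {m : MatTwo F} (hm : m.det = 1) :
    m ∈ K.matrices := by
  have key : ∀ a b c d : F, c ≠ 0 → a * d - b * c = 1 → !![a, b; c, d] ∈ K.matrices := by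
    intro a b c d hc h
    have : !![a, b; c, d] = !![1, (a - 1) / c; 0, 1] * !![1, 0; c, 1] *
        !![1, (d - 1) / c; 0, 1] := by
      have hb : b = (a * d - 1) / c := by field_simp; linear_combination -h
      rw [hb]
      ext i j
      fin_cases i <;> fin_cases j <;> simp [Matrix.mul_apply, Fin.sum_univ_two] <;> field_simp <;>
        ring
    rw [this]
    exact mul_mem (mul_mem (hU _) (hL _)) (hU _)
  obtain ⟨a, b, c, d, rfl⟩ : ∃ a b c d, m = !![a, b; c, d] := ⟨_, _, _, _, m.eta_fin_two⟩
  rw [det_fin_two_of] at hm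
  by_cases hc : c = 0
  · subst hc
    have ha : a ≠ 0 := by rintro rfl; simp at hm
    have h1 : !![a, b; 0, d] = !![1, 0; -1, 1] * !![a, b; a, b + d] := by
      ext i j
      fin_cases i <;> fin_cases j <;> simp [Matrix.mul_apply, Fin.sum_univ_two]
    rw [h1]
    exact mul_mem (hL _) (key _ _ _ _ ha (by linear_combination hm))
  · exact key _ _ _ _ hc hm

theorem eq_top_of_elementary {d : F} (hd : ∀ x, x ≠ 0 → ∃ k : ℕ, d ^ k = x)
    (hU : ∀ c, !![1, c; 0, 1] ∈ K.matrices) (hL : ∀ c, !![1, 0; c, 1] ∈ K.matrices)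
    {u : (MatTwo F)ˣ} (hu : u ∈ K) (hdet : u.val.det = d) : K = ⊤ := by
  rw [eq_top_iff]
  intro g _
  obtain ⟨k, hk⟩ := hd _ (unit_det_ne_zero g)
  have h1 : ((u ^ k)⁻¹ * g).val.det = 1 := by
    have h2 := congrArg (fun v : (MatTwo F)ˣ ↦ v.val.det) (mul_inv_cancel_left (u ^ k) g)
    simp only [Units.val_mul, Matrix.det_mul, Units.val_pow_eq_pow_val, Matrix.det_pow, hdet,
      hk] at h2
    rw [Units.val_mul, Matrix.det_mul]
    exact mul_left_cancel₀ (unit_det_ne_zero g) (h2.trans (mul_one _).symm)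
  have := val_mem_matrices.mp (mem_matrices_of_det_eq_one hU hL h1)
  simpa using mul_mem (pow_mem hu k) this

/-- A subgroup containing all upper elementary matrices is everything or triangular. -/
theorem eq_top_or_triangular {d : F} (hd : ∀ x, x ≠ 0 → ∃ k : ℕ, d ^ k = x)
    (hU : ∀ c, !![1, c; 0, 1] ∈ K.matrices) {u : (MatTwo F)ˣ} (hu : u ∈ K)
    (hdet : u.val.det = d) : K = ⊤ ∨ ∀ g ∈ K, g.val 1 0 = 0 := by
  by_contra! h
  obtain ⟨htop, g, hg, hr⟩ := h
  refine htop (eq_top_of_elementary hd hU (fun c ↦ ?_) hu hdet)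
  have hdg := unit_det_ne_zero g
  have hgK : g.val ∈ K.matrices := ⟨g, hg, rfl⟩
  obtain ⟨p, q, r, w, hm⟩ : ∃ p q r w, g.val = !![p, q; r, w] := ⟨_, _, _, _, g.val.eta_fin_two⟩
  rw [hm] at hr hdg hgK
  replace hr : r ≠ 0 := by simpa using hr
  rw [det_fin_two_of] at hdg
  obtain ⟨D, hD⟩ : ∃ D, D = q * r - p * w := ⟨_, rfl⟩
  have hD0 : D ≠ 0 := fun h ↦ hdg (by linear_combination hD - h)
  have h1 : !![0, D / r; r, w] ∈ K.matrices := by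
    have : !![0, D / r; r, w] = !![1, -p / r; 0, 1] * !![p, q; r, w] := by
      rw [hD]
      ext i j
      fin_cases i <;> fin_cases j <;> simp [Matrix.mul_apply, Fin.sum_univ_two] <;> field_simp <;>
        ring
    rw [this]
    exact mul_mem (hU _) hgK
  have h2 : !![-(w / D), 1 / r; r / D, 0] ∈ K.matrices := by
    refine inv_mem_matrices h1 ?_
    ext i j
    fin_cases i <;> fin_cases j <;> simp [Matrix.mul_apply, Fin.sum_univ_two] <;> field_simp <;>
      ring
  have h3 : !![1, 0; c, 1] = !![0, D / r; r, w] * !![1, c * D / r ^ 2; 0, 1] *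
      !![-(w / D), 1 / r; r / D, 0] := by
    ext i j
    fin_cases i <;> fin_cases j <;> simp [Matrix.mul_apply, Fin.sum_univ_two] <;> field_simp <;>
      ring
  rw [h3]
  exact mul_mem (mul_mem h1 (hU _)) h2

theorem upper_mem_of_nonzero {d : F} (hd : ∀ x, x ≠ 0 → ∃ k : ℕ, d ^ k = x) (hd0 : d ≠ 0) {x c : F}
    (hx : !![1, x; 0, d] ∈ K.matrices) (hc : c ≠ 0) (h : !![1, c; 0, 1] ∈ K.matrices) (y : F) :
    !![1, y; 0, 1] ∈ K.matrices := by
  have hx' : !![1, -x / d; 0, 1 / d] ∈ K.matrices := by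
    refine inv_mem_matrices hx ?_
    ext i j
    fin_cases i <;> fin_cases j <;> simp [Matrix.mul_apply, Fin.sum_univ_two] <;> field_simp <;>
      ring
  have hk : ∀ k : ℕ, !![1, c * d ^ k; 0, 1] ∈ K.matrices := by
    intro k
    induction k with
    | zero => simpa using h
    | succ k ih =>
      have : !![1, c * d ^ (k + 1); 0, 1] = !![1, -x / d; 0, 1 / d] * !![1, c * d ^ k; 0, 1] *
          !![1, x; 0, d] := by
        ext i j
        fin_cases i <;> fin_cases j <;> simp [Matrix.mul_apply, Fin.sum_univ_two] <;>
          field_simp <;> ring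
      rw [this]
      exact mul_mem (mul_mem hx' ih) hx
  by_cases hy : y = 0
  · subst hy
    rw [← Matrix.one_fin_two]
    exact one_mem _
  · obtain ⟨k, hk'⟩ := hd (y / c) (by positivity)
    have := hk k
    rwa [hk', mul_div_cancel₀ _ hc] at this

end GeneralLinear

section GeneralLinear

open Matrix

variable {F : Type} [Field F]

/-- Multiplication by `x + y √n` in the basis `1, √n`. -/
def scalarTwo (n x y : F) : MatTwo F := !![x, n * y; y, x]

theorem scalarTwo_mul (n x y x' y' : F) :
    scalarTwo n x y * scalarTwo n x' y' = scalarTwo n (x * x' + n * (y * y')) (x * y' + y * x') := by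
  ext i j
  fin_cases i <;> fin_cases j <;> simp [scalarTwo, Matrix.mul_apply, Fin.sum_univ_two] <;> ring

/-- `h + √n` is a primitive element of a quadratic extension of a finite field of odd order, with
norm other than `-1`, and the values `y` with `n (1 - n k²) y² = c` span the field. -/
structure IsSinger (h n : F) : Prop where
  two_ne : (2 : F) ≠ 0
  h_ne : h ≠ 0
  not_square : ∀ x, x * x ≠ n
  gen : ∀ x y, ¬ (x = 0 ∧ y = 0) → ∃ k : ℕ, scalarTwo n h 1 ^ k = scalarTwo n x y
  gen_det : ∀ x, x ≠ 0 → ∃ k : ℕ, (h * h - n) ^ k = x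
  det_ne : 1 + (h * h - n) ≠ 0
  span : ∀ c, c ≠ 0 → ∀ S : AddSubgroup F,
    (∀ y k, n * (1 - n * (k * k)) * (y * y) = c → y ∈ S) → S = ⊤

variable {K : Subgroup (MatTwo F)ˣ} {n : F}

theorem norm_ne_zero (hn : ∀ x, x * x ≠ n) {x y : F} (h : ¬ (x = 0 ∧ y = 0)) :
    x * x - n * (y * y) ≠ 0 := by
  intro h0
  by_cases hy : y = 0
  · subst hy
    exact h ⟨by simpa using h0, rfl⟩
  · refine hn (x / y) ?_
    field_simp
    linear_combination h0

/-- Some element of `T b T` is the lower elementary matrix with entry `2 y`. -/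
theorem lower_mem_of_unipotent (hn : ∀ x, x * x ≠ n)
    (hT : ∀ x y, ¬ (x = 0 ∧ y = 0) → scalarTwo n x y ∈ K.matrices) {a b c d y : F}
    (hb : !![a, b; c, d] ∈ K.matrices) (htr : a + d = 2) (hdet : a * d - b * c = 1)
    (hy : n * c + b = 2 * n * y) : !![1, 0; 2 * y, 1] ∈ K.matrices := by
  have hn0 : n ≠ 0 := fun h ↦ hn 0 (by simp [h])
  have hd : d = 2 - a := by linear_combination htr
  subst hd
  by_cases hb0 : b = 0
  · subst hb0
    have ha : a = 1 := by
      have : (a - 1) ^ 2 = 0 := by linear_combination -hdet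
      linear_combination pow_eq_zero_iff (two_ne_zero) |>.mp this
    have hc : c = 2 * y := mul_left_cancel₀ hn0 (by linear_combination hy)
    subst ha hc
    convert hb using 3
    norm_num
  · have hc : c = 2 * y - b / n := by field_simp; linear_combination hy
    have hN := norm_ne_zero hn (x := 1 - a) (y := b / n) (by simp [hb0, hn0])
    have h1 := hT (1 - a) (b / n) (by simp [hb0, hn0])
    have h3 : scalarTwo n (1 - a) (b / n) * !![1, 0; 2 * y, 1] =
        !![a, b; c, 2 - a] * scalarTwo n (1 - a) (b / n) := by
      have e : (1 - a) * (1 - a) + b * (2 * y - b / n) = 0 := by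
        rw [hc] at hdet
        linear_combination -hdet
      have e' : (1 - a) * (1 - a) * n + b * (2 * y * n - b) = 0 := by
        field_simp at e
        linear_combination e
      rw [hc]
      ext i j
      fin_cases i <;> fin_cases j <;> simp [scalarTwo, Matrix.mul_apply, Fin.sum_univ_two] <;>
        field_simp
      · linear_combination e'
      · ring
      · ring
      · linear_combination -e'
    obtain ⟨u, hu, hu'⟩ := mem_matrices.mp h1
    have h4 := mul_mem (mul_mem (val_mem_matrices.mpr (K.inv_mem hu)) hb) h1
    rwa [mul_assoc, ← h3, ← hu', Units.inv_mul_cancel_left] at h4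

theorem lower_mem_of_double_coset (h2 : (2 : F) ≠ 0) (hn : ∀ x, x * x ≠ n)
    (hT : ∀ x y, ¬ (x = 0 ∧ y = 0) → scalarTwo n x y ∈ K.matrices) {p q r w y : F}
    (hb : !![p, q; r, w] ∈ K.matrices) (hdet : p * w - q * r ≠ 0)
    (hy : 4 * n * (1 - n * (y * y)) * (p * w - q * r) = n * (p + w) ^ 2 - (n * r + q) ^ 2) :
    !![1, 0; 2 * y, 1] ∈ K.matrices := by
  have hn0 : n ≠ 0 := fun h ↦ hn 0 (by simp [h])
  have hN := norm_ne_zero hn (x := 1) (y := y) (by simp)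
  obtain ⟨A, hA⟩ : ∃ A, A = n * (p + w) ^ 2 - (n * r + q) ^ 2 := ⟨_, rfl⟩
  have hA0 : A ≠ 0 := by
    rw [hA, ← hy]
    have : (4 : F) ≠ 0 := by
      have : (4 : F) = 2 * 2 := by norm_num
      rw [this]
      exact mul_ne_zero h2 h2
    refine mul_ne_zero (mul_ne_zero (mul_ne_zero this hn0) (by simpa using hN)) hdet
  -- `z = 2 (1 + y s) (n (p + w) - (n r + q) s) / A`
  obtain ⟨z1, hz1⟩ : ∃ z, z = 2 * (n * (p + w) - n * y * (n * r + q)) / A := ⟨_, rfl⟩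
  obtain ⟨z2, hz2⟩ : ∃ z, z = 2 * (n * y * (p + w) - (n * r + q)) / A := ⟨_, rfl⟩
  have hz : z1 * z1 - n * (z2 * z2) = 4 * n * (1 - n * (y * y)) / A := by
    rw [hz1, hz2]
    field_simp
    rw [hA]
    ring
  have hz0 : ¬ (z1 = 0 ∧ z2 = 0) := by
    rintro ⟨h1, h2⟩
    rw [h1, h2] at hz
    have h3 := mul_ne_zero hA0 hA0
    have : 4 * n * (1 - n * (y * y)) = 0 := by
      field_simp at hz
      linear_combination -hz
    rw [this, zero_mul, ← hA] at hy
    exact hA0 hy.symm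
  have h1 := mul_mem (hT z1 z2 hz0) hb
  have h3 : scalarTwo n z1 z2 * !![p, q; r, w] =
      !![z1 * p + n * z2 * r, z1 * q + n * z2 * w; z2 * p + z1 * r, z2 * q + z1 * w] := by
    ext i j
    fin_cases i <;> fin_cases j <;> simp [scalarTwo, Matrix.mul_apply, Fin.sum_univ_two]
  rw [h3] at h1
  refine lower_mem_of_unipotent hn hT h1 ?_ ?_ ?_
  · rw [hz1, hz2]
    field_simp
    rw [hA]
    ring
  · have : (z1 * z1 - n * (z2 * z2)) * (p * w - q * r) = 1 := by
      rw [hz]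
      field_simp
      rw [hA]
      linear_combination hy
    linear_combination this
  · rw [hz1, hz2]
    field_simp
    rw [hA]
    ring

theorem lower_mem_of_pair (h2 : (2 : F) ≠ 0) (hn : ∀ x, x * x ≠ n)
    (hT : ∀ x y, ¬ (x = 0 ∧ y = 0) → scalarTwo n x y ∈ K.matrices) {p q r w y k A : F}
    (hb : !![p, q; r, w] ∈ K.matrices) (hdet : p * w - q * r ≠ 0)
    (hA : A = n * (p + w) ^ 2 - (n * r + q) ^ 2) (hA0 : A ≠ 0)
    (hy : n * (1 - n * (k * k)) * (y * y) * (4 * n ^ 2 * (p * w - q * r) ^ 2) =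
      A * (4 * n * (p * w - q * r) - A)) : !![1, 0; 2 * y, 1] ∈ K.matrices := by
  have hn0 : n ≠ 0 := fun h ↦ hn 0 (by simp [h])
  obtain ⟨z1, hz1⟩ : ∃ z, z = n * (p + w) - n * k * (n * r + q) := ⟨_, rfl⟩
  obtain ⟨z2, hz2⟩ : ∃ z, z = n * k * (p + w) - (n * r + q) := ⟨_, rfl⟩
  have hk := norm_ne_zero hn (x := 1) (y := k) (by simp)
  have hz : z1 * z1 - n * (z2 * z2) = n * A * (1 * 1 - n * (k * k)) := by
    rw [hz1, hz2, hA]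
    ring
  have hzn : z1 * z1 - n * (z2 * z2) ≠ 0 := by
    rw [hz]
    exact mul_ne_zero (mul_ne_zero hn0 hA0) hk
  have hz0 : ¬ (z1 = 0 ∧ z2 = 0) := by
    rintro ⟨h1, h2⟩
    simp [h1, h2] at hzn
  have h1 := mul_mem hb (mul_mem (hT z1 z2 hz0) hb)
  obtain ⟨p', hp'⟩ : ∃ x, x = p * (z1 * p + n * z2 * r) + q * (z2 * p + z1 * r) := ⟨_, rfl⟩
  obtain ⟨q', hq'⟩ : ∃ x, x = p * (z1 * q + n * z2 * w) + q * (z2 * q + z1 * w) := ⟨_, rfl⟩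
  obtain ⟨r', hr'⟩ : ∃ x, x = r * (z1 * p + n * z2 * r) + w * (z2 * p + z1 * r) := ⟨_, rfl⟩
  obtain ⟨w', hw'⟩ : ∃ x, x = r * (z1 * q + n * z2 * w) + w * (z2 * q + z1 * w) := ⟨_, rfl⟩
  have h3 : !![p, q; r, w] * (scalarTwo n z1 z2 * !![p, q; r, w]) = !![p', q'; r', w'] := by
    rw [hp', hq', hr', hw']
    ext i j
    fin_cases i <;> fin_cases j <;> simp [scalarTwo, Matrix.mul_apply, Fin.sum_univ_two]
  rw [h3] at h1
  have hdet' : p' * w' - q' * r' = (p * w - q * r) ^ 2 * (z1 * z1 - n * (z2 * z2)) := by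
    rw [hp', hq', hr', hw']
    ring
  refine lower_mem_of_double_coset h2 hn hT h1 ?_ ?_
  · rw [hdet']
    exact mul_ne_zero (pow_ne_zero _ hdet) hzn
  · have e : 4 * n * (p' * w' - q' * r') - (n * (p' + w') ^ 2 - (n * r' + q') ^ 2) =
        A ^ 2 * (4 * n * (p * w - q * r) - A) := by
      rw [hp', hq', hr', hw', hz1, hz2, hA]
      ring
    rw [hz] at hdet'
    linear_combination e - A * hy - 4 * n ^ 2 * (y * y) * hdet'

/-- A maximal torus `T` together with an element outside its normaliser generates everything. -/
theorem eq_top_of_standard {h : F} (hs : IsSinger h n) {a b : (MatTwo F)ˣ} (ha : a ∈ K)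
    (hav : a.val = scalarTwo n h 1) (hb : b ∈ K) (htr : b.val.trace ≠ 0)
    (hc : a.val * b.val ≠ b.val * a.val) : K = ⊤ := by
  have hn0 : n ≠ 0 := fun h ↦ hs.not_square 0 (by simp [h])
  have h2 := hs.two_ne
  have hT : ∀ x y, ¬ (x = 0 ∧ y = 0) → scalarTwo n x y ∈ K.matrices := by
    intro x y hxy
    obtain ⟨k, hk⟩ := hs.gen x y hxy
    rw [← hk, ← hav]
    exact pow_mem (val_mem_matrices.mpr ha) k
  have hdet := unit_det_ne_zero b
  have hbK := val_mem_matrices.mpr hb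
  obtain ⟨p, q, r, w, hm⟩ : ∃ p q r w, b.val = !![p, q; r, w] := ⟨_, _, _, _, b.val.eta_fin_two⟩
  rw [hm] at hdet hbK htr hc
  rw [det_fin_two_of] at hdet
  rw [trace_fin_two_of] at htr
  rw [hav] at hc
  obtain ⟨A, hA⟩ : ∃ A, A = n * (p + w) ^ 2 - (n * r + q) ^ 2 := ⟨_, rfl⟩
  have hA0 : A ≠ 0 := by
    have := norm_ne_zero hs.not_square (x := n * r + q) (y := p + w) (by simp [htr])
    intro h0
    exact this (by linear_combination hA - h0)
  have hC0 : 4 * n * (p * w - q * r) - A ≠ 0 := by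
    have := norm_ne_zero hs.not_square (x := n * r - q) (y := p - w) (by
      rintro ⟨h1, h3⟩
      refine hc ?_
      have e1 : q = n * r := by linear_combination -h1
      have e2 : p = w := by linear_combination h3
      subst e1 e2
      ext i j
      fin_cases i <;> fin_cases j <;> simp [scalarTwo, Matrix.mul_apply, Fin.sum_univ_two] <;>
        ring)
    intro h0
    exact this (by linear_combination h0 + hA)
  have h4 : 4 * n ^ 2 * (p * w - q * r) ^ 2 ≠ 0 := by
    have : (4 : F) = 2 * 2 := by norm_num
    rw [this]
    exact mul_ne_zero (mul_ne_zero (mul_ne_zero h2 h2) (pow_ne_zero _ hn0)) (pow_ne_zero _ hdet)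
  let S : AddSubgroup F :=
    { carrier := {y | !![1, 0; 2 * y, 1] ∈ K.matrices}
      zero_mem' := by
        change !![1, 0; 2 * 0, 1] ∈ K.matrices
        rw [mul_zero, ← Matrix.one_fin_two]
        exact one_mem _
      add_mem' := by
        intro x y hx hy
        have : !![1, 0; 2 * (x + y), 1] = !![1, 0; 2 * x, 1] * !![1, 0; 2 * y, 1] := by
          ext i j
          fin_cases i <;> fin_cases j <;> simp [Matrix.mul_apply, Fin.sum_univ_two]
          ring
        change !![1, 0; 2 * (x + y), 1] ∈ K.matrices
        rw [this]
        exact mul_mem hx hy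
      neg_mem' := by
        intro x hx
        refine inv_mem_matrices hx ?_
        ext i j
        fin_cases i <;> fin_cases j <;> simp [Matrix.mul_apply, Fin.sum_univ_two] }
  have hS : S = ⊤ := by
    refine hs.span (A * (4 * n * (p * w - q * r) - A) / (4 * n ^ 2 * (p * w - q * r) ^ 2))
      (div_ne_zero (mul_ne_zero hA0 hC0) h4) S fun y k hyk ↦ ?_
    refine lower_mem_of_pair h2 hs.not_square hT hbK hdet hA hA0 (k := k) ?_
    rw [hyk, div_mul_cancel₀ _ h4]
  have hL : ∀ c, !![1, 0; c, 1] ∈ K.matrices := by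
    intro c
    have h5 : c / 2 ∈ S := hS ▸ AddSubgroup.mem_top _
    have : !![1, 0; 2 * (c / 2), 1] ∈ K.matrices := h5
    rwa [mul_div_cancel₀ _ h2] at this
  refine eq_top_of_elementary hs.gen_det (fun c ↦ ?_) hL ha ?_
  · have : !![1, c; 0, 1] = scalarTwo n 0 1 * !![1, 0; c / n, 1] * scalarTwo n 0 (1 / n) := by
      ext i j
      fin_cases i <;> fin_cases j <;> simp [scalarTwo, Matrix.mul_apply, Fin.sum_univ_two] <;>
        field_simp
    rw [this]
    exact mul_mem (mul_mem (hT _ _ (by simp)) (hL _)) (hT _ _ (by simp [hn0]))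
  · rw [hav, scalarTwo, det_fin_two_of]
    ring

/-- Two non-commuting matrices with a common primitive characteristic polynomial generate. -/
theorem eq_top_of_singer {h : F} (hs : IsSinger h n) {a b : (MatTwo F)ˣ} (ha : a ∈ K)
    (hat : a.val.trace = 2 * h) (had : a.val.det = h * h - n) (hb : b ∈ K)
    (htr : b.val.trace ≠ 0) (hc : a.val * b.val ≠ b.val * a.val) : K = ⊤ := by
  obtain ⟨p, q, r, w, hm⟩ : ∃ p q r w, a.val = !![p, q; r, w] := ⟨_, _, _, _, a.val.eta_fin_two⟩
  rw [hm, trace_fin_two_of] at hat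
  rw [hm, det_fin_two_of] at had
  have hr : r ≠ 0 := by
    rintro rfl
    refine hs.not_square (p - h) ?_
    linear_combination p * hat - had
  obtain ⟨P, hP⟩ := exists_unit (m := !![1, p - h; 0, r]) (by simpa using hr)
  have hPa : P.val * scalarTwo n h 1 = a.val * P.val := by
    rw [hP, hm]
    ext i j
    fin_cases i <;> fin_cases j <;> simp [scalarTwo, Matrix.mul_apply, Fin.sum_univ_two]
    · linear_combination had - p * hat
    · linear_combination -r * hat
  have h1 : K.comap (MulAut.conj P).toMonoidHom = ⊤ := by
    refine eq_top_of_standard (a := P⁻¹ * a * P) (b := P⁻¹ * b * P) hs ?_ ?_ ?_ ?_ ?_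
    · simpa [Subgroup.mem_comap, mul_assoc] using ha
    · rw [Units.val_mul, Units.val_mul, mul_assoc, ← hPa, Units.inv_mul_cancel_left]
    · simpa [Subgroup.mem_comap, mul_assoc] using hb
    · rwa [Units.val_mul, Matrix.trace_mul_comm, Units.val_mul, Units.mul_inv_cancel_left]
    · intro h0
      refine hc ?_
      rw [← Units.val_mul, ← Units.val_mul, Units.val_inj] at h0 ⊢
      calc a * b = P * (P⁻¹ * a * P * (P⁻¹ * b * P)) * P⁻¹ := by group
        _ = b * a := by rw [h0]; group
  rw [eq_top_iff]
  intro g _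
  have : P⁻¹ * g * P ∈ K.comap (MulAut.conj P).toMonoidHom := h1 ▸ Subgroup.mem_top _
  simpa [Subgroup.mem_comap, mul_assoc] using this

end GeneralLinear

section GeneralLinear

open Matrix

variable {F : Type} [Field F]

/-- A change of basis moving the first basis vector to a given point of the projective line. -/
def pointFrame : Option F → (MatTwo F)ˣ
  | none => 1
  | some x => ⟨!![x, 1; 1, 0], !![0, 1; 1, -x], by
      ext i j
      fin_cases i <;> fin_cases j <;> simp [Matrix.mul_apply, Fin.sum_univ_two], by
      ext i j
      fin_cases i <;> fin_cases j <;> simp [Matrix.mul_apply, Fin.sum_univ_two]⟩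

theorem pointFrame_inv_mul {i j : Option F} (h : i ≠ j) :
    ((pointFrame j)⁻¹ * pointFrame i).val 1 0 ≠ 0 := by
  cases i with
  | none => cases j with
    | none => simp at h
    | some y => simp [pointFrame, Units.inv_mk]
  | some x => cases j with
    | none => simp [pointFrame]
    | some y =>
      simp only [ne_eq, Option.some.injEq] at h
      simp [pointFrame, Units.inv_mk, Matrix.mul_apply, Fin.sum_univ_two]
      intro h0
      exact h (by linear_combination h0)

/-- Invertible upper triangular matrices. -/
def upperTriangular (F : Type) [Field F] : Subgroup (MatTwo F)ˣ where
  carrier := {g | g.val 1 0 = 0}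
  one_mem' := by simp
  mul_mem' := by
    intro a b ha hb
    simp only [Set.mem_ofPred_eq] at ha hb ⊢
    simp [Matrix.mul_apply, Fin.sum_univ_two, ha, hb]
  inv_mem' := by
    intro a ha
    simp only [Set.mem_ofPred_eq] at ha ⊢
    have h1 := congrFun (congrFun (Units.mul_inv a) 1) 0
    have h2 := unit_det_ne_zero a
    rw [Matrix.det_fin_two, ha, mul_zero, sub_zero] at h2
    rw [Matrix.mul_apply, Fin.sum_univ_two, ha, zero_mul, zero_add] at h1
    exact (mul_eq_zero.mp (h1.trans (by simp))).resolve_left (right_ne_zero_of_mul h2)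

/-- The stabiliser of a point of the projective line. -/
def pointStabilizer (i : Option F) : Subgroup (MatTwo F)ˣ :=
  (upperTriangular F).comap (MulAut.conj (pointFrame i)⁻¹).toMonoidHom

theorem mem_pointStabilizer {i : Option F} {g : (MatTwo F)ˣ} :
    g ∈ pointStabilizer i ↔ ((pointFrame i)⁻¹ * g * pointFrame i).val 1 0 = 0 := by
  simp [pointStabilizer, upperTriangular, Subgroup.mem_comap, Subgroup.mem_mk]

/-- The unit with matrix `!![1, x; 0, d]`. -/
noncomputable def affineUnit (x : F) (d : F) (hd : d ≠ 0) : (MatTwo F)ˣ :=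
  GeneralLinearGroup.mkOfDetNeZero !![1, x; 0, d] (by simpa using hd)

theorem affineUnit_val (x d : F) (hd : d ≠ 0) : (affineUnit x d hd).val = !![1, x; 0, d] := rfl

theorem lower_ne_zero_of_conj {W T : (MatTwo F)ˣ} (hW : W.val 1 0 ≠ 0) {x : F} (hx : x ≠ 0)
    (h : W * affineUnit x 1 one_ne_zero = T * W) : T.val 1 0 ≠ 0 := by
  intro hT
  have h' := congrArg Units.val h
  rw [Units.val_mul, Units.val_mul, affineUnit_val] at h'
  have h0 := congrFun (congrFun h' 1) 0
  have h1 := congrFun (congrFun h' 1) 1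
  simp only [Matrix.mul_apply, Fin.sum_univ_two, hT] at h0 h1
  simp at h0 h1
  have : T.val 1 1 = 1 := mul_right_cancel₀ hW (by linear_combination -h0)
  rw [this] at h1
  exact (mul_ne_zero hW hx) (by linear_combination h1)

theorem not_commute_affine {a b : (MatTwo F)ˣ}
    (ha : ∀ x, x * x - a.val.trace * x + a.val.det ≠ 0) {x d : F} (hd : d ≠ 0)
    (hxd : x ≠ 0 ∨ d ≠ 1) (P : (MatTwo F)ˣ) (hb : b = P * affineUnit x d hd * P⁻¹) :
    a.val * b.val ≠ b.val * a.val := by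
  intro hab
  rw [← Units.val_mul, ← Units.val_mul, Units.val_inj] at hab
  have hc : P⁻¹ * a * P * affineUnit x d hd = affineUnit x d hd * (P⁻¹ * a * P) := by
    have : affineUnit x d hd = P⁻¹ * b * P := by rw [hb]; group
    rw [this]
    calc P⁻¹ * a * P * (P⁻¹ * b * P) = P⁻¹ * (a * b) * P := by group
      _ = P⁻¹ * b * P * (P⁻¹ * a * P) := by rw [hab]; group
  have ht' : (P⁻¹ * a * P).val.trace = a.val.trace := by
    rw [Units.val_mul, Matrix.trace_mul_comm, Units.val_mul, Units.mul_inv_cancel_left]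
  have hd' : (P⁻¹ * a * P).val.det = a.val.det := by
    rw [Units.val_mul, Matrix.det_mul, mul_comm, Units.val_mul, Matrix.det_mul, ← mul_assoc,
      ← Matrix.det_mul, Units.mul_inv, Matrix.det_one, one_mul]
  rw [← ht', ← hd'] at ha
  generalize P⁻¹ * a * P = a' at *
  have h' := congrArg Units.val hc
  rw [Units.val_mul, Units.val_mul, affineUnit_val] at h'
  obtain ⟨p, q, r, w, hm⟩ : ∃ p q r w, a'.val = !![p, q; r, w] := ⟨_, _, _, _, a'.val.eta_fin_two⟩
  rw [hm] at h' ha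
  rw [trace_fin_two_of, det_fin_two_of] at ha
  have hr : r ≠ 0 := by
    rintro rfl
    exact ha p (by ring)
  have h0 := congrFun (congrFun h' 0) 0
  have h1 := congrFun (congrFun h' 1) 0
  simp [Matrix.mul_apply, Fin.sum_univ_two, hr] at h0 h1
  rcases hxd with h2 | h2
  · exact h2 h0
  · exact h2 h1

theorem not_mem_of_singer_mem {h n : F} (hs : IsSinger h n) {M : Subgroup (MatTwo F)ˣ}
    (hM : M ≠ ⊤) {a b : (MatTwo F)ˣ} {x d : F} (hd : d ≠ 0) (hxd : x ≠ 0 ∨ d ≠ 1)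
    (hd1 : 1 + d ≠ 0) (hat : a.val.trace = 2 * h) (had : a.val.det = h * h - n) (ha : a ∈ M)
    (P : (MatTwo F)ˣ) (hb : b = P * affineUnit x d hd * P⁻¹) : b ∉ M := by
  intro hbM
  refine hM (eq_top_of_singer hs ha hat had hbM ?_
    (not_commute_affine (fun y h0 ↦ ?_) hd hxd P hb))
  swap
  · rw [hat, had] at h0
    exact hs.not_square (y - h) (by linear_combination h0)
  rw [hb, Units.val_mul, Matrix.trace_mul_comm, Units.val_mul, Units.inv_mul_cancel_left,
    affineUnit_val, trace_fin_two_of]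
  exact hd1

/-- The matrices with prescribed trace `2 h`, determinant `h² - n` and lower left entry `r`. -/
noncomputable def singerUnit {h n : F} (hs : IsSinger h n) (p : F) {r : F} (hr : r ≠ 0) :
    (MatTwo F)ˣ :=
  GeneralLinearGroup.mkOfDetNeZero !![p, (n - (p - h) * (p - h)) / r; r, 2 * h - p] (by
    have := norm_ne_zero hs.not_square (x := h) (y := 1) (by simp)
    rw [det_fin_two_of]
    field_simp
    intro h0
    exact this (by linear_combination h0))

theorem singerUnit_val {h n : F} (hs : IsSinger h n) (p : F) {r : F} (hr : r ≠ 0) :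
    (singerUnit hs p hr).val = !![p, (n - (p - h) * (p - h)) / r; r, 2 * h - p] := rfl

theorem singerUnit_trace {h n : F} (hs : IsSinger h n) (p : F) {r : F} (hr : r ≠ 0) :
    (singerUnit hs p hr).val.trace = 2 * h := by
  rw [singerUnit_val, trace_fin_two_of]
  ring

theorem singerUnit_det {h n : F} (hs : IsSinger h n) (p : F) {r : F} (hr : r ≠ 0) :
    (singerUnit hs p hr).val.det = h * h - n := by
  rw [singerUnit_val, det_fin_two_of]
  field_simp
  ring

theorem singerUnit_not_commute {h n : F} (hs : IsSinger h n) {p p' r r' : F} (hr : r ≠ 0)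
    (hr' : r' ≠ 0) (hrr : r + r' ≠ 0) (hne : ¬ (p = p' ∧ r = r')) :
    (singerUnit hs p hr).val * (singerUnit hs p' hr').val ≠
      (singerUnit hs p' hr').val * (singerUnit hs p hr).val := by
  intro hc
  have hn0 : n ≠ 0 := fun h ↦ hs.not_square 0 (by simp [h])
  rw [singerUnit_val, singerUnit_val] at hc
  have h0 := congrFun (congrFun hc 0) 0
  have h1 := congrFun (congrFun hc 1) 0
  simp [Matrix.mul_apply, Fin.sum_univ_two] at h0 h1
  have e1 : r * (p' - h) = r' * (p - h) :=
    mul_left_cancel₀ hs.two_ne (by linear_combination h1)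
  have e0 : (n - (p - h) * (p - h)) / r * r' = (n - (p' - h) * (p' - h)) / r' * r := by
    linear_combination h0
  field_simp at e0
  have e2 : n * ((r' - r) * (r + r')) = 0 := by
    linear_combination e0 - (r * (p' - h) + r' * (p - h)) * e1
  have e3 : r' = r := by
    have := (mul_eq_zero.mp ((mul_eq_zero.mp e2).resolve_left hn0)).resolve_right hrr
    linear_combination this
  subst e3
  exact hne ⟨by linear_combination -mul_left_cancel₀ hr e1, rfl⟩

/-- The members of a cover that contain no Singer cycle. -/
theorem exists_injective_affine {h n : F} (hs : IsSinger h n) {S : Finset (Subgroup (MatTwo F)ˣ)}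
    (hS : IsSubgroupCover S) : ∃ f : Option F → Subgroup (MatTwo F)ˣ, Function.Injective f ∧
      ∀ j, f j ∈ S ∧ ∃ (P : (MatTwo F)ˣ) (x d : F) (hd : d ≠ 0), (x ≠ 0 ∨ d ≠ 1) ∧ 1 + d ≠ 0 ∧
        P * affineUnit x d hd * P⁻¹ ∈ f j := by
  have hd0 : h * h - n ≠ 0 := by
    have := norm_ne_zero hs.not_square (x := h) (y := 1) (by simp)
    simpa using this
  by_cases hcase : ∀ i : Option F, ∃ M ∈ S,
      pointFrame i * affineUnit 1 1 one_ne_zero * (pointFrame i)⁻¹ ∈ M ∧ M ≤ pointStabilizer i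
  · choose f hfS hfm hfs using hcase
    refine ⟨f, fun i j hij ↦ ?_, fun j ↦ ⟨hfS j, pointFrame j, 1, 1, one_ne_zero, Or.inl one_ne_zero,
      ?_, hfm j⟩⟩
    · by_contra hne
      have h1 := hfs j (hij ▸ hfm i)
      rw [mem_pointStabilizer] at h1
      refine lower_ne_zero_of_conj (pointFrame_inv_mul hne) one_ne_zero ?_ h1
      group
    · rw [one_add_one_eq_two]
      exact hs.two_ne
  · push Not at hcase
    obtain ⟨i, hi⟩ := hcase
    have key : ∀ M ∈ S, ∀ x c, c ≠ 0 →
        pointFrame i * affineUnit x (h * h - n) hd0 * (pointFrame i)⁻¹ ∈ M →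
        pointFrame i * affineUnit c 1 one_ne_zero * (pointFrame i)⁻¹ ∈ M → False := by
      intro M hM x c hc hx hcM
      have hx' : affineUnit x (h * h - n) hd0 ∈ M.comap (MulAut.conj (pointFrame i)).toMonoidHom :=
        hx
      have hc' : affineUnit c 1 one_ne_zero ∈ M.comap (MulAut.conj (pointFrame i)).toMonoidHom :=
        hcM
      have hU := upper_mem_of_nonzero hs.gen_det hd0 (val_mem_matrices.mpr hx') hc
        (val_mem_matrices.mpr hc')
      rcases eq_top_or_triangular hs.gen_det hU hx' (by simp [affineUnit_val]) with h1 | h1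
      · refine hS.1 M hM ?_
        rw [eq_top_iff]
        intro g _
        have : (pointFrame i)⁻¹ * g * pointFrame i ∈
          M.comap (MulAut.conj (pointFrame i)).toMonoidHom := h1 ▸ Subgroup.mem_top _
        simpa [Subgroup.mem_comap, mul_assoc] using this
      · refine hi M hM ?_ ?_
        · exact (val_mem_matrices (u := affineUnit 1 1 one_ne_zero)).mp (hU 1)
        · intro g hg
          rw [mem_pointStabilizer]
          refine h1 _ ?_
          simpa [Subgroup.mem_comap, mul_assoc] using hg
    have hg : ∀ j : Option F, ∃ M ∈ S, pointFrame i * (j.elim (affineUnit 1 1 one_ne_zero)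
        fun x ↦ affineUnit x (h * h - n) hd0) * (pointFrame i)⁻¹ ∈ M := fun j ↦ hS.2 _
    choose f hfS hfm using hg
    refine ⟨f, fun j k hjk ↦ ?_, fun j ↦ ⟨hfS j, ?_⟩⟩
    · have hj := hfm j
      have hk := hfm k
      rw [hjk] at hj
      cases j with
      | none => cases k with
        | none => rfl
        | some y => exact (key _ (hfS _) y 1 one_ne_zero hk hj).elim
      | some x => cases k with
        | none => exact (key _ (hfS _) x 1 one_ne_zero hj hk).elim
        | some y =>
          by_contra hne
          replace hne : y - x ≠ 0 := fun h0 ↦ hne (by rw [sub_eq_zero.mp h0])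
          refine key _ (hfS _) x (y - x) hne hj ?_
          have e : affineUnit y (h * h - n) hd0 =
              affineUnit x (h * h - n) hd0 * affineUnit (y - x) 1 one_ne_zero := by
            apply Units.ext
            rw [Units.val_mul, affineUnit_val, affineUnit_val, affineUnit_val]
            ext i j
            fin_cases i <;> fin_cases j <;> simp [Matrix.mul_apply, Fin.sum_univ_two]
          have := mul_mem (inv_mem hj) hk
          simp only [Option.elim_some] at this
          rw [e] at this
          convert this using 1
          group
    · cases j with
      | none => exact ⟨pointFrame i, 1, 1, one_ne_zero, Or.inl one_ne_zero,
          by rw [one_add_one_eq_two]; exact hs.two_ne, hfm _⟩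
      | some x =>
        refine ⟨pointFrame i, x, h * h - n, hd0, Or.inr fun h0 ↦ ?_, hs.det_ne, hfm _⟩
        obtain ⟨k, hk⟩ := hs.gen_det (-1) (by simp)
        rw [h0, one_pow] at hk
        exact hs.two_ne (by linear_combination hk)

theorem le_coveringNumber_matTwo [Fintype F] {h n : F} (hs : IsSinger h n) (R : Finset F)
    (hR : ∀ r ∈ R, r ≠ 0 ∧ ∀ r' ∈ R, r + r' ≠ 0) :
    ((Fintype.card F * R.card + (Fintype.card F + 1) : ℕ) : ℕ∞) ≤ coveringNumber (MatTwo F)ˣ := by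
  refine le_coveringNumber fun S hS ↦ ?_
  obtain ⟨f, hf, hfS⟩ := exists_injective_affine hs hS
  choose g hgS hgm using fun x : F × R ↦ hS.2 (singerUnit hs x.1 (hR _ x.2.2).1)
  have hg : Function.Injective g := by
    intro x y hxy
    by_contra hne
    have h1 := hgm x
    rw [hxy] at h1
    refine hS.1 _ (hgS y) (eq_top_of_singer hs h1 (singerUnit_trace ..) (singerUnit_det ..) (hgm y) ?_
      (singerUnit_not_commute hs _ _ ((hR _ x.2.2).2 _ y.2.2) fun h2 ↦ hne ?_))
    · rw [singerUnit_trace]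
      exact mul_ne_zero hs.two_ne hs.h_ne
    · exact Prod.ext h2.1 (Subtype.ext h2.2)
  have hfg : Function.Injective (Sum.elim g f) := by
    refine hg.sumElim hf fun x j hxj ↦ ?_
    obtain ⟨hj, P, y, d, hd, hyd, hd1, hm⟩ := hfS j
    rw [← hxj] at hm
    exact not_mem_of_singer_mem hs (hS.1 _ (hgS x)) hd hyd hd1 (singerUnit_trace ..)
      (singerUnit_det ..) (hgm x) P rfl hm
  have hmem : ∀ s : (F × R) ⊕ Option F, Sum.elim g f s ∈ S := by
    rintro (x | j)
    · exact hgS x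
    · exact (hfS j).1
  have := Fintype.card_le_of_injective (fun s ↦ (⟨_, hmem s⟩ : S))
    fun s t hst ↦ hfg (congrArg Subtype.val hst)
  simpa using this

/-- The similitudes of the quadratic form `x² + b x y + c y²`. -/
def similitudes (b c : F) : Subgroup (MatTwo F)ˣ where
  carrier := {g | ∃ l : F, l ≠ 0 ∧ ∀ v : Fin 2 → F,
    (g.val *ᵥ v) 0 ^ 2 + b * (g.val *ᵥ v) 0 * (g.val *ᵥ v) 1 + c * (g.val *ᵥ v) 1 ^ 2 =
      l * (v 0 ^ 2 + b * v 0 * v 1 + c * v 1 ^ 2)}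
  one_mem' := ⟨1, one_ne_zero, fun v ↦ by simp⟩
  mul_mem' := by
    rintro g g' ⟨l, hl, h⟩ ⟨l', hl', h'⟩
    refine ⟨l * l', mul_ne_zero hl hl', fun v ↦ ?_⟩
    rw [Units.val_mul, ← Matrix.mulVec_mulVec, h, h']
    ring
  inv_mem' := by
    rintro g ⟨l, hl, h⟩
    refine ⟨l⁻¹, inv_ne_zero hl, fun v ↦ ?_⟩
    have := h (g⁻¹.val *ᵥ v)
    rw [Matrix.mulVec_mulVec, Units.mul_inv, Matrix.one_mulVec] at this
    rw [this, inv_mul_cancel_left₀ hl]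

theorem mem_similitudes {g : (MatTwo F)ˣ} {p q r w : F} (hm : g.val = !![p, q; r, w])
    (hr : r ≠ 0) : g ∈ similitudes ((w - p) / r) (-q / r) := by
  have hd := unit_det_ne_zero g
  rw [hm, det_fin_two_of] at hd
  refine ⟨p * w - q * r, hd, fun v ↦ ?_⟩
  rw [hm]
  simp [Matrix.mulVec, dotProduct, Fin.sum_univ_two]
  field_simp
  ring

theorem mem_pointStabilizer_some {g : (MatTwo F)ˣ} {p q r w x : F} (hm : g.val = !![p, q; r, w])
    (hx : r * x * x + (w - p) * x - q = 0) : g ∈ pointStabilizer (some x) := by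
  rw [mem_pointStabilizer, Units.val_mul, Units.val_mul, hm]
  simp [pointFrame, Units.inv_mk, Matrix.mul_apply, Fin.sum_univ_two]
  linear_combination -hx

theorem pointStabilizer_ne_top (i : Option F) : pointStabilizer i ≠ ⊤ := by
  intro h
  obtain ⟨L, hL⟩ := exists_unit (F := F) (m := !![1, 0; 1, 1]) (by simp)
  have h1 : pointFrame i * L * (pointFrame i)⁻¹ ∈ pointStabilizer i := h ▸ Subgroup.mem_top _
  rw [mem_pointStabilizer] at h1
  have e : (pointFrame i)⁻¹ * (pointFrame i * L * (pointFrame i)⁻¹) * pointFrame i = L := by group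
  rw [e, hL] at h1
  simp at h1

theorem similitudes_ne_top (h2 : (2 : F) ≠ 0) (b c : F) : similitudes b c ≠ ⊤ := by
  intro h
  have h1 : affineUnit 1 1 one_ne_zero ∈ similitudes b c := h ▸ Subgroup.mem_top _
  obtain ⟨l, hl, hv⟩ := h1
  rw [affineUnit_val] at hv
  have e1 := hv ![1, 0]
  have e2 := hv ![0, 1]
  have e3 := hv ![1, 1]
  simp [Matrix.mulVec, dotProduct, Fin.sum_univ_two] at e1 e2 e3
  rw [← e1] at e2 e3
  exact h2 (by linear_combination e3 - e2)

theorem coveringNumber_matTwo_le [Fintype F] (h2 : (2 : F) ≠ 0) :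
    coveringNumber (MatTwo F)ˣ ≤
      ((Nat.card (Option F ⊕ {x : F × F // ∀ y, y * y + x.1 * y + x.2 ≠ 0}) : ℕ) : ℕ∞) := by
  refine coveringNumber_le_of_family (Sum.elim pointStabilizer fun x ↦ similitudes x.1.1 x.1.2) ?_ ?_
  · rintro (i | x)
    · exact pointStabilizer_ne_top i
    · exact similitudes_ne_top h2 _ _
  · intro g
    obtain ⟨p, q, r, w, hm⟩ : ∃ p q r w, g.val = !![p, q; r, w] := ⟨_, _, _, _, g.val.eta_fin_two⟩
    by_cases hr : r = 0
    · refine ⟨Sum.inl none, ?_⟩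
      change g ∈ pointStabilizer none
      simp [mem_pointStabilizer, pointFrame, hm, hr]
    by_cases hx : ∃ x, x * x + (w - p) / r * x + -q / r = 0
    · obtain ⟨x, hx⟩ := hx
      refine ⟨Sum.inl (some x), mem_pointStabilizer_some hm ?_⟩
      field_simp at hx
      linear_combination hx
    · push Not at hx
      exact ⟨Sum.inr ⟨((w - p) / r, -q / r), hx⟩, mem_similitudes hm hr⟩

theorem coveringNumber_matTwo [Fintype F] {h n : F} (hs : IsSinger h n) (R : Finset F)
    (hR : ∀ r ∈ R, r ≠ 0 ∧ ∀ r' ∈ R, r + r' ≠ 0) {N : ℕ}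
    (hN : N = Fintype.card F * R.card + (Fintype.card F + 1))
    (hN' : Nat.card {x : F × F // ∀ y, y * y + x.1 * y + x.2 ≠ 0} = Fintype.card F * R.card) :
    coveringNumber (MatTwo F)ˣ = N := by
  refine le_antisymm ((coveringNumber_matTwo_le hs.two_ne).trans ?_) ?_
  · rw [Nat.card_sum, hN', hN, Nat.card_eq_fintype_card, Fintype.card_option, add_comm]
  · rw [hN]
    exact le_coveringNumber_matTwo hs R hR

end GeneralLinear

section GeneralLinear

open Matrix

theorem scalarTwo_pow {F : Type} [Field F] (h n : F) (k : ℕ) :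
    scalarTwo n h 1 ^ k = scalarTwo n
      ((fun z : F × F ↦ (z.1 * h + n * z.2, z.1 + z.2 * h))^[k] (1, 0)).1
      ((fun z : F × F ↦ (z.1 * h + n * z.2, z.1 + z.2 * h))^[k] (1, 0)).2 := by
  induction k with
  | zero =>
    ext i j
    fin_cases i <;> fin_cases j <;> simp [scalarTwo]
  | succ k ih =>
    rw [pow_succ, ih, scalarTwo_mul, Function.iterate_succ_apply']
    simp

/-- The first `m` powers of `h + √n`, starting from a given one. -/
def singerOrbit {F : Type} [Field F] (h n : F) : ℕ → F × F → List (F × F)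
  | 0, _ => []
  | m + 1, z => z :: singerOrbit h n m (z.1 * h + n * z.2, z.1 + z.2 * h)

theorem exists_iterate_of_mem_singerOrbit {F : Type} [Field F] {h n : F} {m : ℕ} {z y : F × F}
    (hy : y ∈ singerOrbit h n m z) :
    ∃ k, (fun z : F × F ↦ (z.1 * h + n * z.2, z.1 + z.2 * h))^[k] z = y := by
  induction m generalizing z with
  | zero => simp [singerOrbit] at hy
  | succ m ih =>
    rcases List.mem_cons.mp hy with rfl | hy
    · exact ⟨0, rfl⟩
    · obtain ⟨k, hk⟩ := ih hy
      exact ⟨k + 1, hk⟩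

theorem exists_pow_of_mem_singerOrbit {F : Type} [Field F] {h n : F} {m : ℕ}
    (H : ∀ z : F × F, z ≠ (0, 0) → z ∈ singerOrbit h n m (1, 0)) (x y : F)
    (hxy : ¬ (x = 0 ∧ y = 0)) : ∃ k : ℕ, scalarTwo n h 1 ^ k = scalarTwo n x y := by
  obtain ⟨k, hk⟩ := exists_iterate_of_mem_singerOrbit (H (x, y) (by simpa [Prod.ext_iff] using hxy))
  exact ⟨k, by rw [scalarTwo_pow, hk]⟩

theorem isSinger_zmod {p : ℕ} [Fact p.Prime] {h n : ZMod p} (h2 : (2 : ZMod p) ≠ 0) (h0 : h ≠ 0)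
    (hn : ∀ x, x * x ≠ n) {m : ℕ} 
    (H : ∀ z : ZMod p × ZMod p, z ≠ (0, 0) → z ∈ singerOrbit h n m (1, 0))
    (hd : ∀ x, x ≠ 0 → ∃ k : Fin m, (h * h - n) ^ k.val = x) (hd1 : 1 + (h * h - n) ≠ 0)
    (hc : ∀ c, c ≠ 0 → ∃ y k, n * (1 - n * (k * k)) * (y * y) = c) : IsSinger h n where
  two_ne := h2
  h_ne := h0
  not_square := hn
  gen := exists_pow_of_mem_singerOrbit H
  gen_det x hx := let ⟨k, hk⟩ := hd x hx; ⟨k, hk⟩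
  det_ne := hd1
  span c hc0 S hS := by
    obtain ⟨y, k, hy⟩ := hc c hc0
    have hy0 : y ≠ 0 := by
      rintro rfl
      exact hc0 (by simpa using hy.symm)
    rw [eq_top_iff]
    intro z _
    have h1 := S.nsmul_mem (hS y k hy) (z / y).val
    rwa [nsmul_eq_mul, ZMod.natCast_zmod_val, div_mul_cancel₀ _ hy0] at h1

instance : Fact (Nat.Prime 7) := ⟨by norm_num⟩

instance : Fact (Nat.Prime 11) := ⟨by norm_num⟩

instance : Fact (Nat.Prime 13) := ⟨by norm_num⟩

theorem exists_coveringNumber_eq_29 : ∃ (G : Type) (_ : Group G) (_ : Finite G),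
    coveringNumber G = (29 : ℕ) := by
  refine ⟨(MatTwo (ZMod 7))ˣ, inferInstance, inferInstance, ?_⟩
  have hs : IsSinger (F := ZMod 7) 1 3 := isSinger_zmod (m := 48) (by decide) (by decide)
    (by decide) (by decide) (by decide) (by decide) (by decide)
  refine coveringNumber_matTwo hs {1, 2, 3} (by decide) (by decide) ?_
  rw [Nat.card_eq_fintype_card]
  decide

theorem exists_coveringNumber_eq_67 : ∃ (G : Type) (_ : Group G) (_ : Finite G),
    coveringNumber G = (67 : ℕ) := by
  refine ⟨(MatTwo (ZMod 11))ˣ, inferInstance, inferInstance, ?_⟩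
  have hs : IsSinger (F := ZMod 11) 1 6 := isSinger_zmod (m := 120) (by decide) (by decide)
    (by decide) (by decide +kernel) (by decide +kernel) (by decide) (by decide +kernel)
  refine coveringNumber_matTwo hs {1, 2, 3, 4, 5} (by decide) (by decide) ?_
  rw [Nat.card_eq_fintype_card]
  decide +kernel

theorem exists_coveringNumber_eq_92 : ∃ (G : Type) (_ : Group G) (_ : Finite G),
    coveringNumber G = (92 : ℕ) := by
  refine ⟨(MatTwo (ZMod 13))ˣ, inferInstance, inferInstance, ?_⟩
  have hs : IsSinger (F := ZMod 13) 1 7 := isSinger_zmod (m := 168) (by decide) (by decide)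
    (by decide) (by decide +kernel) (by decide +kernel) (by decide) (by decide +kernel)
  refine coveringNumber_matTwo hs {1, 2, 3, 4, 5, 6} (by decide) (by decide) ?_
  rw [Nat.card_eq_fintype_card]
  decide +kernel

instance : Fact (∀ r : ZMod 3, r ^ 2 ≠ 2 + 0 * r) := ⟨by decide⟩

instance : Fintype (QuadraticAlgebra (ZMod 3) 2 0) :=
  Fintype.ofEquiv _ (QuadraticAlgebra.equivProd (2 : ZMod 3) 0).symm

theorem exists_coveringNumber_eq_46 : ∃ (G : Type) (_ : Group G) (_ : Finite G),
    coveringNumber G = (46 : ℕ) := by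
  refine ⟨(MatTwo (QuadraticAlgebra (ZMod 3) 2 0))ˣ, inferInstance, inferInstance, ?_⟩
  have hs : IsSinger (F := QuadraticAlgebra (ZMod 3) 2 0) ⟨0, 1⟩ ⟨1, 1⟩ := by
    refine ⟨by decide, by decide, by decide, exists_pow_of_mem_singerOrbit (m := 80) (by decide +kernel), ?_,
      by decide, ?_⟩
    · have : ∀ x : QuadraticAlgebra (ZMod 3) 2 0, x ≠ 0 → ∃ k : Fin 8,
        (⟨0, 1⟩ * ⟨0, 1⟩ - ⟨1, 1⟩ : QuadraticAlgebra (ZMod 3) 2 0) ^ k.val = x := by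
        decide +kernel
      intro x hx
      obtain ⟨k, hk⟩ := this x hx
      exact ⟨k, hk⟩
    · have : ∀ c : QuadraticAlgebra (ZMod 3) 2 0, c ≠ 0 → ∃ y₁ y₂ : QuadraticAlgebra (ZMod 3) 2 0,
          (∃ k, ⟨1, 1⟩ * (1 - ⟨1, 1⟩ * (k * k)) * (y₁ * y₁) = c) ∧
          (∃ k, ⟨1, 1⟩ * (1 - ⟨1, 1⟩ * (k * k)) * (y₂ * y₂) = c) ∧
          ∀ z, ∃ i j : Fin 3, i.val • y₁ + j.val • y₂ = z := by
        decide +kernel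
      intro c hc S hS
      obtain ⟨y₁, y₂, ⟨k₁, h₁⟩, ⟨k₂, h₂⟩, hz⟩ := this c hc
      rw [eq_top_iff]
      intro z _
      obtain ⟨i, j, rfl⟩ := hz z
      exact add_mem (nsmul_mem (hS _ _ h₁) _) (nsmul_mem (hS _ _ h₂) _)
  refine coveringNumber_matTwo hs {⟨1, 0⟩, ⟨0, 1⟩, ⟨1, 1⟩, ⟨1, 2⟩} (by decide) (by decide) ?_
  rw [Nat.card_eq_fintype_card]
  decide +kernel

end GeneralLinear

section FieldEight

/-- The multiplication of the field with eight elements; an element is the bit code of a polynomial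
in a root of `X³ + X + 1`. -/
def eightMul (a b : Fin 8) : Fin 8 :=
  (((if b.val.testBit 0 then [0, 1, 2, 3, 4, 5, 6, 7] else [0, 0, 0, 0, 0, 0, 0, 0])[a.val]! : Fin 8) ^^^
    ((if b.val.testBit 1 then [0, 2, 4, 6, 3, 1, 7, 5] else [0, 0, 0, 0, 0, 0, 0, 0])[a.val]! : Fin 8)) ^^^
    ((if b.val.testBit 2 then [0, 4, 3, 7, 6, 2, 5, 1] else [0, 0, 0, 0, 0, 0, 0, 0])[a.val]! : Fin 8)

/-- The field with eight elements. -/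
@[ext] structure FieldEight where
  /-- The bit code. -/
  code : Fin 8
deriving DecidableEq

namespace FieldEight

instance : Fintype FieldEight := Fintype.ofEquiv (Fin 8) ⟨fun a ↦ ⟨a⟩, fun a ↦ a.code, fun _ ↦ rfl, fun _ ↦ rfl⟩

instance : Add FieldEight := ⟨fun a b ↦ ⟨a.code ^^^ b.code⟩⟩
instance : Mul FieldEight := ⟨fun a b ↦ ⟨eightMul a.code b.code⟩⟩
instance : Zero FieldEight := ⟨⟨0⟩⟩
instance : One FieldEight := ⟨⟨1⟩⟩
instance : Neg FieldEight := ⟨fun a ↦ a⟩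
instance : Inv FieldEight := ⟨fun a ↦ ⟨[0, 1, 5, 6, 7, 2, 3, 4][a.code.val]!⟩⟩

instance : Field FieldEight where
  add_assoc := by decide +kernel
  zero_add := by decide +kernel
  add_zero := by decide +kernel
  add_comm := by decide +kernel
  mul_assoc := by decide +kernel
  one_mul := by decide +kernel
  mul_one := by decide +kernel
  mul_comm := by decide +kernel
  left_distrib := by decide +kernel
  right_distrib := by decide +kernel
  zero_mul := by decide +kernel
  mul_zero := by decide +kernel
  neg_add_cancel := by decide +kernel
  nsmul := nsmulRec
  zsmul := zsmulRec
  exists_pair_ne := ⟨0, 1, by decide⟩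
  mul_inv_cancel := by decide +kernel
  inv_zero := by decide
  nnqsmul := _
  nnqsmul_def := fun _ _ ↦ rfl
  qsmul := _
  qsmul_def := fun _ _ ↦ rfl

theorem two_eq_zero : (2 : FieldEight) = 0 := by decide +kernel

instance : CharP FieldEight 2 := CharTwo.of_one_ne_zero_of_two_eq_zero one_ne_zero two_eq_zero

end FieldEight

end FieldEight

section GeneralLinearEven

open Matrix

variable {F : Type} [Field F]

/-- Multiplication by `x + y ω` in the basis `1, ω`, where `ω² = ω + d` and `2 = 0`. -/
def scalarEven (d x y : F) : MatTwo F := !![x, d * y; y, x + y]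

/-- The root `ω` of `X² + X + d` is a primitive element of a quadratic extension of a finite field
of characteristic two. -/
structure IsSingerEven (d : F) : Prop where
  two_eq : (2 : F) = 0
  irreducible : ∀ x, x * x + x + d ≠ 0
  gen : ∀ x y, ¬ (x = 0 ∧ y = 0) → ∃ k : ℕ, scalarEven d 0 1 ^ k = scalarEven d x y
  gen_det : ∀ x, x ≠ 0 → ∃ k : ℕ, d ^ k = x
  det_ne : 1 + d ≠ 0
  sqrt : ∀ x : F, ∃ y, y * y = x
  span : ∀ (S : AddSubgroup F) (c : F), c ≠ 0 →
    (∀ x n, n * n = x * x + x + d → c / n ∈ S) → S = ⊤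

variable {K : Subgroup (MatTwo F)ˣ} {d : F}

theorem IsSingerEven.norm_ne (hs : IsSingerEven d) {x y : F} (h : ¬ (x = 0 ∧ y = 0)) :
    x * x + x * y + d * (y * y) ≠ 0 := by
  intro h0
  by_cases hy : y = 0
  · subst hy
    exact h ⟨by simpa using h0, rfl⟩
  · refine hs.irreducible (x / y) ?_
    field_simp
    linear_combination h0

theorem upper_mem_of_trace_eq_zero (hs : IsSingerEven d)
    (hT : ∀ x y, ¬ (x = 0 ∧ y = 0) → scalarEven d x y ∈ K.matrices) {A v₁ v₂ c : F}
    (hu : !![A, v₁ * v₁; v₂ * v₂, A] ∈ K.matrices) (hv : ¬ (v₁ = 0 ∧ v₂ = 0))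
    (hc : c * (A + v₁ * v₂) = v₁ * v₁ + v₁ * v₂ + d * (v₂ * v₂)) :
    !![1, c; 0, 1] ∈ K.matrices := by
  have h2 := hs.two_eq
  have hs0 : A + v₁ * v₂ ≠ 0 := by
    intro h0
    rw [h0, mul_zero] at hc
    exact hs.norm_ne hv hc.symm
  obtain ⟨s, hs'⟩ : ∃ s, s = A + v₁ * v₂ := ⟨_, rfl⟩
  rw [← hs'] at hs0 hc
  have hA : A = s - v₁ * v₂ := by linear_combination -hs'
  subst hA
  have h1 := hT v₁ v₂ hv
  have h3 := hT s 0 (by simp [hs0])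
  have h4 : !![s - v₁ * v₂, v₁ * v₁; v₂ * v₂, s - v₁ * v₂] * scalarEven d v₁ v₂ =
      scalarEven d s 0 * scalarEven d v₁ v₂ * !![1, c; 0, 1] := by
    ext i j
    fin_cases i <;> fin_cases j <;> simp [scalarEven, Matrix.mul_apply, Fin.sum_univ_two]
    · ring
    · linear_combination -v₁ * hc - d * v₁ * v₂ ^ 2 * h2
    · ring
    · grind
  obtain ⟨e, he, he'⟩ := mem_matrices.mp h1
  obtain ⟨t, ht, ht'⟩ := mem_matrices.mp h3
  have h5 := mul_mem (mul_mem (val_mem_matrices.mpr (K.inv_mem (K.mul_mem ht he))) hu) h1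
  rwa [mul_assoc, h4, ← he', ← ht', ← Units.val_mul, Units.inv_mul_cancel_left] at h5

/-- The upper elementary matrices of a subgroup. -/
def upperEntries (K : Subgroup (MatTwo F)ˣ) : AddSubgroup F where
  carrier := {y | !![1, y; 0, 1] ∈ K.matrices}
  zero_mem' := by
    change !![1, 0; 0, 1] ∈ K.matrices
    rw [← Matrix.one_fin_two]
    exact one_mem _
  add_mem' := by
    intro x y hx hy
    have : !![1, x + y; 0, 1] = !![1, x; 0, 1] * !![1, y; 0, 1] := by
      ext i j
      fin_cases i <;> fin_cases j <;> simp [Matrix.mul_apply, Fin.sum_univ_two]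
      ring
    change !![1, x + y; 0, 1] ∈ K.matrices
    rw [this]
    exact mul_mem hx hy
  neg_mem' := by
    intro x hx
    refine inv_mem_matrices hx ?_
    ext i j
    fin_cases i <;> fin_cases j <;> simp [Matrix.mul_apply, Fin.sum_univ_two]

theorem upper_mem_of_upper_mem (hs : IsSingerEven d)
    (hT : ∀ x y, ¬ (x = 0 ∧ y = 0) → scalarEven d x y ∈ K.matrices) {c : F}
    (hc : !![1, c; 0, 1] ∈ K.matrices) (hc0 : c * (c + 1) ≠ 0) (y : F) :
    !![1, y; 0, 1] ∈ K.matrices := by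
  have h2 := hs.two_eq
  suffices h : upperEntries K = ⊤ by
    have : y ∈ upperEntries K := h ▸ AddSubgroup.mem_top _
    exact this
  refine hs.span _ (c * (c + 1)) hc0 fun x n hn ↦ ?_
  have hn0 : n ≠ 0 := by
    rintro rfl
    exact hs.irreducible x (by linear_combination -hn)
  obtain ⟨v, hv⟩ := hs.sqrt (c * (c + 1))
  have hv0 : v ≠ 0 := by
    rintro rfl
    exact hc0 (by linear_combination -hv)
  have h1 := mul_mem (hT (c * c + x + 1) 1 (by simp)) (mul_mem (mul_mem hc (hT x 1 (by simp))) hc)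
  refine upper_mem_of_trace_eq_zero hs hT
    (A := (c * c + x + 1) * (x + c) + d) (v₁ := v * (n + x + c + 1)) (v₂ := v) ?_ (by simp [hv0]) ?_
  · convert h1 using 1
    ext i j
    fin_cases i <;> fin_cases j <;> simp [scalarEven, Matrix.mul_apply, Fin.sum_univ_two]
    · grind
    · grind
    · grind
  · field_simp
    grind

theorem eq_top_of_scalarEven (hs : IsSingerEven d) {a b : (MatTwo F)ˣ} (ha : a ∈ K)
    (hav : a.val = scalarEven d 0 1) (hb : b ∈ K) (htr : b.val.trace ≠ 0)
    (hc : a.val * b.val ≠ b.val * a.val) : K = ⊤ := by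
  have h2 := hs.two_eq
  have hT : ∀ x y, ¬ (x = 0 ∧ y = 0) → scalarEven d x y ∈ K.matrices := by
    intro x y hxy
    obtain ⟨k, hk⟩ := hs.gen x y hxy
    rw [← hk, ← hav]
    exact pow_mem (val_mem_matrices.mpr ha) k
  have hbK := val_mem_matrices.mpr hb
  obtain ⟨p, q, r, w, hm⟩ : ∃ p q r w, b.val = !![p, q; r, w] := ⟨_, _, _, _, b.val.eta_fin_two⟩
  rw [hm] at hbK htr hc
  rw [trace_fin_two_of] at htr
  obtain ⟨z₁, hz₁⟩ : ∃ z, z = d * r + q + w := ⟨_, rfl⟩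
  obtain ⟨z₂, hz₂⟩ : ∃ z, z = p + w := ⟨_, rfl⟩
  have hz : ¬ (z₁ = 0 ∧ z₂ = 0) := by
    rintro ⟨-, h0⟩
    exact htr (hz₂ ▸ h0)
  have h1 := mul_mem (hT z₁ z₂ hz) hbK
  obtain ⟨A, hA⟩ : ∃ A, A = z₁ * p + d * z₂ * r := ⟨_, rfl⟩
  obtain ⟨v₁, hv₁⟩ := hs.sqrt (z₁ * q + d * z₂ * w)
  obtain ⟨v₂, hv₂⟩ := hs.sqrt (z₂ * p + (z₁ + z₂) * r)
  have h3 : scalarEven d z₁ z₂ * !![p, q; r, w] = !![A, v₁ * v₁; v₂ * v₂, A] := by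
    rw [hv₁, hv₂, hA]
    ext i j
    fin_cases i <;> fin_cases j <;> simp [scalarEven, Matrix.mul_apply, Fin.sum_univ_two]
    grind
  have hv : ¬ (v₁ = 0 ∧ v₂ = 0) := by
    rintro ⟨h4, h5⟩
    refine hc ?_
    obtain ⟨e, -, he⟩ := mem_matrices.mp (hT z₁ z₂ hz)
    have h6 : !![A, v₁ * v₁; v₂ * v₂, A] = scalarEven d A 0 := by
      rw [h4, h5]
      ext i j
      fin_cases i <;> fin_cases j <;> simp [scalarEven]
    have h7 : ∀ x y x' y', scalarEven d x y * scalarEven d x' y' =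
        scalarEven d x' y' * scalarEven d x y := by
      intro x y x' y'
      ext i j
      fin_cases i <;> fin_cases j <;> simp [scalarEven, Matrix.mul_apply, Fin.sum_univ_two] <;> ring
    refine (Units.isUnit e).mul_left_cancel ?_
    rw [he, ← mul_assoc, ← mul_assoc, hav, h7, mul_assoc, h3, h6, h7]
  obtain ⟨c, hc'⟩ : ∃ c, c * (A + v₁ * v₂) = v₁ * v₁ + v₁ * v₂ + d * (v₂ * v₂) := by
    refine ⟨(v₁ * v₁ + v₁ * v₂ + d * (v₂ * v₂)) / (A + v₁ * v₂), div_mul_cancel₀ _ ?_⟩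
    have h8 := mul_ne_zero (unit_det_ne_zero b) (hs.norm_ne hz)
    rw [hm, det_fin_two_of] at h8
    intro h0
    refine h8 ?_
    have : (A + v₁ * v₂) * (A + v₁ * v₂) = 0 := by rw [h0, zero_mul]
    grind
  have hN := hs.norm_ne hv
  have hNz := hs.norm_ne hz
  have hU := upper_mem_of_trace_eq_zero hs hT (h3 ▸ h1) hv hc'
  have hUall := upper_mem_of_upper_mem hs hT hU (by
    refine mul_ne_zero ?_ ?_
    · rintro rfl
      exact hN (by linear_combination -hc')
    · intro h0
      have : c = 1 := by linear_combination h0 - h2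
      subst this
      exact hNz (by grind))
  refine (eq_top_or_triangular hs.gen_det hUall ha ?_).resolve_right fun h0 ↦ ?_
  · rw [hav, scalarEven, det_fin_two_of]
    linear_combination -d * h2
  · have := h0 a ha
    rw [hav] at this
    simp [scalarEven] at this

/-- Two non-commuting matrices, one with a primitive characteristic polynomial, generate. -/
theorem eq_top_of_singerEven (hs : IsSingerEven d) {a b : (MatTwo F)ˣ} (ha : a ∈ K)
    (hat : a.val.trace = 1) (had : a.val.det = d) (hb : b ∈ K)
    (htr : b.val.trace ≠ 0) (hc : a.val * b.val ≠ b.val * a.val) : K = ⊤ := by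
  have h2 := hs.two_eq
  obtain ⟨p, q, r, w, hm⟩ : ∃ p q r w, a.val = !![p, q; r, w] := ⟨_, _, _, _, a.val.eta_fin_two⟩
  rw [hm, trace_fin_two_of] at hat
  rw [hm, det_fin_two_of] at had
  have hr : r ≠ 0 := by
    rintro rfl
    exact hs.irreducible p (by grind)
  obtain ⟨P, hP⟩ := exists_unit (m := !![1, p; 0, r]) (by simpa using hr)
  have hPa : P.val * scalarEven d 0 1 = a.val * P.val := by
    rw [hP, hm]
    ext i j
    fin_cases i <;> fin_cases j <;> simp [scalarEven, Matrix.mul_apply, Fin.sum_univ_two] <;> grind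
  have h1 : K.comap (MulAut.conj P).toMonoidHom = ⊤ := by
    refine eq_top_of_scalarEven (a := P⁻¹ * a * P) (b := P⁻¹ * b * P) hs ?_ ?_ ?_ ?_ ?_
    · simpa [Subgroup.mem_comap, mul_assoc] using ha
    · rw [Units.val_mul, Units.val_mul, mul_assoc, ← hPa, Units.inv_mul_cancel_left]
    · simpa [Subgroup.mem_comap, mul_assoc] using hb
    · rwa [Units.val_mul, Matrix.trace_mul_comm, Units.val_mul, Units.mul_inv_cancel_left]
    · intro h0
      refine hc ?_
      rw [← Units.val_mul, ← Units.val_mul, Units.val_inj] at h0 ⊢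
      calc a * b = P * (P⁻¹ * a * P * (P⁻¹ * b * P)) * P⁻¹ := by group
        _ = b * a := by rw [h0]; group
  rw [eq_top_iff]
  intro g _
  have : P⁻¹ * g * P ∈ K.comap (MulAut.conj P).toMonoidHom := h1 ▸ Subgroup.mem_top _
  simpa [Subgroup.mem_comap, mul_assoc] using this

end GeneralLinearEven

section GeneralLinearEven

open Matrix

variable {F : Type} [Field F] {d : F}

theorem IsSingerEven.d_ne_zero (hs : IsSingerEven d) : d ≠ 0 := by
  simpa using hs.irreducible 0

/-- The matrices with trace `1`, determinant `d` and given first column. -/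
noncomputable def singerEvenUnit (hs : IsSingerEven d) (p : F) {r : F} (hr : r ≠ 0) :
    (MatTwo F)ˣ :=
  GeneralLinearGroup.mkOfDetNeZero !![p, (p * (1 - p) - d) / r; r, 1 - p] (by
    rw [det_fin_two_of, div_mul_cancel₀ _ hr, sub_sub_cancel]
    exact hs.d_ne_zero)

theorem singerEvenUnit_val (hs : IsSingerEven d) (p : F) {r : F} (hr : r ≠ 0) :
    (singerEvenUnit hs p hr).val = !![p, (p * (1 - p) - d) / r; r, 1 - p] := rfl

theorem singerEvenUnit_trace (hs : IsSingerEven d) (p : F) {r : F} (hr : r ≠ 0) :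
    (singerEvenUnit hs p hr).val.trace = 1 := by
  rw [singerEvenUnit_val, trace_fin_two_of]
  ring

theorem singerEvenUnit_det (hs : IsSingerEven d) (p : F) {r : F} (hr : r ≠ 0) :
    (singerEvenUnit hs p hr).val.det = d := by
  rw [singerEvenUnit_val, det_fin_two_of, div_mul_cancel₀ _ hr, sub_sub_cancel]

theorem singerEvenUnit_not_commute (hs : IsSingerEven d) {p p' r r' : F} (hr : r ≠ 0)
    (hr' : r' ≠ 0) (hpp : p + p' ≠ 1) (hne : ¬ (p = p' ∧ r = r')) :
    (singerEvenUnit hs p hr).val * (singerEvenUnit hs p' hr').val ≠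
      (singerEvenUnit hs p' hr').val * (singerEvenUnit hs p hr).val := by
  intro hc
  have h2 := hs.two_eq
  rw [singerEvenUnit_val, singerEvenUnit_val] at hc
  have h0 := congrFun (congrFun hc 0) 0
  have h1 := congrFun (congrFun hc 1) 0
  simp [Matrix.mul_apply, Fin.sum_univ_two] at h0 h1
  have e1 : r = r' := by grind
  subst e1
  have e0 : (p * (1 - p) - d) / r * r = (p' * (1 - p') - d) / r * r := by linear_combination h0
  rw [div_mul_cancel₀ _ hr, div_mul_cancel₀ _ hr] at e0
  have e2 : (p - p') * (p + p' - 1) = 0 := by linear_combination -e0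
  rcases mul_eq_zero.mp e2 with h3 | h3
  · exact hne ⟨sub_eq_zero.mp h3, rfl⟩
  · exact hpp (sub_eq_zero.mp h3)

theorem not_mem_of_singerEven_mem (hs : IsSingerEven d) {M : Subgroup (MatTwo F)ˣ}
    (hM : M ≠ ⊤) {a : (MatTwo F)ˣ} (hat : a.val.trace = 1) (had : a.val.det = d) (ha : a ∈ M)
    (P : (MatTwo F)ˣ) (x : F) : P * affineUnit x d hs.d_ne_zero * P⁻¹ ∉ M := by
  intro hb
  have h2 := hs.two_eq
  refine hM (eq_top_of_singerEven hs ha hat had hb ?_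
    (not_commute_affine (fun y h0 ↦ ?_) hs.d_ne_zero (Or.inr fun h0 ↦ ?_) P rfl))
  · rw [Units.val_mul, Matrix.trace_mul_comm, Units.val_mul, Units.inv_mul_cancel_left,
      affineUnit_val, trace_fin_two_of]
    exact hs.det_ne
  · rw [hat, had] at h0
    exact hs.irreducible y (by linear_combination h0 + y * h2)
  · exact hs.det_ne (by linear_combination h0 + h2)

/-- The members of a cover that contain no Singer cycle. -/
theorem exists_injective_affine_even (hs : IsSingerEven d) {S : Finset (Subgroup (MatTwo F)ˣ)}
    (hS : IsSubgroupCover S) : ∃ f : F → Subgroup (MatTwo F)ˣ, Function.Injective f ∧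
      ∀ j, f j ∈ S ∧ ∃ (P : (MatTwo F)ˣ) (x : F), P * affineUnit x d hs.d_ne_zero * P⁻¹ ∈ f j := by
  by_cases hcase : ∀ i : F, ∃ M ∈ S, ∃ x c : F, c ≠ 0 ∧
      pointFrame (some i) * affineUnit x d hs.d_ne_zero * (pointFrame (some i))⁻¹ ∈ M ∧
      pointFrame (some i) * affineUnit c 1 one_ne_zero * (pointFrame (some i))⁻¹ ∈ M
  · choose f hfS x c hc0 hx hc using hcase
    refine ⟨f, fun i j hij ↦ ?_, fun j ↦ ⟨hfS j, _, _, hx j⟩⟩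
    by_contra hne
    have hxj : affineUnit (x j) d hs.d_ne_zero ∈
      (f j).comap (MulAut.conj (pointFrame (some j))).toMonoidHom := hx j
    have hcj : affineUnit (c j) 1 one_ne_zero ∈
      (f j).comap (MulAut.conj (pointFrame (some j))).toMonoidHom := hc j
    have hU := upper_mem_of_nonzero hs.gen_det hs.d_ne_zero (val_mem_matrices.mpr hxj) (hc0 j)
        (val_mem_matrices.mpr hcj)
    rcases eq_top_or_triangular hs.gen_det hU hxj (by simp [affineUnit_val]) with h1 | h1
    · refine hS.1 _ (hfS j) ?_
      rw [eq_top_iff]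
      intro g _
      have : (pointFrame (some j))⁻¹ * g * pointFrame (some j) ∈
        (f j).comap (MulAut.conj (pointFrame (some j))).toMonoidHom := h1 ▸ Subgroup.mem_top _
      simpa [Subgroup.mem_comap, mul_assoc] using this
    · have h3 := hc i
      rw [hij] at h3
      have h4 := h1 ((pointFrame (some j))⁻¹ * (pointFrame (some i) *
        affineUnit (c i) 1 one_ne_zero * (pointFrame (some i))⁻¹) * pointFrame (some j))
        (by simpa [Subgroup.mem_comap, mul_assoc] using h3)
      have hne' : some i ≠ some j := fun h ↦ hne (Option.some.inj h)
      refine lower_ne_zero_of_conj (pointFrame_inv_mul hne') (hc0 i) ?_ h4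
      group
  · push Not at hcase
    obtain ⟨i, hi⟩ := hcase
    choose f hfS hfm using fun x ↦
      hS.2 (pointFrame (some i) * affineUnit x d hs.d_ne_zero * (pointFrame (some i))⁻¹)
    refine ⟨f, fun x y hxy ↦ ?_, fun j ↦ ⟨hfS j, _, _, hfm j⟩⟩
    by_contra hne
    have hx := hfm x
    have hy := hfm y
    rw [hxy] at hx
    refine hi _ (hfS y) x (y - x) (fun h0 ↦ hne (sub_eq_zero.mp h0).symm) hx ?_
    have e : affineUnit y d hs.d_ne_zero =
        affineUnit x d hs.d_ne_zero * affineUnit (y - x) 1 one_ne_zero := by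
      apply Units.ext
      rw [Units.val_mul, affineUnit_val, affineUnit_val, affineUnit_val]
      ext i j
      fin_cases i <;> fin_cases j <;> simp [Matrix.mul_apply, Fin.sum_univ_two]
    have := mul_mem (inv_mem hx) hy
    rw [e] at this
    convert this using 1
    group

theorem le_coveringNumber_matTwo_even [Fintype F] [DecidableEq F] (hs : IsSingerEven d)
    (R : Finset F) (hR : ∀ p ∈ R, ∀ p' ∈ R, p + p' ≠ 1) :
    ((R.card * Fintype.card {r : F // r ≠ 0} + Fintype.card F : ℕ) : ℕ∞) ≤
      coveringNumber (MatTwo F)ˣ := by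
  refine le_coveringNumber fun S hS ↦ ?_
  obtain ⟨f, hf, hfS⟩ := exists_injective_affine_even hs hS
  choose g hgS hgm using fun x : R × {r : F // r ≠ 0} ↦ hS.2 (singerEvenUnit hs x.1 x.2.2)
  have hg : Function.Injective g := by
    intro x y hxy
    by_contra hne
    have h1 := hgm x
    rw [hxy] at h1
    refine hS.1 _ (hgS y) (eq_top_of_singerEven hs h1 (singerEvenUnit_trace ..)
      (singerEvenUnit_det ..) (hgm y) ?_
      (singerEvenUnit_not_commute hs _ _ (hR _ x.1.2 _ y.1.2) fun h2 ↦ hne ?_))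
    · rw [singerEvenUnit_trace]
      exact one_ne_zero
    · exact Prod.ext (Subtype.ext h2.1) (Subtype.ext h2.2)
  have hfg : Function.Injective (Sum.elim g f) := by
    refine hg.sumElim hf fun x j hxj ↦ ?_
    obtain ⟨hj, P, y, hm⟩ := hfS j
    rw [← hxj] at hm
    exact not_mem_of_singerEven_mem hs (hS.1 _ (hgS x)) (singerEvenUnit_trace ..)
      (singerEvenUnit_det ..) (hgm x) P y hm
  have hmem : ∀ s : (R × {r : F // r ≠ 0}) ⊕ F, Sum.elim g f s ∈ S := by
    rintro (x | j)
    · exact hgS x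
    · exact (hfS j).1
  have := Fintype.card_le_of_injective (fun s ↦ (⟨_, hmem s⟩ : S))
    fun s t hst ↦ hfg (congrArg Subtype.val hst)
  simpa only [Fintype.card_sum, Fintype.card_prod, Fintype.card_coe] using this

theorem IsSingerEven.similitudes_ne_top (hs : IsSingerEven d) (b c : F) : similitudes b c ≠ ⊤ := by
  have h2 := hs.two_eq
  obtain ⟨x, hx0, hxb⟩ : ∃ x, x ≠ 0 ∧ x + b ≠ 0 := by
    by_cases hb : 1 + b = 0
    · refine ⟨d, hs.d_ne_zero, fun h0 ↦ hs.det_ne ?_⟩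
      linear_combination h0 - hb + h2
    · exact ⟨1, one_ne_zero, hb⟩
  intro h
  have h1 : affineUnit x 1 one_ne_zero ∈ similitudes b c := h ▸ Subgroup.mem_top _
  obtain ⟨l, hl, hv⟩ := h1
  rw [affineUnit_val] at hv
  have e1 := hv ![1, 0]
  have e2 := hv ![0, 1]
  simp [Matrix.mulVec, dotProduct, Fin.sum_univ_two] at e1 e2
  rw [← e1] at e2
  exact mul_ne_zero hx0 hxb (by linear_combination e2)

theorem coveringNumber_matTwo_even_le [Fintype F] (hs : IsSingerEven d) :
    coveringNumber (MatTwo F)ˣ ≤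
      ((Nat.card (F ⊕ {x : F × F // ∀ y, y * y + x.1 * y + x.2 ≠ 0}) : ℕ) : ℕ∞) := by
  have h2 := hs.two_eq
  refine coveringNumber_le_of_family
    (Sum.elim (fun x ↦ pointStabilizer (some x)) fun x ↦ similitudes x.1.1 x.1.2) ?_ ?_
  · rintro (i | x)
    · exact pointStabilizer_ne_top (some i)
    · exact hs.similitudes_ne_top _ _
  · intro g
    obtain ⟨p, q, r, w, hm⟩ : ∃ p q r w, g.val = !![p, q; r, w] := ⟨_, _, _, _, g.val.eta_fin_two⟩
    by_cases hr : r = 0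
    · by_cases hpw : w - p = 0
      · by_cases hq : q = 0
        · exact ⟨Sum.inl 0, mem_pointStabilizer_some hm (by rw [hr, hpw, hq]; ring)⟩
        · have hd := unit_det_ne_zero g
          rw [hm, det_fin_two_of, hr, mul_zero, sub_zero] at hd
          have hp : p ≠ 0 := left_ne_zero_of_mul hd
          refine ⟨Sum.inr ⟨(q / p, (q / p) * (q / p) * d), fun y hy ↦ ?_⟩, p * p,
            mul_ne_zero hp hp, fun v ↦ ?_⟩
          · refine hs.irreducible (y * p / q) ?_
            field_simp at hy ⊢
            linear_combination hy
          · rw [hm, hr, sub_eq_zero.mp hpw]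
            simp [Matrix.mulVec, dotProduct, Fin.sum_univ_two]
            field_simp
            linear_combination (p * q * v 0 * v 1 + q ^ 2 * v 1 ^ 2) * h2
      · refine ⟨Sum.inl (q / (w - p)), mem_pointStabilizer_some hm ?_⟩
        rw [hr]
        field_simp
        ring
    by_cases hx : ∃ x, x * x + (w - p) / r * x + -q / r = 0
    · obtain ⟨x, hx⟩ := hx
      refine ⟨Sum.inl x, mem_pointStabilizer_some hm ?_⟩
      field_simp at hx
      linear_combination hx
    · push Not at hx
      exact ⟨Sum.inr ⟨((w - p) / r, -q / r), hx⟩, mem_similitudes hm hr⟩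

/-- The first `m` powers of `ω`, starting from a given one. -/
def singerEvenOrbit (d : F) : ℕ → F × F → List (F × F)
  | 0, _ => []
  | m + 1, z => z :: singerEvenOrbit d m (d * z.2, z.1 + z.2)

theorem exists_pow_of_mem_singerEvenOrbit {m : ℕ} {z y : F × F}
    (hy : y ∈ singerEvenOrbit d m z) :
    ∃ k, scalarEven d 0 1 ^ k * scalarEven d z.1 z.2 = scalarEven d y.1 y.2 := by
  induction m generalizing z with
  | zero => simp [singerEvenOrbit] at hy
  | succ m ih =>
    rcases List.mem_cons.mp hy with rfl | hy
    · exact ⟨0, by rw [pow_zero, one_mul]⟩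
    · obtain ⟨k, hk⟩ := ih hy
      refine ⟨k + 1, ?_⟩
      rw [← hk, pow_succ, mul_assoc]
      congr 1
      ext i j
      fin_cases i <;> fin_cases j <;> simp [scalarEven, Matrix.mul_apply, Fin.sum_univ_two]

theorem isSingerEven_fieldEight : IsSingerEven (⟨3⟩ : FieldEight) where
  two_eq := FieldEight.two_eq_zero
  irreducible := by decide +kernel
  gen x y hxy := by
    have h : ∀ z : FieldEight × FieldEight, z ≠ (0, 0) →
      z ∈ singerEvenOrbit ⟨3⟩ 63 (1, 0) := by decide +kernel
    obtain ⟨k, hk⟩ := exists_pow_of_mem_singerEvenOrbit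
      (h (x, y) (by simpa [Prod.ext_iff] using hxy))
    have h1 : scalarEven (⟨3⟩ : FieldEight) 1 0 = 1 := by
      ext i j
      fin_cases i <;> fin_cases j <;> simp [scalarEven]
    change _ * scalarEven _ 1 0 = _ at hk
    rw [h1, mul_one] at hk
    exact ⟨k, hk⟩
  gen_det x hx := by
    have h : ∀ x : FieldEight, x ≠ 0 → ∃ k : Fin 7, (⟨3⟩ : FieldEight) ^ k.val = x := by
      decide +kernel
    obtain ⟨k, hk⟩ := h x hx
    exact ⟨k, hk⟩
  det_ne := by decide +kernel
  sqrt := by decide +kernel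
  span S c hc hS := by
    have h : ∀ z : FieldEight, ∃ a₁ a₂ a₃ : Fin 2, z = a₁.val • (1 / ⟨7⟩) + a₂.val • (1 / ⟨3⟩) +
      a₃.val • (1 / ⟨1⟩) := by decide +kernel
    rw [eq_top_iff]
    intro z _
    obtain ⟨a₁, a₂, a₃, hz⟩ := h (z / c)
    have hz' : z = a₁.val • (c / ⟨7⟩) + a₂.val • (c / ⟨3⟩) + a₃.val • (c / ⟨1⟩) := by
      simp only [nsmul_eq_mul] at hz ⊢
      rw [div_eq_iff hc] at hz
      rw [hz]
      ring
    rw [hz']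
    exact add_mem (add_mem (nsmul_mem (hS ⟨0⟩ _ (by decide +kernel)) _)
      (nsmul_mem (hS ⟨2⟩ _ (by decide +kernel)) _)) (nsmul_mem (hS ⟨4⟩ _ (by decide +kernel)) _)

theorem exists_coveringNumber_eq_36 : ∃ (G : Type) (_ : Group G) (_ : Finite G),
    coveringNumber G = (36 : ℕ) := by
  refine ⟨(MatTwo FieldEight)ˣ, inferInstance, inferInstance, le_antisymm
    ((coveringNumber_matTwo_even_le isSingerEven_fieldEight).trans ?_)
    ((Nat.cast_le.mpr ?_).trans (le_coveringNumber_matTwo_even isSingerEven_fieldEight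
      {⟨0⟩, ⟨2⟩, ⟨4⟩, ⟨6⟩} (by decide +kernel)))⟩
  · rw [Nat.card_eq_fintype_card, Nat.cast_le]
    decide +kernel
  · decide +kernel

end GeneralLinearEven

/-- The multiplication of the alternating group of degree five: `12 * i + h` is the code of the
product of the `i`-th power of a fixed 5-cycle and the `h`-th permutation that fixes the last
point. -/
def altMul (a b : ℕ) : ℕ :=
  let t := 864504960046500011599965753042100225595619391307582816427486090737671761351320614966005647750181111626564352 >>> (6 * (5 * (a % 12) + b / 12)) % 64
  12 * ((a / 12 + t / 12) % 5) +
    1099246228769001890931082562126702001558018722078822917734316235188111912971129222491798936609133464225093121906702645793607206164188692679327496667199353807173393975620112 >>>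
      (4 * (12 * (t % 12) + b % 12)) % 16

/-- The inversion of the alternating group of degree five. -/
def altInv (a : ℕ) : ℕ :=
  2191111745982421187261832404669584053351801030674569268854903281713192666405412438456144882118011758177947776 >>>
    (6 * a) % 64

/-- The action of the alternating group of degree five on the five points. -/
def altFive (a p : ℕ) : ℕ :=
  (770154380750907492594106544533235401846094443443668616 >>> (3 * (5 * (a % 12) + p)) % 8 + a / 12) % 5

/-- The action of the alternating group of degree five on its six Sylow 5-subgroups. -/
def altSix (a p : ℕ) : ℕ :=
  let q := 69831570955770099686759870812947094622374150222819071492516136584 >>> (3 * (6 * (a % 12) + p)) % 8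
  if q = 5 then 5 else (q + a / 12) % 5

/-- The alternating group of degree five. -/
@[ext] structure AltFive where
  /-- The code of an element. -/
  code : Fin 60
deriving DecidableEq

namespace AltFive

instance : Fintype AltFive :=
  Fintype.ofEquiv (Fin 60) ⟨fun a ↦ ⟨a⟩, fun a ↦ a.code, fun _ ↦ rfl, fun _ ↦ rfl⟩

instance : Mul AltFive := ⟨fun a b ↦ ⟨Fin.ofNat 60 (altMul a.code.val b.code.val)⟩⟩
instance : One AltFive := ⟨⟨0⟩⟩
instance : Inv AltFive := ⟨fun a ↦ ⟨Fin.ofNat 60 (altInv a.code.val)⟩⟩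

/-- The action on five points. -/
def five (a : AltFive) (p : Fin 5) : Fin 5 := Fin.ofNat 5 (altFive a.code.val p.val)

/-- The action on the six Sylow 5-subgroups. -/
def six (a : AltFive) (p : Fin 6) : Fin 6 := Fin.ofNat 6 (altSix a.code.val p.val)

theorem five_mul : ∀ (a b : AltFive) (p : Fin 5), five (a * b) p = five a (five b p) := by
  decide +kernel

theorem six_mul : ∀ (a b : AltFive) (p : Fin 6), six (a * b) p = six a (six b p) := by
  decide +kernel

theorem five_injective : ∀ a b : AltFive, (∀ p, five a p = five b p) → a = b := by
  decide +kernel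

theorem one_five : ∀ p : Fin 5, five 1 p = p := by decide +kernel

theorem one_six : ∀ p : Fin 6, six 1 p = p := by decide +kernel

instance : Group AltFive :=
  Group.ofLeftAxioms
    (fun a b c ↦ five_injective _ _ fun p ↦ by simp only [five_mul])
    (fun a ↦ five_injective _ _ fun p ↦ by rw [five_mul, one_five])
    (by decide +kernel)

/-- The permutation action on five points. -/
def fiveHom : AltFive →* Equiv.Perm (Fin 5) :=
  MonoidHom.toHomPerm ⟨⟨five, funext one_five⟩, fun a b ↦ funext (five_mul a b)⟩

/-- The permutation action on the six Sylow 5-subgroups. -/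
def sixHom : AltFive →* Equiv.Perm (Fin 6) :=
  MonoidHom.toHomPerm ⟨⟨six, funext one_six⟩, fun a b ↦ funext (six_mul a b)⟩

end AltFive

namespace AltFive

/-- The order of an element. -/
def order (a : AltFive) : ℕ := 519811141923860406345822240284741110820986820821365977 >>> (3 * a.code.val) % 8

theorem pow_order : ∀ a : AltFive, a ^ a.order = 1 := by decide +kernel

theorem order_mem : ∀ a : AltFive, a.order = 1 ∧ a = 1 ∨ a ≠ 1 ∧ a.order ∈ [2, 3, 5] := by
  decide +kernel

theorem orderOf_eq (a : AltFive) : orderOf a = a.order := by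
  have h1 := orderOf_dvd_of_pow_eq_one (pow_order a)
  rcases order_mem a with ⟨h, rfl⟩ | ⟨ha, h⟩
  · rw [h, orderOf_one]
  · refine ((Nat.dvd_prime ?_).mp h1).resolve_left fun h ↦ ha (orderOf_eq_one_iff.mp h)
    simp only [List.mem_cons, List.not_mem_nil, or_false] at h
    rcases h with h | h | h <;> rw [h] <;> norm_num

theorem exists_order_of_six_ne : ∀ c : AltFive, c.order = 5 → ∀ p, six c p = p → ∀ k,
    six k p ≠ p →
    (∃ i : Fin 5, (c ^ i.val * k).order = 2) ∧ ∃ i : Fin 5, (c ^ i.val * k).order = 3 := by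
  decide +kernel

theorem exists_order_of_five_ne : ∀ c : AltFive, c.order = 3 → ∀ p, five c p = p →
    ∀ d : AltFive, d.order = 3 ∧ d ≠ c ∧ d ≠ c * c ∧ five d p = p → ∀ k, five k p ≠ p →
    k.order = 5 ∨ (k * c).order = 5 ∨ (k * d).order = 5 ∨ (k * (c * d)).order = 5 ∨
      (k * (d * c)).order = 5 ∨ (k * (c * c)).order = 5 ∨ (k * (d * d)).order = 5 := by
  decide +kernel

theorem order_mul_of_disjoint : ∀ c : AltFive, c.order = 3 → ∀ d : AltFive, d.order = 3 →
    (∃ p, five c p = p ∧ five d p = p) ∨ (c * d).order = 5 := by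
  decide +kernel

theorem six_ne_of_order : ∀ c : AltFive, c.order = 3 → ∀ p, six c p ≠ p := by decide +kernel

theorem exists_six_eq : ∀ c : AltFive, c.order ≠ 3 → ∃ p, six c p = p := by decide +kernel

theorem exists_six_conj_ne : ∀ c : AltFive, c.order = 5 → ∀ p, six c p = p →
    ∃ a, six (a * c * a⁻¹) p ≠ p := by
  decide +kernel

theorem exists_order_mul_conj : ∀ n : AltFive, n ≠ 1 → ∃ a, (n * (a * n * a⁻¹)).order = 5 := by
  decide +kernel

theorem exists_sq_mul_sq : ∀ a : AltFive, ∃ b c : AltFive, a = b * b * (c * c) := by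
  decide +kernel

theorem eq_of_commute_of_order : ∀ c : AltFive, c.order = 3 → ∀ b, b * c = c * b →
    b = 1 ∨ b = c ∨ b = c * c := by
  decide +kernel

theorem eq_one_of_commute : ∀ a : AltFive, (∀ b, a * b = b * a) → a = 1 := by decide +kernel

theorem exists_order_two : ∀ z : AltFive, z.order = 5 → ∃ t, (t.order = 2 ∧ (z * t).order = 3) ∧
    (∀ p, six z p = p → six t p ≠ p) ∧ ∀ s, s.order = 2 ∧ (z * s).order = 3 → ∃ k : Fin 5,
      z ^ k.val * s = t * z ^ k.val ∧
        (z ^ k.val * (z ^ k.val * t) = t * (z ^ k.val * z ^ k.val) → k = 0) := by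
  decide +kernel

theorem card_eq : Nat.card AltFive = 60 := by
  rw [Nat.card_eq_fintype_card]
  decide +kernel

variable {K : Subgroup AltFive}

theorem order_dvd_card {a : AltFive} (ha : a ∈ K) : a.order ∣ Nat.card K := by
  rw [← orderOf_eq, ← Subgroup.orderOf_mk a ha]
  exact orderOf_dvd_natCard _

theorem eq_top_of_order {a b c : AltFive} (ha : a ∈ K) (hb : b ∈ K) (hc : c ∈ K)
    (ha2 : a.order = 2) (hb3 : b.order = 3) (hc5 : c.order = 5) : K = ⊤ := by
  have h2 := ha2 ▸ order_dvd_card ha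
  have h3 := hb3 ▸ order_dvd_card hb
  have h5 := hc5 ▸ order_dvd_card hc
  have h30 : 30 ∣ Nat.card K := by omega
  have h60 := card_eq ▸ K.card_mul_index
  obtain ⟨n, hn⟩ := h30
  rw [hn] at h60
  have hi : K.index = 1 ∨ K.index = 2 := by
    have : n * K.index = 2 := by linarith
    exact (Nat.dvd_prime Nat.prime_two).mp (Dvd.intro_left _ this)
  rcases hi with hi | hi
  · exact Subgroup.index_eq_one.mp hi
  · refine eq_top_iff.mpr fun x _ ↦ ?_
    obtain ⟨b, c, rfl⟩ := exists_sq_mul_sq x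
    exact mul_mem (Subgroup.mul_self_mem_of_index_two hi b)
      (Subgroup.mul_self_mem_of_index_two hi c)

theorem six_eq_of_mem (hK : K ≠ ⊤) {c k : AltFive} (hc : c ∈ K) (hc5 : c.order = 5) {p : Fin 6}
    (hp : six c p = p) (hk : k ∈ K) : six k p = p := by
  by_contra h
  obtain ⟨⟨i, hi⟩, j, hj⟩ := exists_order_of_six_ne c hc5 p hp k h
  exact hK (eq_top_of_order (mul_mem (pow_mem hc _) hk) (mul_mem (pow_mem hc _) hk) hc hi hj hc5)

theorem order_ne_of_mem (hK : K ≠ ⊤) {c k : AltFive} (hc : c ∈ K) (hc3 : c.order = 3)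
    (hk : k ∈ K) : k.order ≠ 5 := fun h ↦ by
  obtain ⟨p, hp⟩ := exists_six_eq k (by omega)
  exact six_ne_of_order c hc3 p (six_eq_of_mem hK hk h hp hc)

theorem five_eq_of_mem (hK : K ≠ ⊤) {c d : AltFive} (hc : c ∈ K) (hc3 : c.order = 3) (hd : d ∈ K)
    (hd3 : d.order = 3) (h : ¬ (d = c ∨ d = c * c)) : ∃ p, ∀ k ∈ K, five k p = p := by
  push Not at h
  have hn {k} := order_ne_of_mem hK hc hc3 (k := k)
  obtain ⟨p, hcp, hdp⟩ := (order_mul_of_disjoint c hc3 d hd3).resolve_right (hn (mul_mem hc hd))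
  refine ⟨p, fun k hk ↦ ?_⟩
  by_contra hkp
  rcases exists_order_of_five_ne c hc3 p hcp d ⟨hd3, h.1, h.2, hdp⟩ k hkp with
    h | h | h | h | h | h | h
  · exact hn hk h
  · exact hn (mul_mem hk hc) h
  · exact hn (mul_mem hk hd) h
  · exact hn (mul_mem hk (mul_mem hc hd)) h
  · exact hn (mul_mem hk (mul_mem hd hc)) h
  · exact hn (mul_mem hk (mul_mem hc hc)) h
  · exact hn (mul_mem hk (mul_mem hd hd)) h

theorem eq_top_of_conj_mem (hK : ∀ a, ∀ b ∈ K, a * b * a⁻¹ ∈ K) {n : AltFive} (hn : n ∈ K)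
    (hn1 : n ≠ 1) : K = ⊤ := by
  by_contra h
  obtain ⟨a, ha⟩ := exists_order_mul_conj n hn1
  have hc := mul_mem hn (hK a n hn)
  obtain ⟨p, hp⟩ := exists_six_eq (n * (a * n * a⁻¹)) (by omega)
  obtain ⟨b, hb⟩ := exists_six_conj_ne _ ha p hp
  exact hb (six_eq_of_mem h hc ha hp (hK b _ hc))

/-- An involutory automorphism fixing an element of order five is trivial. -/
theorem eq_id_of_involutive (φ : AltFive →* AltFive) (hφ : ∀ a, φ (φ a) = a) {z : AltFive}
    (hz : z.order = 5) (hφz : φ z = z) (a : AltFive) : φ a = a := by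
  have hinj : Function.Injective φ := fun a b h ↦ by rw [← hφ a, h, hφ]
  have ho (a) : (φ a).order = a.order := by
    rw [← orderOf_eq, ← orderOf_eq, orderOf_injective φ hinj]
  obtain ⟨t, ⟨ht2, ht3⟩, htp, ht⟩ := exists_order_two z hz
  obtain ⟨k, hk, hk0⟩ := ht (φ t) ⟨by rw [ho, ht2], by rw [← ht3, ← ho (z * t), map_mul, hφz]⟩
  have h1 := congrArg φ hk
  simp only [map_mul, map_pow, hφz, hφ] at h1
  have h2 := hk0 (by rw [h1, ← mul_assoc, hk, mul_assoc])
  rw [h2, Fin.val_zero, pow_zero, one_mul, mul_one] at hk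
  have htop : φ.eqLocus (MonoidHom.id _) = ⊤ := by
    by_contra h
    obtain ⟨p, hp⟩ := exists_six_eq z (by omega)
    exact htp p hp (six_eq_of_mem h (show z ∈ φ.eqLocus (MonoidHom.id _) from hφz) hz hp hk)
  exact (htop ▸ Subgroup.mem_top a : a ∈ φ.eqLocus (MonoidHom.id _))

end AltFive

/-- The wreath product of a group with the group of order two; `swap` tells whether the two factors
are interchanged. -/
@[ext] structure WreathTwo (A : Type*) where
  /-- The first component. -/
  fst : A
  /-- The second component. -/
  snd : A
  /-- Whether the factors are interchanged. -/
  swap : Bool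
deriving DecidableEq

namespace WreathTwo

variable {A : Type*} [Group A]

instance : Mul (WreathTwo A) :=
  ⟨fun a b ↦ ⟨a.fst * bif a.swap then b.snd else b.fst, a.snd * bif a.swap then b.fst else b.snd,
    a.swap ^^ b.swap⟩⟩

instance : One (WreathTwo A) := ⟨⟨1, 1, false⟩⟩

instance : Inv (WreathTwo A) :=
  ⟨fun a ↦ ⟨bif a.swap then a.snd⁻¹ else a.fst⁻¹, bif a.swap then a.fst⁻¹ else a.snd⁻¹, a.swap⟩⟩

theorem mul_def (a b : WreathTwo A) :
    a * b = ⟨a.fst * bif a.swap then b.snd else b.fst, a.snd * bif a.swap then b.fst else b.snd,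
      a.swap ^^ b.swap⟩ := rfl

theorem one_def : (1 : WreathTwo A) = ⟨1, 1, false⟩ := rfl

theorem inv_def (a : WreathTwo A) :
    a⁻¹ = ⟨bif a.swap then a.snd⁻¹ else a.fst⁻¹, bif a.swap then a.fst⁻¹ else a.snd⁻¹, a.swap⟩ :=
  rfl

instance : Group (WreathTwo A) :=
  Group.ofLeftAxioms
    (by
      rintro ⟨x, y, _ | _⟩ ⟨x', y', _ | _⟩ ⟨x'', y'', _ | _⟩ <;> simp [mul_def, mul_assoc])
    (by rintro ⟨x, y, _ | _⟩ <;> simp [mul_def, one_def])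
    (by rintro ⟨x, y, _ | _⟩ <;> simp [mul_def, one_def, inv_def])

instance [Finite A] : Finite (WreathTwo A) :=
  Finite.of_injective (β := A × A × Bool) (fun a ↦ (a.fst, a.snd, a.swap)) fun a b h ↦ by
    simpa [WreathTwo.ext_iff] using h

/-- The base group. -/
def base (A : Type*) [Group A] : Subgroup (WreathTwo A) where
  carrier := {a | a.swap = false}
  one_mem' := rfl
  mul_mem' {a b} ha hb := by
    change (a.swap ^^ b.swap) = false
    rw [show a.swap = false from ha, show b.swap = false from hb]
    rfl
  inv_mem' h := h

/-- The stabilizer of a pair of points, one for each factor. -/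
def cell {Ω : Type*} (ρ : A →* Equiv.Perm Ω) (p q : Ω) : Subgroup (WreathTwo A) where
  carrier := {a | ρ a.fst (bif a.swap then q else p) = p ∧ ρ a.snd (bif a.swap then p else q) = q}
  one_mem' := by simp [one_def]
  mul_mem' := by
    rintro ⟨x, y, _ | _⟩ ⟨x', y', _ | _⟩ h h' <;> simp_all [mul_def]
  inv_mem' := by
    rintro ⟨x, y, _ | _⟩ h <;> simp_all [inv_def, Equiv.symm_apply_eq]

/-- The projection of a subgroup's intersection with the base group to the first factor. -/
def proj (M : Subgroup (WreathTwo A)) : Subgroup A where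
  carrier := {a | ∃ b, (⟨a, b, false⟩ : WreathTwo A) ∈ M}
  one_mem' := ⟨1, one_mem M⟩
  mul_mem' := by
    rintro a b ⟨a', ha⟩ ⟨b', hb⟩
    exact ⟨_, mul_mem ha hb⟩
  inv_mem' := by
    rintro a ⟨a', ha⟩
    exact ⟨_, inv_mem ha⟩

/-- The elements of the first factor in a subgroup. -/
def core (M : Subgroup (WreathTwo A)) : Subgroup A where
  carrier := {a | (⟨a, 1, false⟩ : WreathTwo A) ∈ M}
  one_mem' := one_mem M
  mul_mem' {a b} (ha : ⟨a, 1, false⟩ ∈ M) (hb : ⟨b, 1, false⟩ ∈ M) := by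
    simpa [mul_def] using mul_mem ha hb
  inv_mem' {a} (ha : ⟨a, 1, false⟩ ∈ M) := by simpa [inv_def] using inv_mem ha

variable {M : Subgroup (WreathTwo A)}

theorem mem_proj_of_swap {x y x' y' : A} (h : ⟨x, y, true⟩ ∈ M) (h' : ⟨x', y', true⟩ ∈ M) :
    x' * x⁻¹ ∈ proj M :=
  ⟨y' * y⁻¹, by simpa [mul_def, inv_def] using mul_mem h' (inv_mem h)⟩

theorem conj_mem_core {a b : A} (ha : a ∈ proj M) (hb : b ∈ core M) : a * b * a⁻¹ ∈ core M := by
  obtain ⟨a', ha⟩ := ha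
  change ⟨b, 1, false⟩ ∈ M at hb
  change ⟨a * b * a⁻¹, 1, false⟩ ∈ M
  simpa [mul_def, inv_def] using mul_mem (mul_mem ha hb) (inv_mem ha)

theorem eq_top_of_core_eq_top (hM : core M = ⊤) {x y : A} (h : ⟨x, y, true⟩ ∈ M) : M = ⊤ := by
  have h1 (a : A) : (⟨a, 1, false⟩ : WreathTwo A) ∈ M := (hM ▸ Subgroup.mem_top a : a ∈ core M)
  have h2 (a : A) : (⟨1, a, false⟩ : WreathTwo A) ∈ M := by
    simpa [mul_def, inv_def, mul_assoc] using
      mul_mem (mul_mem h (h1 (y⁻¹ * a * y))) (inv_mem h)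
  refine eq_top_iff.mpr ?_
  rintro ⟨a, b, _ | _⟩ -
  · simpa [mul_def] using mul_mem (h1 a) (h2 b)
  · simpa [mul_def] using mul_mem (mul_mem (h1 (a * x⁻¹)) (h2 (b * y⁻¹))) h

/-- A subgroup that projects onto the first factor and meets it trivially is the graph of a
homomorphism. -/
theorem exists_hom (hp : proj M = ⊤) (hc : core M = ⊥) {x y : A} (h : ⟨x, y, true⟩ ∈ M) :
    ∃ φ : A →* A, ∀ a b, (⟨a, b, false⟩ : WreathTwo A) ∈ M ↔ b = φ a := by
  have h1 (b : A) (hb : (⟨1, b, false⟩ : WreathTwo A) ∈ M) : b = 1 := by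
    have h2 : x * b * x⁻¹ ∈ core M := by
      change ⟨_, _, _⟩ ∈ M
      simpa [mul_def, inv_def, mul_assoc] using mul_mem (mul_mem h hb) (inv_mem h)
    rw [hc, Subgroup.mem_bot] at h2
    simpa using h2
  have h2 {a b b' : A} (hb : (⟨a, b, false⟩ : WreathTwo A) ∈ M) (hb' : ⟨a, b', false⟩ ∈ M) :
      b = b' := by
    have := h1 (b * b'⁻¹) (by simpa [mul_def, inv_def] using mul_mem hb (inv_mem hb'))
    exact mul_inv_eq_one.mp this
  choose φ hφ using fun a ↦ (hp ▸ Subgroup.mem_top a : a ∈ proj M)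
  refine ⟨⟨⟨φ, h2 (hφ 1) (one_mem M)⟩, fun a b ↦ h2 (hφ _) ?_⟩, fun a b ↦ ⟨fun h ↦ h2 h (hφ a), ?_⟩⟩
  · simpa [mul_def] using mul_mem (hφ a) (hφ b)
  · rintro rfl
    exact hφ a

end WreathTwo

namespace AltFive

open WreathTwo

/-- The element of the wreath product that interchanges the factors and has label `f`, the square
of which has first component `z * z`. -/
def twisted (z f : AltFive) : WreathTwo AltFive := ⟨z * f⁻¹, f * z, true⟩

variable {M : Subgroup (WreathTwo AltFive)} {z f : AltFive}

theorem sq_mem_of_twisted_mem (h : twisted z f ∈ M) :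
    (⟨z * z, f * (z * z) * f⁻¹, false⟩ : WreathTwo AltFive) ∈ M := by
  simpa [twisted, mul_def, mul_assoc] using mul_mem h h

theorem sq_pow_two : ∀ z : AltFive, z.order = 3 → (z * z) ^ 2 = z := by decide +kernel

theorem sq_pow_three : ∀ z : AltFive, z.order = 5 → (z * z) ^ 3 = z := by decide +kernel

theorem exists_sq_pow (hz : z.order = 3 ∨ z.order = 5) : ∃ n : ℕ, (z * z) ^ n = z :=
  hz.elim (fun h ↦ ⟨2, sq_pow_two z h⟩) fun h ↦ ⟨3, sq_pow_three z h⟩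

theorem mem_proj_of_twisted_mem (h : twisted z f ∈ M) (hz : z.order = 3 ∨ z.order = 5) :
    z ∈ proj M := by
  obtain ⟨n, hn⟩ := exists_sq_pow hz
  have h2 : z * z ∈ proj M := ⟨_, sq_mem_of_twisted_mem h⟩
  exact hn ▸ pow_mem h2 n

theorem label_mem_proj {z' f' : AltFive} (h : twisted z f ∈ M) (h' : twisted z' f' ∈ M)
    (hz : z ∈ proj M) (hz' : z' ∈ proj M) : f'⁻¹ * f ∈ proj M := by
  have := mul_mem (mul_mem (inv_mem hz') (mem_proj_of_swap h h')) hz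
  simpa [mul_assoc] using this

variable {φ : AltFive →* AltFive}

theorem hom_apply_of_twisted_mem
    (hφ : ∀ a b, (⟨a, b, false⟩ : WreathTwo AltFive) ∈ M ↔ b = φ a) (h : twisted z f ∈ M)
    (hz : z.order = 3 ∨ z.order = 5) : φ z = f * z * f⁻¹ := by
  obtain ⟨n, hn⟩ := exists_sq_pow hz
  rw [← hn, map_pow, ← (hφ _ _).mp (sq_mem_of_twisted_mem h), conj_pow]

theorem hom_eq_conj
    (hφ : ∀ a b, (⟨a, b, false⟩ : WreathTwo AltFive) ∈ M ↔ b = φ a) (h : twisted z f ∈ M)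
    (hz : z.order = 5) (a : AltFive) : φ a = f * a * f⁻¹ := by
  let ψ : AltFive →* AltFive := (MulAut.conj f⁻¹).toMonoidHom.comp φ
  have hψ (a) : ψ a = f⁻¹ * φ a * f := by simp [ψ]
  have hψz : ψ z = z := by
    rw [hψ, hom_apply_of_twisted_mem hφ h (Or.inr hz)]
    group
  have hinv (a) : ψ (ψ a) = a := by
    have h2 := mul_mem (mul_mem h ((hφ a _).mpr rfl)) (inv_mem h)
    simp only [twisted, mul_def, inv_def, cond_true, Bool.xor_false, Bool.xor_self] at h2
    have h4 : ψ (z * ψ a * z⁻¹) = z * a * z⁻¹ := by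
      rw [hψ (z * ψ a * z⁻¹), hψ a,
        show z * (f⁻¹ * φ a * f) * z⁻¹ = z * f⁻¹ * φ a * (z * f⁻¹)⁻¹ by group, ← (hφ _ _).mp h2]
      group
    rw [map_mul, map_mul, map_inv, hψz] at h4
    simpa using h4
  have h5 := eq_id_of_involutive ψ hinv hz hψz a
  rw [hψ] at h5
  calc φ a = f * (f⁻¹ * φ a * f) * f⁻¹ := by group
    _ = f * a * f⁻¹ := by rw [h5]

theorem inv_ne_self : ∀ z : AltFive, z.order = 3 → z⁻¹ ≠ z ∧ (z * z)⁻¹ ≠ z * z := by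
  decide +kernel

theorem label_eq_of_order_three
    (hφ : ∀ a b, (⟨a, b, false⟩ : WreathTwo AltFive) ∈ M ↔ b = φ a) {f' : AltFive}
    (h : twisted z f ∈ M) (h' : twisted z f' ∈ M) (hz : z.order = 3) : f = f' := by
  have hφz := hom_apply_of_twisted_mem hφ h (Or.inl hz)
  have hφz' := hom_apply_of_twisted_mem hφ h' (Or.inl hz)
  have hcomm : f⁻¹ * f' * z = z * (f⁻¹ * f') := by
    calc f⁻¹ * f' * z = f⁻¹ * (f' * z * f'⁻¹) * f' := by group
      _ = z * (f⁻¹ * f') := by rw [← hφz', hφz]; group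
  obtain ⟨w, hw⟩ : ∃ w, f⁻¹ * f' = w := ⟨_, rfl⟩
  have hf' : f' = f * w := by rw [← hw, mul_inv_cancel_left]
  rw [hw] at hcomm
  have hwφ : φ w⁻¹ = f * w * f⁻¹ := by
    have := mul_mem h' (inv_mem h)
    simp only [twisted, mul_def, inv_def, cond_true, Bool.xor_self] at this
    rw [hf'] at this
    calc φ w⁻¹ = φ (z * (f * w)⁻¹ * (z * f⁻¹)⁻¹) := by
          congr 1
          rw [show z * (f * w)⁻¹ * (z * f⁻¹)⁻¹ = z * (z * w)⁻¹ by group, ← hcomm]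
          group
      _ = f * w * z * (f * z)⁻¹ := ((hφ _ _).mp this).symm
      _ = _ := by group
  have hww (hw2 : φ w = f * w * f⁻¹) : w⁻¹ = w := by
    rw [map_inv, hw2, conj_inv] at hwφ
    exact mul_left_cancel (mul_right_cancel hwφ)
  rcases eq_of_commute_of_order z hz w hcomm with rfl | rfl | rfl
  · rw [hf', mul_one]
  · exact absurd (hww hφz) (inv_ne_self _ hz).1
  · refine absurd (hww ?_) (inv_ne_self _ hz).2
    rw [map_mul, hφz]
    group

theorem card_order_three : (Finset.univ.filter fun z : AltFive ↦ z.order = 3).card = 20 := by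
  decide +kernel

theorem card_normalizer_le : ∀ z : AltFive, z.order = 3 →
    (Finset.univ.filter fun k : AltFive ↦ k * z * k⁻¹ = z ∨ k * z * k⁻¹ = z * z).card ≤ 6 := by
  decide +kernel

/-- The proper subgroups of the wreath product, by the twisted elements they contain. -/
theorem twisted_mem_cases (hM : M ≠ ⊤) :
    (∃ p q, ∀ z f, twisted z f ∈ M → z.order ≠ 3 ∧ (z.order = 5 → six z p = p ∧ six f p = q)) ∨
    (∃ p q, ∀ z f, twisted z f ∈ M → z.order ≠ 5 ∧ (z.order = 3 → five z p = p ∧ five f p = q)) ∨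
    ∃ l, (∀ z f, twisted z f ∈ M → z.order = 5 → f = l) ∧
      {x : AltFive × AltFive | x.1.order = 3 ∧ twisted x.1 x.2 ∈ M}.ncard ≤ 20 := by
  classical
  by_cases hp : proj M = ⊤
  · right; right
    by_cases hne : ∃ z f, twisted z f ∈ M
    · obtain ⟨z₀, f₀, h₀⟩ := hne
      have hc : core M = ⊥ := by
        by_contra hc
        obtain ⟨n, hn, hn1⟩ := (Subgroup.bot_or_exists_ne_one _).resolve_left hc
        exact hM (eq_top_of_core_eq_top (eq_top_of_conj_mem
          (fun a b hb ↦ conj_mem_core (hp ▸ Subgroup.mem_top a) hb) hn hn1) h₀)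
      obtain ⟨φ, hφ⟩ := exists_hom hp hc h₀
      refine exists_and_right.mpr ⟨?_, ?_⟩
      · by_cases h5 : ∃ z f, twisted z f ∈ M ∧ z.order = 5
        · obtain ⟨z₁, l, h₁, hz₁⟩ := h5
          refine ⟨l, fun z f h hz ↦ ?_⟩
          refine inv_mul_eq_one.mp (eq_one_of_commute _ fun b ↦ ?_)
          have hb := (hom_eq_conj hφ h hz b).symm.trans (hom_eq_conj hφ h₁ hz₁ b)
          calc f⁻¹ * l * b = f⁻¹ * (l * b * l⁻¹) * l := by group
            _ = b * (f⁻¹ * l) := by rw [← hb]; group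
        · exact ⟨1, fun z f h hz ↦ absurd ⟨z, f, h, hz⟩ h5⟩
      · rw [← card_order_three, ← Set.ncard_coe_finset]
        refine Set.ncard_le_ncard_of_injOn Prod.fst (fun x hx ↦ by simpa using hx.1) ?_
        rintro ⟨z, f⟩ ⟨hz, h⟩ ⟨z', f'⟩ ⟨-, h'⟩ (rfl : z = z')
        exact congrArg (z, ·) (label_eq_of_order_three hφ h h' hz)
    · refine ⟨1, fun z f h ↦ absurd ⟨z, f, h⟩ hne, ?_⟩
      rw [(Set.eq_empty_of_forall_notMem fun x hx ↦ hne ⟨_, _, hx.2⟩ :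
        {x : AltFive × AltFive | x.1.order = 3 ∧ twisted x.1 x.2 ∈ M} = ∅), Set.ncard_empty]
      norm_num
  by_cases h5 : ∃ z f, twisted z f ∈ M ∧ z.order = 5
  · obtain ⟨z₀, f₀, h₀, hz₀⟩ := h5
    obtain ⟨p, hzp⟩ := exists_six_eq z₀ (by omega)
    have hmem₀ := mem_proj_of_twisted_mem h₀ (Or.inr hz₀)
    have hfix {k} (hk : k ∈ proj M) : six k p = p := six_eq_of_mem hp hmem₀ hz₀ hzp hk
    refine Or.inl ⟨p, six f₀ p, fun z f h ↦ ⟨fun hz ↦ ?_, fun hz ↦ ?_⟩⟩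
    · exact six_ne_of_order z hz p (hfix (mem_proj_of_twisted_mem h (Or.inl hz)))
    · have hmem := mem_proj_of_twisted_mem h (Or.inr hz)
      refine ⟨hfix hmem, ?_⟩
      conv_rhs => rw [← hfix (label_mem_proj h h₀ hmem hmem₀), ← six_mul, mul_inv_cancel_left]
  by_cases h3 : ∃ z f, twisted z f ∈ M ∧ z.order = 3
  · obtain ⟨z₀, f₀, h₀, hz₀⟩ := h3
    have hmem₀ := mem_proj_of_twisted_mem h₀ (Or.inl hz₀)
    by_cases hfix : ∃ p, ∀ k ∈ proj M, five k p = p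
    · obtain ⟨p, hfix⟩ := hfix
      refine Or.inr (Or.inl ⟨p, five f₀ p, fun z f h ↦
        ⟨fun hz ↦ h5 ⟨z, f, h, hz⟩, fun hz ↦ ?_⟩⟩)
      have hmem := mem_proj_of_twisted_mem h (Or.inl hz)
      refine ⟨hfix _ hmem, ?_⟩
      have := hfix _ (label_mem_proj h h₀ hmem hmem₀)
      conv_rhs => rw [← this, ← five_mul, mul_inv_cancel_left]
    · refine Or.inr (Or.inr ⟨1, fun z f h hz ↦ absurd ⟨z, f, h, hz⟩ h5, ?_⟩)
      have hthree {d} (hd : d ∈ proj M) (hd3 : d.order = 3) : d = z₀ ∨ d = z₀ * z₀ := by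
        by_contra hcon
        exact hfix (five_eq_of_mem hp hmem₀ hz₀ hd hd3 hcon)
      let N := Finset.univ.filter fun k : AltFive ↦ k * z₀ * k⁻¹ = z₀ ∨ k * z₀ * k⁻¹ = z₀ * z₀
      have hsub : {x : AltFive × AltFive | x.1.order = 3 ∧ twisted x.1 x.2 ∈ M} ⊆
          ((({z₀, z₀ * z₀} : Finset AltFive) ×ˢ N.image fun k ↦ f₀ * k :
            Finset (AltFive × AltFive)) : Set (AltFive × AltFive)) := by
        rintro ⟨z, f⟩ ⟨hz, h⟩
        have hmem := mem_proj_of_twisted_mem h (Or.inl hz)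
        have hk := label_mem_proj h h₀ hmem hmem₀
        simp only [Finset.coe_product, Set.mem_prod, Finset.mem_coe, Finset.mem_insert,
          Finset.mem_singleton, Finset.mem_image]
        refine ⟨hthree hmem hz, f₀⁻¹ * f, ?_, mul_inv_cancel_left _ _⟩
        simp only [N, Finset.mem_filter, Finset.mem_univ, true_and]
        refine hthree (mul_mem (mul_mem hk hmem₀) (inv_mem hk)) ?_
        rw [← orderOf_eq, ← hz₀, ← orderOf_eq z₀]
        exact MulEquiv.orderOf_eq (MulAut.conj (f₀⁻¹ * f)) z₀
      refine (Set.ncard_le_ncard hsub (Finset.finite_toSet _)).trans ?_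
      rw [Set.ncard_coe_finset, Finset.card_product]
      have h1 : (N.image fun k ↦ f₀ * k).card ≤ 6 :=
        Finset.card_image_le.trans (card_normalizer_le z₀ hz₀)
      have h2 : ({z₀, z₀ * z₀} : Finset AltFive).card ≤ 2 := Finset.card_le_two
      nlinarith
  · refine Or.inr (Or.inr ⟨1, fun z f h hz ↦ absurd ⟨z, f, h, hz⟩ h5, ?_⟩)
    rw [(Set.eq_empty_of_forall_notMem fun x hx ↦ h3 ⟨_, _, hx.2, hx.1⟩ :
      {x : AltFive × AltFive | x.1.order = 3 ∧ twisted x.1 x.2 ∈ M} = ∅), Set.ncard_empty]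
    norm_num

end AltFive

namespace AltFive

theorem card_six_eq : ∀ p u : Fin 6,
    (Finset.univ.filter fun f : AltFive ↦ six f p = u).card = 10 := by
  decide +kernel

theorem card_six_fixed_le : ∀ p q : Fin 6, p ≠ q →
    (Finset.univ.filter fun f : AltFive ↦ six f p = p ∧ six f q = q).card ≤ 2 := by
  decide +kernel

theorem card_five_fixed : ∀ p q : Fin 5, p ≠ q →
    (Finset.univ.filter fun f : AltFive ↦ five f p = p ∧ five f q = q).card = 3 := by
  decide +kernel

theorem card_order_three_five_fixed : ∀ p q : Fin 5, p ≠ q →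
    (Finset.univ.filter fun z : AltFive ↦ z.order = 3 ∧ five z p = p ∧ five z q = q).card = 2 := by
  decide +kernel

theorem exists_five_eq : ∀ p q : Fin 5, p ≠ q → ∀ u v : Fin 5, u ≠ v →
    ∃ f, five f p = u ∧ five f q = v := by
  decide +kernel

theorem five_fixed_eq : ∀ z : AltFive, z.order = 3 → ∀ p q, p < q ∧ five z p = p ∧ five z q = q →
    ∀ r, five z r = r → r = p ∨ r = q := by
  decide +kernel

theorem exists_order_five_fixing : ∀ p : Fin 6, ∃ z : AltFive, z.order = 5 ∧ six z p = p ∧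
    ∀ q, six z q = q → q = p := by
  decide +kernel

theorem card_six_mem (p : Fin 6) (R : Finset (Fin 6)) :
    (Finset.univ.filter fun f : AltFive ↦ six f p ∈ R).card = 10 * R.card := by
  rw [Finset.card_eq_sum_card_fiberwise (f := fun f ↦ six f p) (t := R)
    fun f hf ↦ by simpa using hf, mul_comm, ← smul_eq_mul, ← Finset.sum_const]
  refine Finset.sum_congr rfl fun u hu ↦ ?_
  rw [← card_six_eq p u, Finset.filter_filter]
  congr 1
  ext f
  simp only [Finset.mem_filter, Finset.mem_univ, true_and, and_iff_right_iff_imp]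
  rintro rfl
  exact hu

theorem card_six_mem_mem_le {p q : Fin 6} (hpq : p ≠ q) (R R' : Finset (Fin 6)) :
    (Finset.univ.filter fun f : AltFive ↦ six f p ∈ R ∧ six f q ∈ R').card ≤
      2 * (R.card * R'.card) := by
  rw [← Finset.card_product, mul_comm, ← smul_eq_mul, ← Finset.sum_const]
  rw [Finset.card_eq_sum_card_fiberwise (f := fun f ↦ (six f p, six f q)) (t := R ×ˢ R')
    fun f hf ↦ by simpa using hf]
  refine Finset.sum_le_sum fun u _ ↦ ?_
  rcases Finset.eq_empty_or_nonempty (Finset.filter (fun f ↦ (six f p, six f q) = u)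
    (Finset.univ.filter fun f : AltFive ↦ six f p ∈ R ∧ six f q ∈ R')) with h | ⟨f₀, hf₀⟩
  · rw [h]
    simp
  · refine le_trans ?_ (card_six_fixed_le p q hpq)
    refine Finset.card_le_card_of_injOn (f₀⁻¹ * ·) (fun f hf ↦ ?_) fun _ _ _ _ h ↦
      mul_left_cancel h
    simp only [Finset.coe_filter, Finset.mem_filter, Finset.mem_univ, true_and,
      Set.mem_ofPred_eq] at hf hf₀ ⊢
    have h1 := hf.2.trans hf₀.2.symm
    rw [Prod.mk.injEq] at h1
    rw [six_mul, h1.1, six_mul, h1.2, ← six_mul, ← six_mul, inv_mul_cancel, one_six, one_six]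
    exact ⟨rfl, rfl⟩

theorem le_card_five_mem_mem {p q : Fin 5} (hpq : p ≠ q) (R R' : Finset (Fin 5)) :
    3 * (R.card * R'.card - min R.card R'.card) ≤
      (Finset.univ.filter fun f : AltFive ↦ five f p ∈ R ∧ five f q ∈ R').card := by
  have h1 : R.card * R'.card - min R.card R'.card ≤
      ((R ×ˢ R').filter fun u ↦ u.1 ≠ u.2).card := by
    have h2 := Finset.card_filter_add_card_filter_not (s := R ×ˢ R') fun u ↦ u.1 = u.2
    have h3 : ((R ×ˢ R').filter fun u ↦ u.1 = u.2).card ≤ R.card := by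
      refine Finset.card_le_card_of_injOn Prod.fst (fun u hu ↦ ?_) ?_
      · simp at hu
        exact hu.1.1
      · rintro ⟨a, b⟩ h ⟨c, d⟩ h' (rfl : a = c)
        simp at h h'
        rw [← h.2, ← h'.2]
    have h4 : ((R ×ˢ R').filter fun u ↦ u.1 = u.2).card ≤ R'.card := by
      refine Finset.card_le_card_of_injOn Prod.snd (fun u hu ↦ ?_) ?_
      · simp at hu
        exact hu.1.2
      · rintro ⟨a, b⟩ h ⟨c, d⟩ h' (rfl : b = d)
        simp at h h'
        rw [h.2, h'.2]
    rw [Finset.card_product] at h2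
    have := le_min h3 h4
    simp only [ne_eq]
    omega
  refine (Nat.mul_le_mul_left 3 h1).trans ?_
  rw [mul_comm, ← smul_eq_mul, ← Finset.sum_const]
  refine le_trans ?_ (Finset.card_le_card (Finset.filter_subset
    (fun f ↦ (five f p, five f q) ∈ (R ×ˢ R').filter fun u ↦ u.1 ≠ u.2) _))
  rw [Finset.card_eq_sum_card_fiberwise (f := fun f ↦ (five f p, five f q))
    (t := (R ×ˢ R').filter fun u ↦ u.1 ≠ u.2) fun f hf ↦
      Finset.mem_coe.mpr (Finset.mem_filter.mp (Finset.mem_coe.mp hf)).2]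
  refine Finset.sum_le_sum fun u hu ↦ ?_
  obtain ⟨f₀, h₀, h₀'⟩ := exists_five_eq p q hpq u.1 u.2 (Finset.mem_filter.mp hu).2
  rw [← card_five_fixed p q hpq]
  refine Finset.card_le_card_of_injOn (f₀ * ·) (fun f hf ↦ ?_) fun _ _ _ _ h ↦ mul_left_cancel h
  simp only [Finset.coe_filter, Finset.mem_filter, Finset.mem_univ, true_and,
    Set.mem_ofPred_eq] at hf ⊢
  have h5 : (five (f₀ * f) p, five (f₀ * f) q) = u := by
    rw [five_mul, hf.1, five_mul, hf.2, h₀, h₀']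
  rw [← h5] at hu
  exact ⟨⟨Finset.mem_product.mp (Finset.mem_filter.mp hu).1, Finset.mem_filter.mp hu⟩, h5⟩

theorem profile_bounds_fin : ∀ a b c d e : Fin 6,
    let h (x y : Fin 6) : ℕ := x.val * y.val - min x.val y.val
    let s := a.val + b.val + c.val + d.val + e.val
    let g := 3 * (h a b + h a c + h a d + h a e + h b c + h b d + h b e + h c d + h c e + h d e)
    12 * s ≤ g + 60 ∧ 24 * s ≤ g + 180 ∧ 36 * s ≤ g + 360 ∧ 48 * s ≤ g + 600 := by
  decide +kernel

theorem profile_bounds {r : Fin 5 → ℕ} (hr : ∀ i, r i < 6) :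
    let g := 3 * ∑ i, ∑ j, if i < j then r i * r j - min (r i) (r j) else 0
    12 * ∑ i, r i ≤ g + 60 ∧ 24 * ∑ i, r i ≤ g + 180 ∧ 36 * ∑ i, r i ≤ g + 360 ∧
      48 * ∑ i, r i ≤ g + 600 := by
  have h0 := hr 0
  have h1 := hr 1
  have h2 := hr 2
  have h3 := hr 3
  have h4 := hr 4
  simp only [Fin.sum_univ_five]
  generalize r 0 = a, r 1 = b, r 2 = c, r 3 = d, r 4 = e at *
  have hb := profile_bounds_fin ⟨a, h0⟩ ⟨b, h1⟩ ⟨c, h2⟩ ⟨d, h3⟩ ⟨e, h4⟩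
  simp at hb ⊢
  omega

theorem card_add_sum_card_fiber {α β : Type*} [Fintype α] [Fintype β] [DecidableEq α]
    [DecidableEq β] (D : Finset (α × β)) :
    D.card + ∑ p, (Finset.univ.filter fun u ↦ (p, u) ∉ D).card = Fintype.card (α × β) := by
  rw [← Finset.card_add_card_compl D, Finset.card_eq_sum_card_fiberwise (s := Dᶜ) (f := Prod.fst)
    (t := Finset.univ) fun _ _ ↦ by simp]
  refine congrArg _ (Finset.sum_congr rfl fun p _ ↦ ?_)
  refine Finset.card_bij' (fun u _ ↦ (p, u)) (fun x _ ↦ x.2) ?_ ?_ ?_ ?_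
  · intro u hu
    simpa using hu
  · rintro ⟨a, b⟩ h
    simp only [Finset.mem_filter, Finset.mem_compl] at h
    obtain ⟨h, rfl⟩ := h
    simpa using h
  · intro u hu
    rfl
  · rintro ⟨a, b⟩ h
    simp only [Finset.mem_filter, Finset.mem_compl] at h
    rw [← h.2]

variable {D : Finset (Fin 6 × Fin 6)} {A : Finset (Fin 5 × Fin 5)} {L : Finset AltFive} {n : ℕ}

theorem label_bounds (hL : L.card ≤ n) (hX : ∀ f p, (p, six f p) ∈ D ∨ f ∈ L) :
    ∃ a b : ℕ, b ≤ a ∧ a ≤ 6 ∧ 36 ≤ D.card + a + 5 * b ∧ 10 * a ≤ n ∧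
      10 * a + 10 * b ≤ n + 2 * (a * b) := by
  let R (p : Fin 6) : Finset (Fin 6) := Finset.univ.filter fun u ↦ (p, u) ∉ D
  have hsum : D.card + ∑ p, (R p).card = 36 := by
    rw [card_add_sum_card_fiber]
    simp
  have hsub (p) : (Finset.univ.filter fun f : AltFive ↦ six f p ∈ R p) ⊆ L := fun f hf ↦ by
    simp only [R, Finset.mem_filter, Finset.mem_univ, true_and] at hf
    exact (hX f p).resolve_left hf
  obtain ⟨p, -, hp⟩ := Finset.exists_max_image Finset.univ (fun p ↦ (R p).card)
    Finset.univ_nonempty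
  obtain ⟨q, hq, hqmax⟩ := Finset.exists_max_image (Finset.univ.erase p) (fun p ↦ (R p).card)
    (by rw [← Finset.card_pos, Finset.card_erase_of_mem (Finset.mem_univ _)]; simp)
  refine ⟨(R p).card, (R q).card, hp q (Finset.mem_univ _), card_finset_fin_le _, ?_, ?_, ?_⟩
  · rw [← Finset.add_sum_erase _ _ (Finset.mem_univ p)] at hsum
    have := Finset.sum_le_card_nsmul _ _ _ hqmax
    rw [Finset.card_erase_of_mem (Finset.mem_univ _)] at this
    simp only [Finset.card_univ, Fintype.card_fin, smul_eq_mul] at this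
    omega
  · exact (card_six_mem p (R p) ▸ Finset.card_le_card (hsub p)).trans hL
  · have h1 := Finset.card_union_add_card_inter
      (Finset.univ.filter fun f : AltFive ↦ six f p ∈ R p)
      (Finset.univ.filter fun f : AltFive ↦ six f q ∈ R q)
    rw [card_six_mem, card_six_mem, ← Finset.filter_and] at h1
    have h2 := card_six_mem_mem_le (Finset.ne_of_mem_erase hq).symm (R p) (R q)
    have h3 := Finset.card_le_card (Finset.union_subset (hsub p) (hsub q))
    omega

theorem profile_le (hY : (Finset.univ.filter fun x : AltFive × AltFive ↦
      x.1.order = 3 ∧ ∀ p, five x.1 p = p → (p, five x.2 p) ∉ A).card ≤ 20 * n) :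
    ∃ s : ℕ, A.card + s = 25 ∧
      12 * s ≤ 10 * n + 60 ∧ 24 * s ≤ 10 * n + 180 ∧ 36 * s ≤ 10 * n + 360 ∧
        48 * s ≤ 10 * n + 600 := by
  let R (p : Fin 5) : Finset (Fin 5) := Finset.univ.filter fun u ↦ (p, u) ∉ A
  have hsum : A.card + ∑ p, (R p).card = 25 := by
    rw [card_add_sum_card_fiber]
    simp
  let W (x : Fin 5 × Fin 5) : Finset (AltFive × AltFive) :=
    (Finset.univ.filter fun z ↦ z.order = 3 ∧ five z x.1 = x.1 ∧ five z x.2 = x.2) ×ˢ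
      Finset.univ.filter fun f ↦ five f x.1 ∈ R x.1 ∧ five f x.2 ∈ R x.2
  let I := Finset.univ.filter fun x : Fin 5 × Fin 5 ↦ x.1 < x.2
  have hW : ∑ x ∈ I, 6 * ((R x.1).card * (R x.2).card - min (R x.1).card (R x.2).card) ≤
      20 * n := by
    refine le_trans ?_ hY
    refine le_trans (b := (I.biUnion W).card) ?_ (Finset.card_le_card ?_)
    · rw [Finset.card_biUnion]
      · refine Finset.sum_le_sum fun x hx ↦ ?_
        have hne : x.1 ≠ x.2 := (Finset.mem_filter.mp hx).2.ne
        rw [Finset.card_product, card_order_three_five_fixed _ _ hne]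
        have := le_card_five_mem_mem hne (R x.1) (R x.2)
        omega
      · intro x hx y hy hxy
        refine Finset.disjoint_left.mpr ?_
        rintro ⟨z, f⟩ h h'
        simp only [W, Finset.mem_product, Finset.mem_filter, Finset.mem_univ, true_and] at h h'
        have hx := (Finset.mem_filter.mp hx).2
        have hy := (Finset.mem_filter.mp hy).2
        have h1 := five_fixed_eq z h.1.1 x.1 x.2 ⟨hx, h.1.2⟩
        refine hxy (Prod.ext_iff.mpr ?_)
        have h2 := h1 _ h'.1.2.1
        have h3 := h1 _ h'.1.2.2
        rcases h2 with h2 | h2 <;> rcases h3 with h3 | h3 <;> rw [h2, h3] at hy ⊢ <;> omega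
    · intro x hx
      simp only [W, R, I, Finset.mem_biUnion, Finset.mem_product, Finset.mem_filter,
        Finset.mem_univ, true_and] at hx ⊢
      obtain ⟨y, hy, hx⟩ := hx
      refine ⟨hx.1.1, fun p hp ↦ ?_⟩
      rcases five_fixed_eq x.1 hx.1.1 y.1 y.2 ⟨hy, hx.1.2⟩ p hp with
        rfl | rfl
      · exact hx.2.1
      · exact hx.2.2
  have hlt (p) : (R p).card < 6 := Nat.lt_succ_of_le (card_finset_fin_le _)
  have hb := profile_bounds hlt
  refine ⟨_, hsum, ?_⟩
  rw [← Finset.mul_sum, Finset.sum_filter, Fintype.sum_prod_type] at hW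
  dsimp only at hb hW
  omega

theorem card_bound (hL : L.card ≤ n) (hX : ∀ f p, (p, six f p) ∈ D ∨ f ∈ L)
    (hY : (Finset.univ.filter fun x : AltFive × AltFive ↦
      x.1.order = 3 ∧ ∀ p, five x.1 p = p → (p, five x.2 p) ∉ A).card ≤ 20 * n) :
    56 ≤ D.card + A.card + n := by
  obtain ⟨a, b, hba, ha, hD, h1, h2⟩ := label_bounds hL hX
  obtain ⟨s, hs, h3, h4, h5, h6⟩ := profile_le hY
  interval_cases a <;> interval_cases b <;> omega

end AltFive

namespace AltFive

open WreathTwo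

theorem exists_six_ne : ∀ p : Fin 6, ∃ a, six a p ≠ p := by decide +kernel

theorem exists_five_ne : ∀ p : Fin 5, ∃ a, five a p ≠ p := by decide +kernel

theorem exists_five_castSucc_eq : ∀ c : AltFive, c.order = 3 →
    ∃ i : Fin 4, five c i.castSucc = i.castSucc := by
  decide +kernel

theorem exists_order_five_and_three : ∃ a b : AltFive, a.order = 5 ∧ b.order = 3 := by
  decide +kernel

theorem order_conj : ∀ x a : AltFive, (x * a * x⁻¹).order = a.order := fun x a ↦ by
  rw [← orderOf_eq, ← orderOf_eq, ← MulAut.conj_apply, MulEquiv.orderOf_eq]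

theorem coveringNumber_wreath_le : coveringNumber (WreathTwo AltFive) ≤ (57 : ℕ) := by
  let F : Unit ⊕ (Fin 6 × Fin 6) ⊕ (Fin 4 × Fin 5) → Subgroup (WreathTwo AltFive)
    | .inl _ => base AltFive
    | .inr (.inl x) => cell sixHom x.1 x.2
    | .inr (.inr x) => cell fiveHom x.1.castSucc x.2
  refine (coveringNumber_le_of_family F ?_ ?_).trans (by simp)
  · rintro (_ | ⟨p, q⟩ | ⟨i, j⟩) h
    · have h1 : (⟨1, 1, true⟩ : WreathTwo AltFive) ∈ base AltFive := (Subgroup.eq_top_iff' _).mp h _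
      exact Bool.noConfusion (show true = false from h1)
    · obtain ⟨a, ha⟩ := exists_six_ne p
      have h1 : (⟨a, 1, false⟩ : WreathTwo AltFive) ∈ cell sixHom p q := (Subgroup.eq_top_iff' _).mp h _
      exact ha h1.1
    · obtain ⟨a, ha⟩ := exists_five_ne i.castSucc
      have h1 : (⟨a, 1, false⟩ : WreathTwo AltFive) ∈ cell fiveHom i.castSucc j :=
        (Subgroup.eq_top_iff' _).mp h _
      exact ha h1.1
  · rintro ⟨x, y, _ | _⟩
    · exact ⟨.inl (), rfl⟩
    · by_cases h : (x * y).order = 3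
      · obtain ⟨i, hi⟩ := exists_five_castSucc_eq _ h
        exact ⟨.inr (.inr (i, five y i.castSucc)), (five_mul _ _ _).symm.trans hi, rfl⟩
      · obtain ⟨p, hp⟩ := exists_six_eq _ h
        exact ⟨.inr (.inl (p, six y p)), (six_mul _ _ _).symm.trans hp, rfl⟩

variable {M : Subgroup (WreathTwo AltFive)}

theorem swap_notMem (hM : M ≠ ⊤) {a b : AltFive} (ha : a.order = 5) (hb : b.order = 3)
    (h : ⟨a, b, false⟩ ∈ M) (x y : AltFive) : (⟨x, y, true⟩ : WreathTwo AltFive) ∉ M := fun hx ↦ by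
  have hp : proj M = ⊤ := by
    by_contra hp
    have h1 : x * b * x⁻¹ ∈ proj M := ⟨y * a * y⁻¹, by
      simpa [mul_def, inv_def, mul_assoc] using mul_mem (mul_mem hx h) (inv_mem hx)⟩
    exact order_ne_of_mem hp h1 (by rw [order_conj, hb]) ⟨_, h⟩ ha
  have hc : core M = ⊥ := by
    by_contra hc
    obtain ⟨n, hn, hn1⟩ := (Subgroup.bot_or_exists_ne_one _).resolve_left hc
    exact hM (eq_top_of_core_eq_top (eq_top_of_conj_mem
      (fun a b hb ↦ conj_mem_core (hp ▸ Subgroup.mem_top a) hb) hn hn1) hx)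
  obtain ⟨φ, hφ⟩ := exists_hom hp hc hx
  have h1 := orderOf_map_dvd φ a
  rw [← (hφ _ _).mp h, orderOf_eq, orderOf_eq, ha, hb] at h1
  omega

/-- The part of the family of proper subgroups to which a subgroup belongs, with the data recording
its twisted elements. -/
def Fits (M : Subgroup (WreathTwo AltFive)) :
    (Fin 6 × Fin 6) ⊕ (Fin 5 × Fin 5) ⊕ (AltFive × Subgroup (WreathTwo AltFive)) → Prop
  | .inl x => ∀ z f, twisted z f ∈ M → z.order ≠ 3 ∧ (z.order = 5 → six z x.1 = x.1 ∧ six f x.1 = x.2)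
  | .inr (.inl x) =>
    ∀ z f, twisted z f ∈ M → z.order ≠ 5 ∧ (z.order = 3 → five z x.1 = x.1 ∧ five f x.1 = x.2)
  | .inr (.inr x) => x.2 = M ∧ (∀ z f, twisted z f ∈ M → z.order = 5 → f = x.1) ∧
      {y : AltFive × AltFive | y.1.order = 3 ∧ twisted y.1 y.2 ∈ M}.ncard ≤ 20

theorem exists_fits (hM : M ≠ ⊤) : ∃ c, Fits M c := by
  obtain ⟨p, q, h⟩ | ⟨p, q, h⟩ | ⟨l, h⟩ := twisted_mem_cases hM
  · exact ⟨.inl (p, q), h⟩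
  · exact ⟨.inr (.inl (p, q)), h⟩
  · exact ⟨.inr (.inr (l, M)), rfl, h⟩

set_option linter.constructorNameAsVariable false in
open scoped Classical in
theorem le_card_of_twisted_cover {T : Finset (Subgroup (WreathTwo AltFive))}
    (hT : ∀ M ∈ T, M ≠ ⊤) (hcov : ∀ z f, ∃ M ∈ T, twisted z f ∈ M) : 56 ≤ T.card := by
  choose! c hc using fun M hM ↦ exists_fits (hT M hM)
  let I := T.image c
  let O := I.toRight.toRight
  have hcard : I.toLeft.card + (I.toRight.toLeft.card + O.card) ≤ T.card := by
    rw [Finset.card_toLeft_add_card_toRight, Finset.card_toLeft_add_card_toRight]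
    exact Finset.card_image_le
  have hI {M} (hM : M ∈ T) : c M ∈ I := Finset.mem_image_of_mem c hM
  have hbound := card_bound (D := I.toLeft) (A := I.toRight.toLeft) (L := O.image Prod.fst)
    (n := O.card) Finset.card_image_le ?_ ?_
  · omega
  · intro f p
    obtain ⟨z, hz, hzp, hq⟩ := exists_order_five_fixing p
    obtain ⟨M, hM, hzM⟩ := hcov z f
    have h1 := hc M hM
    have h2 := hI hM
    generalize c M = w at h1 h2
    rcases w with ⟨p', q⟩ | ⟨p', q⟩ | ⟨l, N⟩
    · obtain ⟨h3, h4⟩ := (h1 z f hzM).2 hz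
      obtain rfl := hq _ h3
      obtain rfl : six f p' = q := h4
      exact Or.inl (Finset.mem_toLeft.mpr h2)
    · exact ((h1 z f hzM).1 hz).elim
    · obtain rfl : f = l := h1.2.1 z f hzM hz
      exact Or.inr (Finset.mem_image_of_mem Prod.fst
        (Finset.mem_toRight.mpr (Finset.mem_toRight.mpr h2)))
  · rw [mul_comm]
    refine (Finset.card_le_card (t := O.biUnion fun o ↦ Finset.univ.filter fun y ↦
      y.1.order = 3 ∧ twisted y.1 y.2 ∈ o.2) ?_).trans (Finset.card_biUnion_le_card_mul _ _ _ ?_)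
    · rintro ⟨z, f⟩ hzf
      simp only [Finset.mem_filter, Finset.mem_univ, true_and] at hzf
      obtain ⟨M, hM, hzM⟩ := hcov z f
      have h1 := hc M hM
      have h2 := hI hM
      generalize c M = w at h1 h2
      rcases w with ⟨p', q⟩ | ⟨p', q⟩ | ⟨l, N⟩
      · exact ((h1 z f hzM).1 hzf.1).elim
      · obtain ⟨h3, h4⟩ := (h1 z f hzM).2 hzf.1
        obtain rfl : five f p' = q := h4
        exact (hzf.2 p' h3 (Finset.mem_toLeft.mpr (Finset.mem_toRight.mpr h2))).elim
      · refine Finset.mem_biUnion.mpr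
          ⟨(l, N), Finset.mem_toRight.mpr (Finset.mem_toRight.mpr h2), ?_⟩
        obtain rfl : N = M := h1.1
        simpa using ⟨hzf.1, hzM⟩
    · rintro ⟨l, N⟩ hN
      obtain ⟨M, hM, hMc⟩ := Finset.mem_image.mp (Finset.mem_toRight.mp (Finset.mem_toRight.mp hN))
      have h1 := hc M hM
      rw [hMc] at h1
      obtain rfl : N = M := h1.1
      refine le_trans (le_of_eq ?_) h1.2.2
      rw [← Set.ncard_coe_finset, Finset.coe_filter]
      simp

open scoped Classical in
theorem le_coveringNumber_wreath : (57 : ℕ) ≤ coveringNumber (WreathTwo AltFive) := by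
  refine le_coveringNumber fun S hS ↦ ?_
  obtain ⟨a, b, ha, hb⟩ := exists_order_five_and_three
  obtain ⟨M, hM, hab⟩ := hS.2 ⟨a, b, false⟩
  have h1 := le_card_of_twisted_cover (T := S.erase M)
    (fun N hN ↦ hS.1 N (Finset.mem_of_mem_erase hN)) fun z f ↦ by
      obtain ⟨N, hN, h⟩ := hS.2 (twisted z f)
      refine ⟨N, Finset.mem_erase.mpr ⟨?_, hN⟩, h⟩
      rintro rfl
      exact swap_notMem (hS.1 N hN) ha hb hab _ _ h
  rw [Finset.card_erase_of_mem hM] at h1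
  omega

theorem exists_coveringNumber_eq_57 : ∃ (G : Type) (_ : Group G) (_ : Finite G),
    coveringNumber G = (57 : ℕ) :=
  ⟨WreathTwo AltFive, inferInstance, inferInstance,
    le_antisymm coveringNumber_wreath_le le_coveringNumber_wreath⟩

end AltFive

theorem mem_or_eq_prime_pow_add_one : ∀ n ∈ Finset.Icc 26 129, n ∉ badSet →
    n ∈ [29, 31, 36, 40, 46, 57, 63, 64, 67, 71, 73, 85, 86, 92, 121, 127] ∨
      ∃ p ∈ Finset.range 130, ∃ k ∈ Finset.Icc 1 7, p ^ k + 1 = n ∧ p.Prime := by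
  decide +kernel

theorem statement1 :
    ∀ n : ℕ, 26 ≤ n → n ≤ 129 → n ∉ badSet →
      ∃ (G : Type) (_ : Group G) (_ : Finite G), coveringNumber G = (n : ℕ∞) := by
  intro n h₁ h₂ h
  obtain hn | ⟨p, -, k, hk, rfl, hp⟩ :=
    mem_or_eq_prime_pow_add_one n (Finset.mem_Icc.mpr ⟨h₁, h₂⟩) h
  · simp only [List.mem_cons, List.not_mem_nil, or_false] at hn
    rcases hn with rfl | rfl | rfl | rfl | rfl | rfl | rfl | rfl | rfl | rfl | rfl | rfl | rfl |
      rfl | rfl | rfl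
    exacts [exists_coveringNumber_eq_29, exists_coveringNumber_eq_31, exists_coveringNumber_eq_36,
      exists_coveringNumber_eq_40, exists_coveringNumber_eq_46,
      AltFive.exists_coveringNumber_eq_57, exists_coveringNumber_eq_63,
      exists_coveringNumber_eq_64, exists_coveringNumber_eq_67, exists_coveringNumber_eq_71,
      exists_coveringNumber_eq_73, exists_coveringNumber_eq_85, exists_coveringNumber_eq_86,
      exists_coveringNumber_eq_92, exists_coveringNumber_eq_121, exists_coveringNumber_eq_127]
  · exact exists_coveringNumber_eq_prime_pow_add_one p k hp
      (Nat.one_le_iff_ne_zero.mp (Finset.mem_Icc.mp hk).1) (by omega)
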